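/- arXiv:math/0408030 — 2 statements merged into one kernel-verified Lean document; each statement's English description precedes it below -/
import Mathlib

section
/- For N ≥ 3 and p ≥ 2, equality holds in the spherical Young inequality ∫_{S^{N-1}} ∏_{j=1}^N f_j(v_j) dμ ≤ ∏_{j=1}^N ‖f_j‖_{L^p(S^{N-1})} (with nonnegative f_j, not all zero) if and only if each f_j is constant. -/
open MeasureTheory ENNReal

/-- The uniform Borel probability measure on the unit sphere `S^{N-1} ⊆ ℝ^N`. -/
noncomputable def sphereUniform (N : ℕ) :
    Measure (Metric.sphere (0 : EuclideanSpace ℝ (Fin N)) 1) :=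
  ((volume : Measure (EuclideanSpace ℝ (Fin N))).toSphere Set.univ)⁻¹ •
    (volume : Measure (EuclideanSpace ℝ (Fin N))).toSphere

/-- The unit sphere of `ℝ^N`. -/
abbrev USphere (N : ℕ) := Metric.sphere (0 : EuclideanSpace ℝ (Fin N)) 1

namespace SphereYoung

variable {N : ℕ}

lemma sum_sq_coord (v : USphere N) : ∑ j, v.1 j ^ 2 = 1 := by
  have h : ‖v.1‖ = 1 := by simp
  rw [← EuclideanSpace.real_norm_sq_eq, h, one_pow]

lemma abs_coord_le (v : USphere N) (j : Fin N) : |v.1 j| ≤ 1 := by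
  have h := Finset.single_le_sum (f := fun i => v.1 i ^ 2) (fun i _ => sq_nonneg _)
    (Finset.mem_univ j)
  rw [sum_sq_coord] at h
  exact (sq_le_one_iff_abs_le_one _).1 h

lemma coord_mem_Icc (v : USphere N) (j : Fin N) : v.1 j ∈ Set.Icc (-1 : ℝ) 1 :=
  abs_le.1 (abs_coord_le v j)

lemma continuous_coord (j : Fin N) : Continuous fun v : USphere N => v.1 j := by
  fun_prop

lemma sum_sq_coord_erase (v : USphere N) (j : Fin N) :
    ∑ k ∈ Finset.univ.erase j, v.1 k ^ 2 = 1 - v.1 j ^ 2 := by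
  have := Finset.add_sum_erase Finset.univ (fun k => v.1 k ^ 2) (Finset.mem_univ j)
  rw [sum_sq_coord] at this
  linarith

lemma isProbabilityMeasure_sphereUniform (hN : 3 ≤ N) :
    IsProbabilityMeasure (sphereUniform N) := by
  have : Nontrivial (Fin N) := Fin.nontrivial_iff_two_le.2 (by omega)
  have : Nonempty (Fin N) := inferInstance
  refine ⟨?_⟩
  rw [sphereUniform, Measure.smul_apply, smul_eq_mul]
  refine ENNReal.inv_mul_cancel ?_ (measure_ne_top _ _)
  rw [Ne, Measure.measure_univ_eq_zero]
  exact Measure.toSphere_ne_zero _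

instance : IsFiniteMeasure (sphereUniform N) := by
  by_cases h : (volume : Measure (EuclideanSpace ℝ (Fin N))).toSphere Set.univ = 0
  · rw [sphereUniform, Measure.measure_univ_eq_zero.1 h]
    simp only [smul_zero]
    infer_instance
  · exact Measure.smul_finite _ (ENNReal.inv_ne_top.2 h)

instance : (sphereUniform N).IsOpenPosMeasure :=
  Measure.isOpenPosMeasure_smul _ (ENNReal.inv_ne_zero.2 (measure_ne_top _ _))

lemma measure_coord_eq_zero (k : Fin N) : sphereUniform N {v | v.1 k = 0} = 0 := by
  have hm : MeasurableSet {v : USphere N | v.1 k = 0} :=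
    (continuous_coord k).measurable (measurableSet_singleton 0)
  rw [sphereUniform, Measure.smul_apply, Measure.toSphere_apply' _ hm]
  let P : Submodule ℝ (EuclideanSpace ℝ (Fin N)) :=
    LinearMap.ker (EuclideanSpace.proj (𝕜 := ℝ) k : EuclideanSpace ℝ (Fin N) →L[ℝ] ℝ).toLinearMap
  have hP : P ≠ ⊤ := by
    intro h
    have h1 : EuclideanSpace.single k (1 : ℝ) ∈ P := h ▸ Submodule.mem_top
    simp [P] at h1
  have h0 := Measure.addHaar_submodule (volume : Measure (EuclideanSpace ℝ (Fin N))) P hP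
  rw [measure_mono_null _ h0]
  · simp
  · rintro _ ⟨r, _, _, ⟨v, hv, rfl⟩, rfl⟩
    have hv' : v.1 k = 0 := hv
    simp [P, hv']

/-- Coordinates of the rotation by the angle `θ` in the plane spanned by the `j`-th and `k`-th
basis vectors. -/
noncomputable def rotFun (j k : Fin N) (θ : ℝ) (x : EuclideanSpace ℝ (Fin N)) (i : Fin N) : ℝ :=
  if i = j then Real.cos θ * x j - Real.sin θ * x k
  else if i = k then Real.sin θ * x j + Real.cos θ * x k else x i

lemma sum_sq_rotFun {j k : Fin N} (hjk : j ≠ k) (θ : ℝ) (x : EuclideanSpace ℝ (Fin N)) :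
    ∑ i, rotFun j k θ x i ^ 2 = ∑ i, x i ^ 2 := by
  have hk : k ∈ Finset.univ.erase j := Finset.mem_erase.2 ⟨hjk.symm, Finset.mem_univ k⟩
  rw [← Finset.add_sum_erase _ _ (Finset.mem_univ j), ← Finset.add_sum_erase _ _ hk,
    ← Finset.add_sum_erase (a := j) (s := Finset.univ) (fun i => x i ^ 2) (Finset.mem_univ j),
    ← Finset.add_sum_erase _ (fun i => x i ^ 2) hk]
  have : ∑ i ∈ (Finset.univ.erase j).erase k, rotFun j k θ x i ^ 2 =
      ∑ i ∈ (Finset.univ.erase j).erase k, x i ^ 2 := by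
    refine Finset.sum_congr rfl fun i hi => ?_
    simp only [Finset.mem_erase, Finset.mem_univ, and_true] at hi
    simp [rotFun, hi.1, hi.2]
  rw [this]
  simp only [rotFun, if_true, if_neg hjk.symm]
  linear_combination (x j ^ 2 + x k ^ 2) * Real.sin_sq_add_cos_sq θ

/-- Rotation by the angle `θ` in the plane spanned by the `j`-th and `k`-th basis vectors. -/
noncomputable def rot {j k : Fin N} (hjk : j ≠ k) (θ : ℝ) :
    EuclideanSpace ℝ (Fin N) →ₗᵢ[ℝ] EuclideanSpace ℝ (Fin N) where
  toFun x := WithLp.toLp 2 (rotFun j k θ x)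
  map_add' x y := by
    ext i
    simp only [rotFun, PiLp.add_apply]
    split_ifs <;> ring
  map_smul' c x := by
    ext i
    simp only [rotFun, PiLp.smul_apply, smul_eq_mul, RingHom.id_apply]
    split_ifs <;> ring
  norm_map' x := by
    rw [EuclideanSpace.norm_eq, EuclideanSpace.norm_eq]
    simp only [Real.norm_eq_abs, sq_abs]
    exact congrArg _ (sum_sq_rotFun hjk θ x)

lemma rot_apply {j k : Fin N} (hjk : j ≠ k) (θ : ℝ) (x : EuclideanSpace ℝ (Fin N)) (i : Fin N) :
    rot hjk θ x i = rotFun j k θ x i := rfl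

/-- The action of `rot` on the sphere. -/
noncomputable def rotS {j k : Fin N} (hjk : j ≠ k) (θ : ℝ) (v : USphere N) : USphere N :=
  ⟨rot hjk θ v.1, by simp⟩

@[fun_prop]
lemma continuous_rotS {X : Type*} [TopologicalSpace X] {j k : Fin N} (hjk : j ≠ k) {f : X → ℝ}
    {g : X → USphere N} (hf : Continuous f) (hg : Continuous g) :
    Continuous fun x => rotS hjk (f x) (g x) := by
  refine Continuous.subtype_mk ?_ _
  refine (PiLp.continuous_toLp 2 _).comp (continuous_pi fun i => ?_)
  simp only [rotFun]
  split_ifs <;> fun_prop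

lemma rotS_add {j k : Fin N} (hjk : j ≠ k) (s θ : ℝ) (v : USphere N) :
    rotS hjk (s + θ) v = rotS hjk s (rotS hjk θ v) := by
  refine Subtype.ext ?_
  ext i
  simp only [rotS, rot_apply, rotFun, if_true, if_neg hjk.symm, Real.cos_add, Real.sin_add]
  split_ifs <;> ring

lemma map_rotS {j k : Fin N} (hjk : j ≠ k) (θ : ℝ) :
    (sphereUniform N).map (rotS hjk θ) = sphereUniform N := by
  have hc : Continuous (rotS hjk θ) := continuous_rotS hjk continuous_const continuous_id
  rw [sphereUniform, Measure.map_smul]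
  congr 1
  ext s hs
  rw [Measure.map_apply hc.measurable hs, Measure.toSphere_apply' _ hs,
    Measure.toSphere_apply' _ (hc.measurable hs)]
  congr 1
  let e : EuclideanSpace ℝ (Fin N) ≃ₗᵢ[ℝ] EuclideanSpace ℝ (Fin N) :=
    (rot hjk θ).toLinearIsometryEquiv rfl
  have he : ∀ x, e x = rot hjk θ x := fun x => rfl
  have hinv : ∀ v, rotS hjk θ (rotS hjk (-θ) v) = v := fun v => by
    rw [← rotS_add, add_neg_cancel]
    refine Subtype.ext ?_
    ext i
    simp only [rotS, rot_apply, rotFun, Real.cos_zero, Real.sin_zero]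
    split_ifs with h1 h2
    · subst h1; ring
    · subst h2; ring
    · rfl
  conv_rhs => rw [← e.measurePreserving.measure_preimage_equiv (f := e.toHomeomorph.toMeasurableEquiv)]
  congr 1
  ext x
  constructor
  · rintro ⟨r, hr, _, ⟨v, hv, rfl⟩, rfl⟩
    refine ⟨r, hr, _, ⟨rotS hjk θ v, hv, rfl⟩, ?_⟩
    exact ((rot hjk θ).map_smul r v.1).symm
  · rintro ⟨r, hr, _, ⟨v, hv, rfl⟩, hx⟩
    refine ⟨r, hr, _, ⟨rotS hjk (-θ) v, ?_, rfl⟩, ?_⟩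
    · rw [Set.mem_preimage, hinv]; exact hv
    · apply e.injective
      refine Eq.trans ?_ hx
      have : rot hjk θ (rotS hjk (-θ) v).1 = v.1 := congrArg Subtype.val (hinv v)
      rw [map_smul, he, this]

lemma integral_rotS {j k : Fin N} (hjk : j ≠ k) (θ : ℝ) {G : USphere N → ℝ} (hG : Continuous G) :
    ∫ v, G (rotS hjk θ v) ∂sphereUniform N = ∫ v, G v ∂sphereUniform N := by
  have hc : Continuous (rotS hjk θ) := continuous_rotS hjk continuous_const continuous_id
  conv_rhs => rw [← map_rotS hjk θ]
  rw [integral_map hc.aemeasurable hG.aestronglyMeasurable]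

lemma integrable_of_continuous {G : USphere N → ℝ} (hG : Continuous G) :
    Integrable G (sphereUniform N) :=
  hG.integrable_of_hasCompactSupport (HasCompactSupport.of_compactSpace G)

/-- Differentiation under the integral sign over the sphere. -/
lemma hasDerivAt_integral_sphere {w w' : ℝ → USphere N → ℝ} {t₀ : ℝ} {U : Set ℝ} (hU : IsOpen U)
    (ht₀ : t₀ ∈ U) (hw : ∀ t ∈ U, Continuous (w t))
    (hw' : ContinuousOn (fun q : ℝ × USphere N => w' q.1 q.2) (U ×ˢ Set.univ))
    (hd : ∀ t ∈ U, ∀ v, HasDerivAt (fun s => w s v) (w' t v) t) :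
    HasDerivAt (fun t => ∫ v, w t v ∂sphereUniform N) (∫ v, w' t₀ v ∂sphereUniform N) t₀ := by
  obtain ⟨r, hr, hrU⟩ := Metric.nhds_basis_closedBall.mem_iff.1 (hU.mem_nhds ht₀)
  have hK : IsCompact (Metric.closedBall t₀ r ×ˢ (Set.univ : Set (USphere N))) :=
    (isCompact_closedBall t₀ r).prod isCompact_univ
  obtain ⟨C, hC⟩ := hK.exists_bound_of_continuousOn
    (hw'.mono (Set.prod_mono hrU subset_rfl))
  have hw'c : Continuous (w' t₀) := by
    rw [← continuousOn_univ]
    exact hw'.comp (f := fun v => (t₀, v)) (Continuous.prodMk_right t₀).continuousOn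
      fun v _ => ⟨ht₀, Set.mem_univ v⟩
  refine (hasDerivAt_integral_of_dominated_loc_of_deriv_le (bound := fun _ => C)
    (Metric.closedBall_mem_nhds t₀ hr) ?_ (integrable_of_continuous (hw t₀ ht₀))
    hw'c.aestronglyMeasurable ?_ (integrable_const C) ?_).2
  · filter_upwards [hU.mem_nhds ht₀] with t ht using (hw t ht).aestronglyMeasurable
  · exact Filter.Eventually.of_forall fun v t ht => hC (t, v) ⟨ht, Set.mem_univ v⟩
  · exact Filter.Eventually.of_forall fun v t ht => hd t (hrU ht) v

/-- The integral of a derivative along the infinitesimal rotations vanishes. -/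
lemma integral_rot_deriv_eq_zero {j k : Fin N} (hjk : j ≠ k) {G G' : USphere N → ℝ}
    (hG : Continuous G) (hG' : Continuous G')
    (hd : ∀ v, HasDerivAt (fun θ => G (rotS hjk θ v)) (G' v) 0) :
    ∫ v, G' v ∂sphereUniform N = 0 := by
  have hd' : ∀ t v, HasDerivAt (fun θ => G (rotS hjk θ v)) (G' (rotS hjk t v)) t := by
    intro t v
    have h := HasDerivAt.comp_sub_const t t (f := fun θ => G (rotS hjk θ (rotS hjk t v)))
      (f' := G' (rotS hjk t v)) (by rw [sub_self]; exact hd (rotS hjk t v))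
    refine h.congr_of_eventuallyEq (Filter.Eventually.of_forall fun s => ?_)
    simp only
    rw [← rotS_add, sub_add_cancel]
  have h1 := hasDerivAt_integral_sphere (t₀ := 0) isOpen_univ (Set.mem_univ 0)
    (w := fun θ v => G (rotS hjk θ v)) (w' := fun θ v => G' (rotS hjk θ v))
    (fun t _ => hG.comp (continuous_rotS hjk continuous_const continuous_id))
    (hG'.comp (continuous_rotS hjk continuous_fst continuous_snd)).continuousOn (fun t _ v => hd' t v)
  simp only [integral_rotS hjk _ hG, integral_rotS hjk _ hG'] at h1
  exact h1.unique (hasDerivAt_const _ _)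

open Polynomial Filter Topology

/-- The coefficients of the three-term recurrence of the monic Gegenbauer polynomials. -/
noncomputable def gegCoeff (m : ℝ) (n : ℕ) : ℝ :=
  n * (n + m - 1) / ((2 * n + m) * (2 * n + m - 2))

/-- The monic Gegenbauer polynomials with parameter `m / 2`. -/
noncomputable def geg (m : ℝ) : ℕ → ℝ[X]
  | 0 => 1
  | 1 => X
  | n + 2 => X * geg m (n + 1) - C (gegCoeff m (n + 1)) * geg m n

/-- The Gegenbauer differential operator. -/
noncomputable def lap (m : ℝ) (p : ℝ[X]) : ℝ[X] :=
  (1 - X ^ 2) * derivative (derivative p) - C (m + 1) * X * derivative p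

/-- The eigenvalues of `-lap`. -/
noncomputable def eig (m : ℝ) (n : ℕ) : ℝ := n * (n + m)

lemma gegCoeff_succ (m : ℝ) (n : ℕ) :
    gegCoeff m (n + 1) = (n + 1) * (n + m) / ((2 * n + 2 + m) * (2 * n + m)) := by
  rw [gegCoeff]
  push_cast
  congr 1 <;> ring

section

variable {m : ℝ} (hm : 1 ≤ m)
include hm

lemma gegCoeff_succ_le_one (n : ℕ) : gegCoeff m (n + 1) ≤ 1 := by
  have hn : (0 : ℝ) ≤ n := n.cast_nonneg
  rw [gegCoeff_succ m, div_le_one (by positivity)]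
  nlinarith [mul_nonneg hn hn, mul_nonneg hn (by linarith : 0 ≤ m)]

lemma inv_sq_le_gegCoeff_succ (n : ℕ) : 1 / (m + 2) ^ 2 ≤ gegCoeff m (n + 1) := by
  have hn : (0 : ℝ) ≤ n := n.cast_nonneg
  rw [gegCoeff_succ m, div_le_div_iff₀ (by positivity) (by positivity), one_mul]
  have h1 : 2 * n + 2 + m ≤ (n + 1) * (m + 2) := by nlinarith
  have h2 : 2 * n + m ≤ (n + m) * (m + 2) := by nlinarith
  have := mul_le_mul h1 h2 (by positivity) (by positivity)
  linarith

lemma gegCoeff_succ_pos (n : ℕ) : 0 < gegCoeff m (n + 1) :=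
  lt_of_lt_of_le (by positivity) (inv_sq_le_gegCoeff_succ hm n)

lemma eval_derivative_geg_succ (n : ℕ) (x : ℝ) :
    (1 - x ^ 2) * (derivative (geg m (n + 1))).eval x = -(n + 1) * x * (geg m (n + 1)).eval x +
      (n + 1) * (n + m) / (2 * n + m) * (geg m n).eval x ∧
    (1 - x ^ 2) * (derivative (geg m n)).eval x = (n + m) * x * (geg m n).eval x -
      (2 * n + m) * (geg m (n + 1)).eval x := by
  induction n with
  | zero =>
    simp [geg]
    have : m ≠ 0 := by positivity
    field_simp
    ring
  | succ n ih =>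
    obtain ⟨h1, h2⟩ := ih
    have hn : (0 : ℝ) ≤ n := n.cast_nonneg
    have e1 : 2 * (n : ℝ) + m ≠ 0 := by positivity
    have e2 : 2 * (n : ℝ) + 2 + m ≠ 0 := by positivity
    have hr : (geg m (n + 2)).eval x =
        x * (geg m (n + 1)).eval x - gegCoeff m (n + 1) * (geg m n).eval x := by
      simp [geg]
    have hd : (derivative (geg m (n + 2))).eval x = (geg m (n + 1)).eval x +
        x * (derivative (geg m (n + 1))).eval x
        - gegCoeff m (n + 1) * (derivative (geg m n)).eval x := by
      simp [geg]
    have hb := gegCoeff_succ m n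
    set b := gegCoeff m (n + 1)
    have hb' : b * (2 * n + 2 + m) = (n + 1) * (n + m) / (2 * n + m) := by
      rw [hb]; field_simp
    have hb2 : 1 + b * (2 * n + m) = (n + 2) * (n + 1 + m) / (2 * n + 2 + m) := by
      rw [hb]; field_simp; ring
    have A : (1 - x ^ 2) * (derivative (geg m (n + 1))).eval x =
        (n + 1 + m) * x * (geg m (n + 1)).eval x -
        (2 * (n + 1) + m) * (geg m (n + 2)).eval x := by
      rw [h1, hr, ← hb']; ring
    have e3 : ((n : ℝ) + 1 + 1) * (n + 1 + m) / (2 * (n + 1) + m) = 1 + b * (2 * n + m) := by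
      rw [hb2]; congr 1 <;> ring
    push_cast
    refine ⟨?_, A⟩
    rw [show n + 1 + 1 = n + 2 from rfl, e3, hd, hr]
    rw [← hb'] at h1
    linear_combination x * h1 - b * h2

lemma lap_geg (n : ℕ) : lap m (geg m n) = C (-eig m n) * geg m n := by
  cases n with
  | zero => simp [lap, geg, eig]
  | succ n =>
    rw [← sub_eq_zero]
    have hX : (1 - X ^ 2 : ℝ[X]) ≠ 0 := fun h => by
      have := congrArg (eval 0) h
      simp at this
    refine (mul_eq_zero.1 (?_ : (1 - X ^ 2 : ℝ[X]) * _ = 0)).resolve_left hX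
    have hB : (1 - X ^ 2) * derivative (geg m (n + 1)) =
        C (-(n + 1 : ℝ)) * X * geg m (n + 1) + C ((n + 1) * (n + m) / (2 * n + m)) * geg m n := by
      refine Polynomial.funext fun x => ?_
      have := (eval_derivative_geg_succ hm n x).1
      simp only [eval_mul, eval_sub, eval_add, eval_one, eval_pow, eval_X, eval_C]
      linear_combination this
    refine Polynomial.funext fun x => ?_
    obtain ⟨h1, h2⟩ := eval_derivative_geg_succ hm n x
    have h3 := congrArg (fun p => (derivative p).eval x) hB
    simp only [derivative_mul, derivative_sub, derivative_add, derivative_one, derivative_X_pow,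
      derivative_C, derivative_X, eval_mul, eval_sub, eval_add, eval_one, eval_pow, eval_X,
      eval_C, eval_neg, Nat.cast_ofNat, zero_mul, zero_add, zero_sub, mul_one,
      Nat.add_one_sub_one, pow_one] at h3
    have e1 : 2 * (n : ℝ) + m ≠ 0 := by positivity
    have he : (n + 1) * (n + m) / (2 * n + m) * (2 * n + m) = (n + 1) * (n + m) := by
      field_simp
    simp only [lap, eig, eval_mul, eval_sub, eval_one, eval_pow, eval_X, eval_C, eval_zero]
    push_cast
    set e := (n + 1) * (n + m) / (2 * n + m)
    linear_combination (1 - x ^ 2) * h3 + e * h2 - x * (n + m) * h1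
      - (geg m (n + 1)).eval x * he

lemma abs_eval_geg_le (n : ℕ) {x : ℝ} (hx : |x| ≤ 2) : |(geg m n).eval x| ≤ 3 ^ n := by
  induction n using Nat.twoStepInduction with
  | zero => simp [geg]
  | one => simpa [geg] using hx.trans (by norm_num)
  | more n h1 h2 =>
    simp only [geg, eval_sub, eval_mul, eval_X, eval_C]
    refine (abs_sub _ _).trans ?_
    rw [abs_mul, abs_mul, abs_of_pos (gegCoeff_succ_pos hm n)]
    have := mul_le_mul hx h2 (abs_nonneg _) (by norm_num)
    have := mul_le_mul (gegCoeff_succ_le_one hm n) h1 (abs_nonneg _) (by norm_num)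
    have : (0 : ℝ) < 3 ^ n := by positivity
    rw [pow_succ] at *
    rw [pow_succ]
    linarith

lemma abs_eval_derivative_geg_le (n : ℕ) {x : ℝ} (hx : |x| ≤ 2) :
    |(derivative (geg m n)).eval x| ≤ 4 ^ n := by
  induction n using Nat.twoStepInduction with
  | zero => simp [geg]
  | one => simp [geg]
  | more n h1 h2 =>
    simp only [geg, derivative_sub, derivative_mul, derivative_X, derivative_C, eval_sub, eval_add,
      eval_mul, eval_X, eval_C, one_mul, zero_mul, zero_add]
    refine (abs_sub _ _).trans ((add_le_add_left (abs_add_le _ _) _).trans ?_)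
    rw [abs_mul, abs_mul, abs_of_pos (gegCoeff_succ_pos hm n)]
    have h3 := mul_le_mul hx h2 (abs_nonneg _) (by norm_num)
    have h4 := mul_le_mul (gegCoeff_succ_le_one hm n) h1 (abs_nonneg _) (by norm_num)
    have h5 := abs_eval_geg_le hm (n + 1) hx
    have h6 : (3 : ℝ) ^ (n + 1) ≤ 4 ^ (n + 1) := by gcongr; norm_num
    have : (0 : ℝ) < 4 ^ n := by positivity
    rw [pow_succ, pow_succ]
    rw [pow_succ] at h3 h5
    rw [pow_succ, pow_succ] at h6
    linarith

end

lemma mem_span_geg (m : ℝ) (p : ℝ[X]) : p ∈ Submodule.span ℝ (Set.range (geg m)) := by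
  have hX : ∀ q ∈ Submodule.span ℝ (Set.range (geg m)),
      X * q ∈ Submodule.span ℝ (Set.range (geg m)) := by
    intro q hq
    induction hq using Submodule.span_induction with
    | mem q hq =>
      obtain ⟨n, rfl⟩ := hq
      cases n with
      | zero => exact Submodule.subset_span ⟨1, by simp [geg]⟩
      | succ n =>
        have : X * geg m (n + 1) = geg m (n + 2) + gegCoeff m (n + 1) • geg m n := by
          simp [geg, smul_eq_C_mul]
        rw [this]
        exact add_mem (Submodule.subset_span ⟨_, rfl⟩)
          (Submodule.smul_mem _ _ (Submodule.subset_span ⟨_, rfl⟩))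
    | zero => simp
    | add a b _ _ ha hb => rw [mul_add]; exact add_mem ha hb
    | smul c a _ ha => rw [mul_smul_comm]; exact Submodule.smul_mem _ _ ha
  induction p using Polynomial.induction_on with
  | C a =>
    rw [← mul_one (C a), ← smul_eq_C_mul]
    exact Submodule.smul_mem _ _ (Submodule.subset_span ⟨0, by simp [geg]⟩)
  | add p q hp hq => exact add_mem hp hq
  | monomial n a h =>
    have : C a * X ^ (n + 1) = X * (C a * X ^ n) := by ring
    rw [this]
    exact hX _ h

lemma rotS_zero {j k : Fin N} (hjk : j ≠ k) (v : USphere N) : rotS hjk 0 v = v := by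
  refine Subtype.ext ?_
  ext i
  simp only [rotS, rot_apply, rotFun, Real.cos_zero, Real.sin_zero]
  split_ifs with h1 h2
  · subst h1; ring
  · subst h2; ring
  · rfl

lemma hasDerivAt_rotS_coord {j k : Fin N} (hjk : j ≠ k) (v : USphere N) (i : Fin N) :
    HasDerivAt (fun θ => (rotS hjk θ v).1 i)
      (if i = j then -v.1 k else if i = k then v.1 j else 0) 0 := by
  simp only [rotS, rot_apply, rotFun]
  split_ifs with h1 h2
  · simpa using ((Real.hasDerivAt_cos 0).mul_const (v.1 j)).fun_sub
      ((Real.hasDerivAt_sin 0).mul_const (v.1 k))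
  · simpa using ((Real.hasDerivAt_sin 0).mul_const (v.1 j)).fun_add
      ((Real.hasDerivAt_cos 0).mul_const (v.1 k))
  · exact hasDerivAt_const _ _

lemma hasDerivAt_comp_rotS_coord {j k : Fin N} (hjk : j ≠ k) (v : USphere N) (i : Fin N)
    {f : ℝ → ℝ} {f' : ℝ} (hf : HasDerivAt f f' (v.1 i)) :
    HasDerivAt (fun θ => f ((rotS hjk θ v).1 i))
      (f' * (if i = j then -v.1 k else if i = k then v.1 j else 0)) 0 := by
  refine HasDerivAt.comp (0 : ℝ) ?_ (hasDerivAt_rotS_coord hjk v i)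
  rwa [rotS_zero]

lemma continuous_eval_coord (p : ℝ[X]) (j : Fin N) :
    Continuous fun v : USphere N => p.eval (v.1 j) :=
  p.continuous.comp (continuous_coord j)

lemma lap_eval_eq_sum (p : ℝ[X]) (v : USphere N) (j : Fin N) :
    (lap (N - 2) p).eval (v.1 j) = ∑ k ∈ Finset.univ.erase j,
      (v.1 k ^ 2 * (derivative (derivative p)).eval (v.1 j)
        - v.1 j * (derivative p).eval (v.1 j)) := by
  rw [Finset.sum_sub_distrib, ← Finset.sum_mul, sum_sq_coord_erase, Finset.sum_const,
    Finset.card_erase_of_mem (Finset.mem_univ j), Finset.card_univ, Fintype.card_fin, nsmul_eq_mul,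
    Nat.cast_pred j.pos]
  simp only [lap, eval_sub, eval_mul, eval_one, eval_pow, eval_X, eval_C]
  ring

lemma integral_lap_mul (p q : ℝ[X]) (j : Fin N) :
    ∫ v, (lap (N - 2) p).eval (v.1 j) * q.eval (v.1 j) ∂sphereUniform N =
      -∫ v, (1 - v.1 j ^ 2) * ((derivative p).eval (v.1 j) * (derivative q).eval (v.1 j))
        ∂sphereUniform N := by
  rw [← sub_eq_zero, sub_neg_eq_add]
  have hc := fun p => continuous_eval_coord (N := N) p j
  have c1 : Continuous fun v : USphere N => (lap (N - 2) p).eval (v.1 j) * q.eval (v.1 j) :=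
    (hc _).mul (hc _)
  have c2 : Continuous fun v : USphere N =>
      (1 - v.1 j ^ 2) * ((derivative p).eval (v.1 j) * (derivative q).eval (v.1 j)) :=
    (continuous_const.sub ((continuous_coord j).pow 2)).mul ((hc _).mul (hc _))
  rw [← integral_add (integrable_of_continuous c1) (integrable_of_continuous c2)]
  have key : ∀ k ∈ Finset.univ.erase j, ∫ v : USphere N,
      ((v.1 k ^ 2 * (derivative (derivative p)).eval (v.1 j)
        - v.1 j * (derivative p).eval (v.1 j)) * q.eval (v.1 j) +
        v.1 k ^ 2 * ((derivative p).eval (v.1 j) * (derivative q).eval (v.1 j)))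
        ∂sphereUniform N = 0 := by
    intro k hk
    have hjk : j ≠ k := (Finset.ne_of_mem_erase hk).symm
    have ck := continuous_coord k
    have cj := continuous_coord j
    rw [← neg_eq_zero, ← integral_neg]
    refine integral_rot_deriv_eq_zero hjk
      (G := fun v => v.1 k * ((derivative p).eval (v.1 j) * q.eval (v.1 j)))
      (ck.mul ((hc _).mul (hc _)))
      (((((ck.pow 2).mul (hc _)).sub (cj.mul (hc _))).mul (hc _)).add
        ((ck.pow 2).mul ((hc _).mul (hc _)))).neg fun v => ?_
    have h1 := hasDerivAt_rotS_coord hjk v k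
    have h2 := hasDerivAt_comp_rotS_coord hjk v j ((derivative p).hasDerivAt (v.1 j))
    have h3 := hasDerivAt_comp_rotS_coord hjk v j (q.hasDerivAt (v.1 j))
    refine (h1.mul (h2.mul h3)).congr_deriv ?_
    simp only [Pi.mul_apply, rotS_zero, if_true, if_neg hjk.symm]
    ring
  rw [← Finset.sum_eq_zero key, ← integral_finsetSum]
  · refine integral_congr_ae (Filter.Eventually.of_forall fun v => ?_)
    simp only
    rw [Finset.sum_add_distrib, ← Finset.sum_mul, ← Finset.sum_mul, ← lap_eval_eq_sum,
      sum_sq_coord_erase]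
  · intro k _
    have ck := continuous_coord k
    have cj := continuous_coord j
    exact integrable_of_continuous (((((ck.pow 2).mul (hc _)).sub (cj.mul (hc _))).mul (hc _)).add
        ((ck.pow 2).mul ((hc _).mul (hc _))))

/-- The product of the square roots of the coordinate functions `U j`. -/
noncomputable def sqrtProd (U : Fin N → ℝ → ℝ) (v : USphere N) : ℝ :=
  ∏ j, √(U j (v.1 j))

lemma sqrtProd_nonneg (U : Fin N → ℝ → ℝ) (v : USphere N) : 0 ≤ sqrtProd U v :=
  Finset.prod_nonneg fun _ _ => Real.sqrt_nonneg _

lemma prod_erase_sqrt_mul {U : Fin N → ℝ → ℝ} {v : USphere N} {i : Fin N} (h : 0 < U i (v.1 i))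
    (x : ℝ) : (∏ l ∈ Finset.univ.erase i, √(U l (v.1 l))) * (x / (2 * √(U i (v.1 i)))) =
      sqrtProd U v * (x / (2 * U i (v.1 i))) := by
  rw [sqrtProd, ← Finset.mul_prod_erase _ _ (Finset.mem_univ i)]
  have h0 : √(U i (v.1 i)) ≠ 0 := (Real.sqrt_pos.2 h).ne'
  have h1 : x / (2 * U i (v.1 i)) = x / (2 * (√(U i (v.1 i)) * √(U i (v.1 i)))) := by
    rw [Real.mul_self_sqrt h.le]
  rw [h1]
  field_simp

section

variable {U : Fin N → ℝ[X]} (hU : ∀ j, ∀ x ∈ Set.Icc (-1 : ℝ) 1, 0 < (U j).eval x)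

/-- Logarithmic derivative of the coordinate function `U j`. -/
noncomputable def logDer (U : Fin N → ℝ[X]) (j : Fin N) (v : USphere N) : ℝ :=
  (derivative (U j)).eval (v.1 j) / (U j).eval (v.1 j)

lemma continuous_sqrtProd (U : Fin N → ℝ[X]) :
    Continuous (sqrtProd fun j x => (U j).eval x) :=
  continuous_finsetProd _ fun j _ => (continuous_eval_coord (U j) j).sqrt

include hU

lemma continuous_logDer (j : Fin N) : Continuous (logDer U j) :=
  (continuous_eval_coord _ j).div (continuous_eval_coord _ j)
    fun v => (hU j _ (coord_mem_Icc v j)).ne'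

lemma hasDerivAt_sqrtProd_rotS {j k : Fin N} (hjk : j ≠ k) (v : USphere N) :
    HasDerivAt (fun θ => sqrtProd (fun j x => (U j).eval x) (rotS hjk θ v))
      (sqrtProd (fun j x => (U j).eval x) v *
        ((v.1 j * logDer U k v - v.1 k * logDer U j v) / 2)) 0 := by
  have hpos := fun i => hU i _ (coord_mem_Icc v i)
  have h : ∀ i ∈ Finset.univ, HasDerivAt (fun θ => √((U i).eval ((rotS hjk θ v).1 i))) _ 0 :=
    fun i _ => (hasDerivAt_comp_rotS_coord hjk v i ((U i).hasDerivAt (v.1 i))).sqrt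
      (by rw [rotS_zero]; exact (hpos i).ne')
  have h2 := HasDerivAt.fun_finsetProd h
  refine h2.congr_deriv ?_
  simp only [rotS_zero, smul_eq_mul]
  have e := fun i x => prod_erase_sqrt_mul (U := fun j x => (U j).eval x) (hpos i) x
  simp only at e
  simp only [e]
  rw [← Finset.mul_sum]
  congr 1
  rw [← Finset.add_sum_erase _ _ (Finset.mem_univ j),
    ← Finset.add_sum_erase _ _ (Finset.mem_erase.2 ⟨hjk.symm, Finset.mem_univ k⟩),
    Finset.sum_eq_zero]
  · simp only [if_true, if_neg hjk.symm, logDer]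
    have := (hpos j).ne'
    have := (hpos k).ne'
    field_simp
    ring
  · intro i hi
    simp only [Finset.mem_erase, Finset.mem_univ, and_true] at hi
    simp [hi.1, hi.2]

lemma integral_rot_flow {j k : Fin N} (hjk : j ≠ k) :
    ∫ v, sqrtProd (fun j x => (U j).eval x) v *
      ((v.1 k ^ 2 * (derivative (derivative (U j))).eval (v.1 j)
        - v.1 j * (derivative (U j)).eval (v.1 j)) / (2 * (U j).eval (v.1 j))) ∂sphereUniform N =
    ∫ v, sqrtProd (fun j x => (U j).eval x) v *
      (v.1 k * logDer U j v * (v.1 k * logDer U j v + v.1 j * logDer U k v) / 4)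
        ∂sphereUniform N := by
  have ck := continuous_coord k
  have cj := continuous_coord j
  have cF := continuous_sqrtProd U
  have cl := continuous_logDer hU
  have hc := fun p => continuous_eval_coord (N := N) p j
  have hpos := fun i v => hU i _ (coord_mem_Icc v i)
  have c1 : Continuous fun v : USphere N => sqrtProd (fun j x => (U j).eval x) v *
      ((v.1 k ^ 2 * (derivative (derivative (U j))).eval (v.1 j)
        - v.1 j * (derivative (U j)).eval (v.1 j)) / (2 * (U j).eval (v.1 j))) :=
    cF.mul ((((ck.pow 2).mul (hc _)).sub (cj.mul (hc _))).div (continuous_const.mul (hc _))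
      fun v => (mul_pos two_pos (hpos j v)).ne')
  have c2 : Continuous fun v : USphere N => sqrtProd (fun j x => (U j).eval x) v *
      (v.1 k * logDer U j v * (v.1 k * logDer U j v + v.1 j * logDer U k v) / 4) :=
    cF.mul ((((ck.mul (cl j)).mul ((ck.mul (cl j)).add (cj.mul (cl k))))).div_const 4)
  rw [← sub_eq_zero, ← integral_sub (integrable_of_continuous c1) (integrable_of_continuous c2)]
  rw [← neg_eq_zero, ← integral_neg]
  refine integral_rot_deriv_eq_zero hjk
    (G := fun v => v.1 k * (logDer U j v / 2 * sqrtProd (fun j x => (U j).eval x) v))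
    (ck.mul (((cl j).div_const 2).mul cF)) (c1.sub c2).neg fun v => ?_
  have h1 := hasDerivAt_rotS_coord hjk v k
  have hj := (hpos j v).ne'
  have h2 := ((hasDerivAt_comp_rotS_coord hjk v j ((derivative (U j)).hasDerivAt (v.1 j))).div
    (hasDerivAt_comp_rotS_coord hjk v j ((U j).hasDerivAt (v.1 j)))
      (by rw [rotS_zero]; exact hj)).div_const 2
  have h3 := hasDerivAt_sqrtProd_rotS hU hjk v
  refine (h1.mul (h2.mul h3)).congr_deriv ?_
  simp only [Pi.mul_apply, Pi.div_apply, rotS_zero, if_true, if_neg hjk.symm, logDer]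
  have hk := (hpos k v).ne'
  field_simp
  ring

/-- The derivative of the Young functional along the heat flow is a sum of squares. -/
lemma integral_lap_flow :
    ∫ v, ∑ j, sqrtProd (fun j x => (U j).eval x) v *
      ((lap (N - 2) (U j)).eval (v.1 j) / (2 * (U j).eval (v.1 j))) ∂sphereUniform N =
    ∑ j, ∑ k ∈ Finset.univ.erase j, (∫ v, sqrtProd (fun j x => (U j).eval x) v *
      (v.1 k * logDer U j v + v.1 j * logDer U k v) ^ 2 ∂sphereUniform N) / 8 := by
  have cF := continuous_sqrtProd U
  have cl := continuous_logDer hU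
  have hpos := fun i v => hU i _ (coord_mem_Icc v i)
  have c1 : ∀ j k : Fin N, Continuous fun v : USphere N => sqrtProd (fun j x => (U j).eval x) v *
      ((v.1 k ^ 2 * (derivative (derivative (U j))).eval (v.1 j)
        - v.1 j * (derivative (U j)).eval (v.1 j)) / (2 * (U j).eval (v.1 j))) := fun j k =>
    cF.mul (((((continuous_coord k).pow 2).mul (continuous_eval_coord _ j)).sub
      ((continuous_coord j).mul (continuous_eval_coord _ j))).div
        (continuous_const.mul (continuous_eval_coord _ j)) fun v => (mul_pos two_pos (hpos j v)).ne')
  have c2 : ∀ j k : Fin N, Continuous fun v : USphere N => sqrtProd (fun j x => (U j).eval x) v *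
      (v.1 k * logDer U j v * (v.1 k * logDer U j v + v.1 j * logDer U k v) / 4) := fun j k =>
    cF.mul ((((continuous_coord k).mul (cl j)).mul (((continuous_coord k).mul (cl j)).add
      ((continuous_coord j).mul (cl k)))).div_const 4)
  have e1 : ∀ v : USphere N, ∑ j, sqrtProd (fun j x => (U j).eval x) v *
      ((lap (N - 2) (U j)).eval (v.1 j) / (2 * (U j).eval (v.1 j))) =
      ∑ j, ∑ k ∈ Finset.univ.erase j, sqrtProd (fun j x => (U j).eval x) v *
      ((v.1 k ^ 2 * (derivative (derivative (U j))).eval (v.1 j)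
        - v.1 j * (derivative (U j)).eval (v.1 j)) / (2 * (U j).eval (v.1 j))) := fun v =>
    Finset.sum_congr rfl fun j _ => by
      rw [lap_eval_eq_sum, ← Finset.mul_sum, Finset.sum_div]
  simp only [e1]
  rw [integral_finsetSum _ fun j _ => integrable_finsetSum _ fun k _ =>
    integrable_of_continuous (c1 j k)]
  have e2 : ∀ j : Fin N, ∫ v, ∑ k ∈ Finset.univ.erase j, sqrtProd (fun j x => (U j).eval x) v *
      ((v.1 k ^ 2 * (derivative (derivative (U j))).eval (v.1 j)
        - v.1 j * (derivative (U j)).eval (v.1 j)) / (2 * (U j).eval (v.1 j))) ∂sphereUniform N =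
      ∑ k ∈ Finset.univ.erase j, ∫ v, sqrtProd (fun j x => (U j).eval x) v *
      (v.1 k * logDer U j v * (v.1 k * logDer U j v + v.1 j * logDer U k v) / 4)
        ∂sphereUniform N := fun j => by
    rw [integral_finsetSum _ fun k _ => integrable_of_continuous (c1 j k)]
    exact Finset.sum_congr rfl fun k hk => integral_rot_flow hU (Finset.ne_of_mem_erase hk).symm
  simp only [e2]
  have e3 : ∀ j k : Fin N, (∫ v, sqrtProd (fun j x => (U j).eval x) v *
      (v.1 k * logDer U j v + v.1 j * logDer U k v) ^ 2 ∂sphereUniform N) / 8 =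
      (∫ v, sqrtProd (fun j x => (U j).eval x) v *
      (v.1 k * logDer U j v * (v.1 k * logDer U j v + v.1 j * logDer U k v) / 4)
        ∂sphereUniform N) / 2 +
      (∫ v, sqrtProd (fun j x => (U j).eval x) v *
      (v.1 j * logDer U k v * (v.1 j * logDer U k v + v.1 k * logDer U j v) / 4)
        ∂sphereUniform N) / 2 := fun j k => by
    rw [← add_div, ← integral_add (integrable_of_continuous (c2 j k))
      (integrable_of_continuous (c2 k j)), ← integral_div, ← integral_div]
    refine integral_congr_ae (Filter.Eventually.of_forall fun v => ?_)
    simp only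
    ring
  simp only [e3, Finset.sum_add_distrib]
  have e4 : ∀ a : Fin N → Fin N → ℝ, ∑ j, ∑ k ∈ Finset.univ.erase j, a k j =
      ∑ j, ∑ k ∈ Finset.univ.erase j, a j k := fun a =>
    Finset.sum_comm' fun x y => by simp [ne_comm]
  rw [e4 fun j k => (∫ v, sqrtProd (fun j x => (U j).eval x) v *
      (v.1 k * logDer U j v * (v.1 k * logDer U j v + v.1 j * logDer U k v) / 4)
        ∂sphereUniform N) / 2]
  simp only [← Finset.sum_add_distrib, add_halves]

end

lemma one_le_natCast_sub_two (hN : 3 ≤ N) : (1 : ℝ) ≤ (N : ℝ) - 2 := by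
  have : (3 : ℝ) ≤ N := by exact_mod_cast hN
  linarith

lemma eig_lt_eig {m : ℝ} (hm : 1 ≤ m) {n k : ℕ} (h : n < k) : eig m n < eig m k := by
  have h' : (n : ℝ) < k := by exact_mod_cast h
  have h0 : (0 : ℝ) ≤ n := n.cast_nonneg
  simp only [eig]
  nlinarith

lemma sq_le_eig {m : ℝ} (hm : 1 ≤ m) (n : ℕ) : (n : ℝ) ^ 2 ≤ eig m n := by
  have h0 : (0 : ℝ) ≤ n := n.cast_nonneg
  simp only [eig]
  nlinarith

lemma integral_geg_mul_geg_of_ne (hN : 3 ≤ N) (j : Fin N) {n k : ℕ} (hnk : n ≠ k) :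
    ∫ v, (geg (N - 2) n).eval (v.1 j) * (geg (N - 2) k).eval (v.1 j) ∂sphereUniform N = 0 := by
  have hm := one_le_natCast_sub_two hN
  have h1 := integral_lap_mul (geg (N - 2) n) (geg (N - 2) k) j
  have h2 := integral_lap_mul (geg (N - 2) k) (geg (N - 2) n) j
  simp only [mul_comm ((derivative (geg ((N : ℝ) - 2) k)).eval _)] at h2
  rw [← h1] at h2
  simp only [lap_geg hm, eval_mul, eval_C, mul_assoc, integral_const_mul] at h2
  simp only [mul_comm ((geg ((N : ℝ) - 2) k).eval _)] at h2
  have hne : eig ((N : ℝ) - 2) n ≠ eig (N - 2) k := by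
    rcases hnk.lt_or_gt with h | h
    · exact (eig_lt_eig hm h).ne
    · exact (eig_lt_eig hm h).ne'
  have h3 : (eig ((N : ℝ) - 2) n - eig (N - 2) k) *
      ∫ v, (geg (N - 2) n).eval (v.1 j) * (geg (N - 2) k).eval (v.1 j) ∂sphereUniform N = 0 := by
    linear_combination h2
  exact (mul_eq_zero.1 h3).resolve_left (sub_ne_zero.2 hne)

/-- The squared `L²` norms of the monic Gegenbauer polynomials. -/
noncomputable def gegNormSq (m : ℝ) (n : ℕ) : ℝ := ∏ i ∈ Finset.range n, gegCoeff m (i + 1)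

lemma gegNormSq_pos {m : ℝ} (hm : 1 ≤ m) (n : ℕ) : 0 < gegNormSq m n :=
  Finset.prod_pos fun i _ => gegCoeff_succ_pos hm i

lemma pow_le_gegNormSq {m : ℝ} (hm : 1 ≤ m) (n : ℕ) : (1 / (m + 2) ^ 2) ^ n ≤ gegNormSq m n := by
  rw [gegNormSq, ← Finset.card_range n, ← Finset.prod_const, Finset.card_range]
  exact Finset.prod_le_prod (fun _ _ => by positivity) fun i _ => inv_sq_le_gegCoeff_succ hm i

lemma integral_X_mul_geg_mul_geg (j : Fin N) (n k : ℕ) :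
    ∫ v, (X * geg (N - 2) n).eval (v.1 j) * (geg (N - 2) k).eval (v.1 j) ∂sphereUniform N =
      ∫ v, (geg (N - 2) (n + 1)).eval (v.1 j) * (geg (N - 2) k).eval (v.1 j) ∂sphereUniform N +
      if n = 0 then 0 else gegCoeff (N - 2) n * ∫ v, (geg (N - 2) (n - 1)).eval (v.1 j) *
        (geg (N - 2) k).eval (v.1 j) ∂sphereUniform N := by
  cases n with
  | zero => simp [geg]
  | succ n =>
    have hc := fun p q : ℝ[X] => integrable_of_continuous
      (((p * q).continuous).comp (continuous_coord (N := N) j))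
    simp only [Function.comp_def, eval_mul] at hc
    rw [if_neg n.succ_ne_zero, Nat.add_sub_cancel, ← integral_const_mul, ← integral_add
      (hc _ _) ((hc _ _).const_mul _)]
    refine integral_congr_ae (Filter.Eventually.of_forall fun v => ?_)
    simp only [geg, eval_mul, eval_sub, eval_X, eval_C]
    ring

lemma integral_geg_mul_self (hN : 3 ≤ N) (j : Fin N) (n : ℕ) :
    ∫ v, (geg (N - 2) n).eval (v.1 j) * (geg (N - 2) n).eval (v.1 j) ∂sphereUniform N =
      gegNormSq (N - 2) n := by
  have := isProbabilityMeasure_sphereUniform hN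
  induction n with
  | zero => simp [geg, gegNormSq]
  | succ n ih =>
    rw [gegNormSq, Finset.prod_range_succ, ← gegNormSq, ← ih, mul_comm]
    have h1 := integral_X_mul_geg_mul_geg j n (n + 1)
    have h2 := integral_X_mul_geg_mul_geg j (n + 1) n
    rw [if_neg n.succ_ne_zero, Nat.add_sub_cancel,
      integral_geg_mul_geg_of_ne hN j (by omega : n + 1 + 1 ≠ n), zero_add] at h2
    rw [← h2]
    have h3 : (if n = 0 then 0 else gegCoeff (N - 2) n * ∫ v, (geg (N - 2) (n - 1)).eval (v.1 j) *
        (geg (N - 2) (n + 1)).eval (v.1 j) ∂sphereUniform N) = 0 := by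
      rw [integral_geg_mul_geg_of_ne hN j (by omega : n - 1 ≠ n + 1), mul_zero, ite_self]
    rw [h3, add_zero] at h1
    rw [← h1]
    refine integral_congr_ae (Filter.Eventually.of_forall fun v => ?_)
    simp only [eval_mul, eval_X]
    ring

/-- Gegenbauer coefficients of the zonal function `v ↦ h (v j)`. -/
noncomputable def coef (j : Fin N) (h : ℝ → ℝ) (k : ℕ) : ℝ :=
  (∫ v, h (v.1 j) * (geg (N - 2) k).eval (v.1 j) ∂sphereUniform N) / gegNormSq (N - 2) k

/-- Truncated heat evolution of a Gegenbauer series. -/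
noncomputable def heatPoly (m : ℝ) (c : ℕ → ℝ) (d : ℕ) (t : ℝ) : ℝ[X] :=
  ∑ k ∈ Finset.range d, C (c k * Real.exp (-eig m k * t)) * geg m k

lemma heatPoly_zero (m : ℝ) (c : ℕ → ℝ) (d : ℕ) :
    heatPoly m c d 0 = ∑ k ∈ Finset.range d, C (c k) * geg m k := by
  simp [heatPoly]

lemma integral_sum_mul_geg (hN : 3 ≤ N) (j : Fin N) (c : ℕ → ℝ) {d k : ℕ} :
    ∫ v, (∑ i ∈ Finset.range d, C (c i) * geg (N - 2) i).eval (v.1 j) *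
      (geg (N - 2) k).eval (v.1 j) ∂sphereUniform N =
      if k < d then c k * gegNormSq (N - 2) k else 0 := by
  have hc := fun p q : ℝ[X] => integrable_of_continuous
      (((p * q).continuous).comp (continuous_coord (N := N) j))
  simp only [Function.comp_def, eval_mul] at hc
  have h1 : ∀ v : USphere N, (∑ i ∈ Finset.range d, C (c i) * geg (N - 2) i).eval (v.1 j) *
      (geg (N - 2) k).eval (v.1 j) = ∑ i ∈ Finset.range d, c i * ((geg (N - 2) i).eval (v.1 j) *
      (geg (N - 2) k).eval (v.1 j)) := fun v => by
    rw [eval_finsetSum, Finset.sum_mul]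
    simp only [eval_mul, eval_C, mul_assoc]
  simp only [h1]
  rw [integral_finsetSum _ fun i _ => (hc _ _).const_mul _]
  simp only [integral_const_mul]
  split_ifs with hk
  · rw [Finset.sum_eq_single_of_mem k (Finset.mem_range.2 hk), integral_geg_mul_self hN]
    intro i _ hik
    rw [integral_geg_mul_geg_of_ne hN j hik, mul_zero]
  · refine Finset.sum_eq_zero fun i hi => ?_
    rw [integral_geg_mul_geg_of_ne hN j (by have := Finset.mem_range.1 hi; omega), mul_zero]

lemma exists_heatPoly_zero_eq (hN : 3 ≤ N) (j : Fin N) (q : ℝ[X]) :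
    ∃ d, heatPoly (N - 2) (coef j fun x => q.eval x) d 0 = q ∧
      ∀ k, d ≤ k → coef j (fun x => q.eval x) k = 0 := by
  have hm := one_le_natCast_sub_two hN
  obtain ⟨c, hc⟩ := Finsupp.mem_span_range_iff_exists_finsupp.1 (mem_span_geg ((N : ℝ) - 2) q)
  obtain ⟨d, hd⟩ := c.support.exists_nat_subset_range
  have hq : q = ∑ i ∈ Finset.range d, C (c i) * geg (N - 2) i := by
    rw [← hc, Finsupp.sum_of_support_subset _ hd _ (by simp)]
    simp only [smul_eq_C_mul]
  have hcoef : ∀ k, coef j (fun x => q.eval x) k = if k < d then c k else 0 := fun k => by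
    rw [coef, hq, integral_sum_mul_geg hN]
    split_ifs
    · exact mul_div_cancel_right₀ _ (gegNormSq_pos hm k).ne'
    · exact zero_div _
  refine ⟨d, ?_, fun k hk => by rw [hcoef, if_neg hk.not_gt]⟩
  rw [heatPoly_zero]
  conv_rhs => rw [hq]
  exact Finset.sum_congr rfl fun k hk => by rw [hcoef, if_pos (Finset.mem_range.1 hk)]

lemma coef_zero (j : Fin N) (h : ℝ → ℝ) : coef j h 0 = ∫ v, h (v.1 j) ∂sphereUniform N := by
  simp [coef, geg, gegNormSq]

lemma abs_coef_le (hN : 3 ≤ N) (j : Fin N) (h : ℝ → ℝ)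
    (hh : Integrable (fun v : USphere N => h (v.1 j)) (sphereUniform N)) (k : ℕ) :
    |coef j h k| ≤ (∫ v, |h (v.1 j)| ∂sphereUniform N) * (3 * N ^ 2) ^ k := by
  have hm := one_le_natCast_sub_two hN
  have hN0 : (0 : ℝ) < N := by linarith
  rw [coef, abs_div, abs_of_pos (gegNormSq_pos hm k), div_le_iff₀ (gegNormSq_pos hm k)]
  have h1 : |∫ v, h (v.1 j) * (geg (N - 2) k).eval (v.1 j) ∂sphereUniform N| ≤
      (∫ v, |h (v.1 j)| ∂sphereUniform N) * 3 ^ k := by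
    rw [← integral_mul_const, ← Real.norm_eq_abs]
    refine norm_integral_le_of_norm_le (hh.abs.mul_const _)
      (Filter.Eventually.of_forall fun v => ?_)
    rw [norm_mul, Real.norm_eq_abs, Real.norm_eq_abs]
    exact mul_le_mul_of_nonneg_left
      (abs_eval_geg_le hm k ((abs_coord_le v j).trans one_le_two)) (abs_nonneg _)
  refine h1.trans ?_
  rw [mul_assoc]
  refine mul_le_mul_of_nonneg_left ?_ (integral_nonneg fun _ => abs_nonneg _)
  have h2 := pow_le_gegNormSq hm k
  rw [sub_add_cancel] at h2
  calc (3 : ℝ) ^ k = (3 * N ^ 2) ^ k * (1 / N ^ 2) ^ k := by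
        rw [← mul_pow]; congr 1; field_simp
    _ ≤ _ := mul_le_mul_of_nonneg_left h2 (by positivity)

lemma coef_sub (j : Fin N) {h g : ℝ → ℝ}
    (hh : Integrable (fun v : USphere N => h (v.1 j)) (sphereUniform N))
    (hg : Integrable (fun v : USphere N => g (v.1 j)) (sphereUniform N)) (k : ℕ) :
    coef j (fun x => h x - g x) k = coef j h k - coef j g k := by
  have hb : ∀ {f : ℝ → ℝ}, Integrable (fun v : USphere N => f (v.1 j)) (sphereUniform N) →
      Integrable (fun v : USphere N => f (v.1 j) * (geg (N - 2) k).eval (v.1 j))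
        (sphereUniform N) := fun {f} hf => by
    have c := continuous_eval_coord (geg ((N : ℝ) - 2) k) j
    obtain ⟨C, hC⟩ := isCompact_univ.exists_bound_of_continuousOn c.continuousOn
    exact hf.mul_bdd (c := C) c.aestronglyMeasurable
      (Filter.Eventually.of_forall fun v => hC v (Set.mem_univ v))
  simp only [coef, sub_mul]
  rw [integral_sub (hb hh) (hb hg), sub_div]

section

variable (m : ℝ) (c : ℕ → ℝ) (d : ℕ)

lemma eval_heatPoly (t x : ℝ) : (heatPoly m c d t).eval x =
    ∑ k ∈ Finset.range d, c k * Real.exp (-eig m k * t) * (geg m k).eval x := by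
  simp [heatPoly, eval_finsetSum]

lemma continuous_heatPoly : Continuous fun q : ℝ × ℝ => (heatPoly m c d q.1).eval q.2 := by
  simp only [eval_heatPoly]
  refine continuous_finsetSum _ fun k _ => ?_
  exact (continuous_const.mul (Real.continuous_exp.comp (continuous_const.mul continuous_fst))).mul
    ((geg m k).continuous.comp continuous_snd)

lemma lap_sum_C_mul (a : ℕ → ℝ) (p : ℕ → ℝ[X]) (s : Finset ℕ) :
    lap m (∑ k ∈ s, C (a k) * p k) = ∑ k ∈ s, C (a k) * lap m (p k) := by
  simp only [lap, derivative_sum, derivative_C_mul, Finset.mul_sum, ← Finset.sum_sub_distrib]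
  exact Finset.sum_congr rfl fun k _ => by ring

lemma lap_heatPoly {m : ℝ} (hm : 1 ≤ m) (t : ℝ) :
    lap m (heatPoly m c d t) = heatPoly m (fun k => -eig m k * c k) d t := by
  rw [heatPoly, lap_sum_C_mul, heatPoly]
  refine Finset.sum_congr rfl fun k _ => ?_
  rw [lap_geg hm, ← mul_assoc, ← C_mul]
  congr 2
  ring

lemma hasDerivAt_heatPoly {m : ℝ} (hm : 1 ≤ m) (t x : ℝ) :
    HasDerivAt (fun t => (heatPoly m c d t).eval x) ((lap m (heatPoly m c d t)).eval x) t := by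
  simp only [lap_heatPoly c d hm, eval_heatPoly]
  refine HasDerivAt.fun_sum fun k _ => ?_
  have h : HasDerivAt (fun t : ℝ => -eig m k * t) (-eig m k) t := by
    simpa using (hasDerivAt_id t).const_mul (-eig m k)
  refine ((h.exp.const_mul (c k)).mul_const _).congr_deriv ?_
  ring

end

lemma deriv_nonpos_of_le_left {f : ℝ → ℝ} {f' a : ℝ} (hf : HasDerivAt f f' a)
    (h : ∀ᶠ x in 𝓝[<] a, f a ≤ f x) : f' ≤ 0 := by
  refine le_of_tendsto (hf.tendsto_slope.mono_left (nhdsLT_le_nhdsNE a)) ?_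
  filter_upwards [h, self_mem_nhdsWithin] with x hx hxa
  rw [slope_def_field]
  exact div_nonpos_of_nonneg_of_nonpos (sub_nonneg.2 hx) (sub_nonpos.2 (le_of_lt hxa))

lemma deriv_nonneg_of_le_right {f : ℝ → ℝ} {f' a : ℝ} (hf : HasDerivAt f f' a)
    (h : ∀ᶠ x in 𝓝[>] a, f a ≤ f x) : 0 ≤ f' := by
  refine ge_of_tendsto (hf.tendsto_slope.mono_left (nhdsGT_le_nhdsNE a)) ?_
  filter_upwards [h, self_mem_nhdsWithin] with x hx hxa
  rw [slope_def_field]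
  exact div_nonneg (sub_nonneg.2 hx) (sub_nonneg.2 (le_of_lt hxa))

lemma derivative_derivative_nonneg_of_isLocalMin {p : ℝ[X]} {a : ℝ}
    (h : IsLocalMin (fun x => p.eval x) a) : 0 ≤ (derivative (derivative p)).eval a := by
  by_contra! hneg
  have hd : ∀ q : ℝ[X], deriv (fun x => q.eval x) = fun x => (derivative q).eval x := fun q => by
    ext x; exact q.deriv
  have hmax : IsLocalMax (fun x => p.eval x) a := by
    refine isLocalMax_of_deriv_deriv_neg ?_ ?_ p.continuous.continuousAt
    · rwa [hd, hd]
    · exact h.deriv_eq_zero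
  have heq : (fun x => p.eval x) =ᶠ[𝓝 a] fun _ => p.eval a := by
    filter_upwards [h, hmax] with x h1 h2 using le_antisymm h2 h1
  have h2 := heq.deriv.deriv.eq_of_nhds
  rw [hd, hd] at h2
  simp only [deriv_const'] at h2
  exact hneg.ne h2

lemma lap_nonneg_of_isMinOn {m : ℝ} (hm : 1 ≤ m) {p : ℝ[X]} {a : ℝ} (ha : a ∈ Set.Icc (-1 : ℝ) 1)
    (h : ∀ x ∈ Set.Icc (-1 : ℝ) 1, p.eval a ≤ p.eval x) : 0 ≤ (lap m p).eval a := by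
  simp only [lap, eval_sub, eval_mul, eval_one, eval_pow, eval_X, eval_C]
  rcases eq_or_lt_of_le ha.1 with h1 | h1
  · have := deriv_nonneg_of_le_right (p.hasDerivAt a) (by
      filter_upwards [Ioo_mem_nhdsGT (by linarith : a < 1)] with x hx
        using h x ⟨ha.1.trans hx.1.le, hx.2.le⟩)
    subst h1
    nlinarith
  rcases eq_or_lt_of_le ha.2 with h2 | h2
  · have := deriv_nonpos_of_le_left (p.hasDerivAt a) (by
      filter_upwards [Ioo_mem_nhdsLT (by linarith : -1 < a)] with x hx
        using h x ⟨hx.1.le, hx.2.le.trans ha.2⟩)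
    subst h2
    nlinarith
  have hmin : IsLocalMin (fun x => p.eval x) a := by
    filter_upwards [Icc_mem_nhds h1 h2] with x hx using h x hx
  have h3 := derivative_derivative_nonneg_of_isLocalMin hmin
  have h4 : (derivative p).eval a = 0 := by
    rw [← p.deriv]; exact hmin.deriv_eq_zero
  rw [h4, mul_zero, sub_zero]
  exact mul_nonneg (by nlinarith) h3

/-- Minimum principle for the heat flow. -/
lemma le_heatPoly {m : ℝ} (hm : 1 ≤ m) {c : ℕ → ℝ} {d : ℕ} {δ : ℝ}
    (h0 : ∀ x ∈ Set.Icc (-1 : ℝ) 1, δ ≤ (heatPoly m c d 0).eval x) {t : ℝ} (ht : 0 ≤ t)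
    {x : ℝ} (hx : x ∈ Set.Icc (-1 : ℝ) 1) : δ ≤ (heatPoly m c d t).eval x := by
  have key : ∀ η > 0, δ ≤ (heatPoly m c d t).eval x + η * t := fun η hη => by
    have hK : IsCompact (Set.Icc 0 t ×ˢ Set.Icc (-1 : ℝ) 1) := isCompact_Icc.prod isCompact_Icc
    have hcont : Continuous fun q : ℝ × ℝ => (heatPoly m c d q.1).eval q.2 + η * q.1 :=
      (continuous_heatPoly m c d).add (continuous_const.mul continuous_fst)
    obtain ⟨⟨s, y⟩, ⟨hs, hy⟩, hmin⟩ := hK.exists_isMinOn ⟨(t, x), ⟨ht, le_rfl⟩, hx⟩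
      hcont.continuousOn
    simp only at hs hy
    have hmin' : ∀ r ∈ Set.Icc 0 t, ∀ z ∈ Set.Icc (-1 : ℝ) 1,
        (heatPoly m c d s).eval y + η * s ≤ (heatPoly m c d r).eval z + η * r :=
      fun r hr z hz => hmin (a := (r, z)) ⟨hr, hz⟩
    refine le_trans ?_ (hmin' t ⟨ht, le_rfl⟩ x hx)
    rcases eq_or_lt_of_le hs.1 with h | h
    · rw [← h, mul_zero, add_zero]; exact h0 y hy
    · exfalso
      have hd : HasDerivAt (fun r => (heatPoly m c d r).eval y + η * r)
          ((lap m (heatPoly m c d s)).eval y + η) s := by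
        simpa using (hasDerivAt_heatPoly c d hm s y).fun_add ((hasDerivAt_id s).const_mul η)
      have h1 := deriv_nonpos_of_le_left hd (by
        filter_upwards [Ioo_mem_nhdsLT h] with r hr
          using hmin' r ⟨hr.1.le, hr.2.le.trans hs.2⟩ y hy)
      have h2 := lap_nonneg_of_isMinOn hm hy (p := heatPoly m c d s) fun z hz => by
        have := hmin' s hs z hz
        linarith
      linarith
  rcases eq_or_lt_of_le ht with h | h
  · rw [← h]; exact h0 x hx
  · refine le_of_forall_pos_le_add fun ε hε => ?_
    have := key (ε / t) (by positivity)
    rwa [div_mul_cancel₀ _ h.ne'] at this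

lemma heatPoly_pos {m : ℝ} (hm : 1 ≤ m) {c : ℕ → ℝ} {d : ℕ}
    (h0 : ∀ x ∈ Set.Icc (-1 : ℝ) 1, 0 < (heatPoly m c d 0).eval x) {t : ℝ} (ht : 0 ≤ t)
    {x : ℝ} (hx : x ∈ Set.Icc (-1 : ℝ) 1) : 0 < (heatPoly m c d t).eval x := by
  obtain ⟨y, hy, hmin⟩ := isCompact_Icc.exists_isMinOn ⟨x, hx⟩
    (heatPoly m c d 0).continuous.continuousOn
  exact (h0 y hy).trans_le (le_heatPoly hm (fun z hz => hmin hz) ht hx)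

/-- Sum of squares giving the derivative of the Young functional along the heat flow. -/
noncomputable def dissipation (U : Fin N → ℝ[X]) : ℝ :=
  ∑ j, ∑ k ∈ Finset.univ.erase j, (∫ v, sqrtProd (fun j x => (U j).eval x) v *
      (v.1 k * logDer U j v + v.1 j * logDer U k v) ^ 2 ∂sphereUniform N) / 8

lemma dissipation_nonneg (U : Fin N → ℝ[X]) : 0 ≤ dissipation U :=
  Finset.sum_nonneg fun _ _ => Finset.sum_nonneg fun _ _ => div_nonneg
    (integral_nonneg fun v => mul_nonneg (sqrtProd_nonneg _ v) (sq_nonneg _)) (by norm_num)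

section

variable (c : Fin N → ℕ → ℝ) (d : Fin N → ℕ)

/-- The coordinate functions evolved by the heat flow. -/
noncomputable def flow (t : ℝ) (j : Fin N) : ℝ[X] := heatPoly (N - 2) (c j) (d j) t

/-- The Young functional along the heat flow. -/
noncomputable def youngFlow (t : ℝ) : ℝ :=
  ∫ v, sqrtProd (fun j x => (flow c d t j).eval x) v ∂sphereUniform N

lemma continuous_sqrtProd_flow :
    Continuous fun q : ℝ × USphere N => sqrtProd (fun j x => (flow c d q.1 j).eval x) q.2 :=
  continuous_finsetProd _ fun j _ => ((continuous_heatPoly _ (c j) (d j)).comp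
    (continuous_fst.prodMk ((continuous_coord j).comp continuous_snd))).sqrt

lemma continuous_youngFlow : Continuous (youngFlow c d) := by
  have h := continuous_parametric_integral_of_continuous (μ := sphereUniform N)
    (f := fun t v => sqrtProd (fun j x => (flow c d t j).eval x) v)
    (continuous_sqrtProd_flow c d) isCompact_univ
  rw [Measure.restrict_univ] at h
  exact h

variable {c d} (hN : 3 ≤ N)
  (h0 : ∀ j, ∀ x ∈ Set.Icc (-1 : ℝ) 1, 0 < (flow c d 0 j).eval x)
include hN h0

lemma flow_pos {t : ℝ} (ht : 0 ≤ t) (j : Fin N) {x : ℝ} (hx : x ∈ Set.Icc (-1 : ℝ) 1) :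
    0 < (flow c d t j).eval x :=
  heatPoly_pos (one_le_natCast_sub_two hN) (h0 j) ht hx

lemma hasDerivAt_youngFlow {t : ℝ} (ht : 0 < t) :
    HasDerivAt (youngFlow c d) (dissipation (flow c d t)) t := by
  have hm := one_le_natCast_sub_two hN
  rw [dissipation, ← integral_lap_flow fun j x hx => flow_pos hN h0 ht.le j hx]
  have cc := fun (c : ℕ → ℝ) d (j : Fin N) => (continuous_heatPoly ((N : ℝ) - 2) c d).comp
    (f := fun q : ℝ × USphere N => (q.1, q.2.1 j))
    (continuous_fst.prodMk ((continuous_coord j).comp continuous_snd))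
  refine hasDerivAt_integral_sphere (w := fun t v => sqrtProd (fun j x => (flow c d t j).eval x) v)
    (w' := fun t v => ∑ j, sqrtProd (fun j x => (flow c d t j).eval x) v *
      ((lap (N - 2) (flow c d t j)).eval (v.1 j) / (2 * (flow c d t j).eval (v.1 j))))
    isOpen_Ioi (Set.mem_Ioi.2 ht) (fun t _ => continuous_sqrtProd _) ?_ ?_
  · refine continuousOn_finsetSum _ fun j _ => ?_
    refine (continuous_sqrtProd_flow c d).continuousOn.mul (ContinuousOn.div ?_ ?_ ?_)
    · simp only [flow, lap_heatPoly _ _ hm]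
      exact (cc _ _ j).continuousOn
    · exact (continuous_const.mul (cc _ _ j)).continuousOn
    · rintro ⟨s, v⟩ ⟨hs, -⟩
      exact (mul_pos two_pos (flow_pos hN h0 (le_of_lt hs) j (coord_mem_Icc v j))).ne'
  · intro s hs v
    have hpos := fun i => flow_pos hN h0 (le_of_lt hs) i (coord_mem_Icc v i)
    have h : ∀ i ∈ Finset.univ, HasDerivAt (fun s => √((flow c d s i).eval (v.1 i))) _ s :=
      fun i _ => (hasDerivAt_heatPoly (c i) (d i) hm s (v.1 i)).sqrt (hpos i).ne'
    refine (HasDerivAt.fun_finsetProd h).congr_deriv ?_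
    simp only [smul_eq_mul]
    exact Finset.sum_congr rfl fun i _ =>
      prod_erase_sqrt_mul (U := fun j x => (flow c d s j).eval x) (hpos i) _

lemma monotoneOn_youngFlow : MonotoneOn (youngFlow c d) (Set.Ici 0) := by
  refine monotoneOn_of_deriv_nonneg (convex_Ici 0) (continuous_youngFlow c d).continuousOn ?_ ?_
  · rw [interior_Ici]
    exact fun t ht => (hasDerivAt_youngFlow hN h0 ht).differentiableAt.differentiableWithinAt
  · rw [interior_Ici]
    intro t ht
    rw [(hasDerivAt_youngFlow hN h0 ht).deriv]
    exact dissipation_nonneg _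

lemma tendsto_youngFlow_atTop :
    Tendsto (youngFlow c d) atTop (𝓝 (∏ j, √(c j 0))) := by
  have hm := one_le_natCast_sub_two hN
  have := isProbabilityMeasure_sphereUniform hN
  have hd : ∀ j, 0 < d j := fun j => by
    by_contra! h
    have := h0 j 0 (by norm_num)
    rw [flow, eval_heatPoly, Nat.le_zero.1 h] at this
    simp at this
  have hlim : ∀ j x, Tendsto (fun t => (flow c d t j).eval x) atTop (𝓝 (c j 0)) := fun j x => by
    have : c j 0 = ∑ k ∈ Finset.range (d j), if k = 0 then c j 0 else 0 := by
      rw [Finset.sum_ite_eq' , if_pos (Finset.mem_range.2 (hd j))]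
    rw [this]
    simp only [flow, eval_heatPoly]
    refine tendsto_finsetSum _ fun k _ => ?_
    split_ifs with hk
    · subst hk
      simp [eig, geg]
    · have he : 0 < eig ((N : ℝ) - 2) k := by
        have := sq_le_eig hm k
        have : (0 : ℝ) < k := by exact_mod_cast Nat.pos_of_ne_zero hk
        nlinarith
      have : Tendsto (fun t => Real.exp (-eig ((N : ℝ) - 2) k * t)) atTop (𝓝 0) :=
        Real.tendsto_exp_atBot.comp (tendsto_id.const_mul_atTop_of_neg (neg_lt_zero.2 he))
      simpa using (this.const_mul (c j k)).mul_const ((geg ((N : ℝ) - 2) k).eval x)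
  have hbd : ∀ j t, 0 ≤ t → ∀ v : USphere N, (flow c d t j).eval (v.1 j) ≤
      ∑ k ∈ Finset.range (d j), |c j k| * 3 ^ k := fun j t ht v => by
    rw [flow, eval_heatPoly]
    refine Finset.sum_le_sum fun k _ => (le_abs_self _).trans ?_
    rw [abs_mul, abs_mul, Real.abs_exp, mul_assoc]
    refine mul_le_mul_of_nonneg_left ?_ (abs_nonneg _)
    have he : Real.exp (-eig ((N : ℝ) - 2) k * t) ≤ 1 := by
      rw [Real.exp_le_one_iff]
      nlinarith [sq_le_eig hm k, mul_nonneg ((sq_nonneg (k : ℝ)).trans (sq_le_eig hm k)) ht]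
    have h3 := abs_eval_geg_le hm k ((abs_coord_le v j).trans one_le_two)
    calc _ ≤ 1 * (3 : ℝ) ^ k := mul_le_mul he h3 (abs_nonneg _) zero_le_one
      _ = _ := one_mul _
  have hconst : ∏ j, √(c j 0) = ∫ _ : USphere N, ∏ j, √(c j 0) ∂sphereUniform N := by simp
  rw [hconst]
  refine tendsto_integral_filter_of_dominated_convergence
    (fun _ => ∏ j, √(∑ k ∈ Finset.range (d j), |c j k| * 3 ^ k))
    (Eventually.of_forall fun t => (continuous_sqrtProd _).aestronglyMeasurable) ?_
    (integrable_const _) (Eventually.of_forall fun v =>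
      tendsto_finsetProd _ fun j _ => (hlim j _).sqrt)
  filter_upwards [eventually_ge_atTop 0] with t ht
  refine Eventually.of_forall fun v => ?_
  rw [Real.norm_of_nonneg (sqrtProd_nonneg _ _)]
  exact Finset.prod_le_prod (fun _ _ => Real.sqrt_nonneg _)
    fun j _ => Real.sqrt_le_sqrt (hbd j t ht v)

lemma youngFlow_le {t : ℝ} (ht : 0 ≤ t) : youngFlow c d t ≤ ∏ j, √(c j 0) := by
  refine ge_of_tendsto (tendsto_youngFlow_atTop hN h0) ?_
  filter_upwards [eventually_ge_atTop t] with s hs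
    using monotoneOn_youngFlow hN h0 ht (ht.trans hs) hs

end

lemma summable_pow_mul_exp {K τ : ℝ} (hK : 0 < K) (hτ : 0 < τ) :
    Summable fun k : ℕ => K ^ k * Real.exp (-k ^ 2 * τ) := by
  refine summable_of_ratio_test_tendsto_lt_one zero_lt_one
    (Eventually.of_forall fun k => by positivity) ?_
  have h : ∀ k : ℕ, ‖K ^ (k + 1) * Real.exp (-((k + 1 : ℕ) : ℝ) ^ 2 * τ)‖ /
      ‖K ^ k * Real.exp (-(k : ℝ) ^ 2 * τ)‖ = K * Real.exp (-τ) * Real.exp (-(2 * τ) * k) :=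
    fun k => by
    rw [Real.norm_of_nonneg (by positivity), Real.norm_of_nonneg (by positivity),
      div_eq_iff (by positivity), pow_succ]
    have : Real.exp (-((k + 1 : ℕ) : ℝ) ^ 2 * τ) =
        Real.exp (-τ) * Real.exp (-(2 * τ) * k) * Real.exp (-(k : ℝ) ^ 2 * τ) := by
      rw [← Real.exp_add, ← Real.exp_add]
      congr 1
      push_cast
      ring
    rw [this]
    ring
  simp only [h]
  have : Tendsto (fun k : ℕ => Real.exp (-(2 * τ) * k)) atTop (𝓝 0) :=
    Real.tendsto_exp_atBot.comp
      (tendsto_natCast_atTop_atTop.const_mul_atTop_of_neg (by linarith))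
  simpa using this.const_mul (K * Real.exp (-τ))

/-- The series `∑ c k * exp (-eig k * t) * q k x`. -/
noncomputable def heatSum (m : ℝ) (q : ℕ → ℝ[X]) (c : ℕ → ℝ) (t x : ℝ) : ℝ :=
  ∑' k, c k * Real.exp (-eig m k * t) * (q k).eval x

/-- The sum of the series dominating `heatSum`. -/
noncomputable def heatBound (K τ : ℝ) : ℝ := ∑' k : ℕ, (K * 4) ^ k * Real.exp (-k ^ 2 * τ)

lemma heatSum_eq_sum {m : ℝ} {q : ℕ → ℝ[X]} {c : ℕ → ℝ} {d : ℕ} (hc : ∀ k, d ≤ k → c k = 0)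
    (t x : ℝ) : heatSum m q c t x =
      ∑ k ∈ Finset.range d, c k * Real.exp (-eig m k * t) * (q k).eval x :=
  tsum_eq_sum fun k hk => by
    rw [hc k (by simpa using hk), zero_mul, zero_mul]

section

variable {m : ℝ} (hm : 1 ≤ m) {q : ℕ → ℝ[X]} (hq : ∀ k x, |x| ≤ 2 → |(q k).eval x| ≤ 4 ^ k)
  {c : ℕ → ℝ} {B K τ : ℝ} (hB : 0 ≤ B) (hK : 0 < K) (hτ : 0 < τ) (hc : ∀ k, |c k| ≤ B * K ^ k)
include hm hq hB hK hτ hc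

lemma norm_heatSum_term_le {t x : ℝ} (ht : τ ≤ t) (hx : |x| ≤ 2) (k : ℕ) :
    ‖c k * Real.exp (-eig m k * t) * (q k).eval x‖ ≤
      B * ((K * 4) ^ k * Real.exp (-k ^ 2 * τ)) := by
  rw [norm_mul, norm_mul, Real.norm_eq_abs, Real.norm_eq_abs, Real.norm_eq_abs, Real.abs_exp]
  have he : Real.exp (-eig m k * t) ≤ Real.exp (-k ^ 2 * τ) := by
    rw [Real.exp_le_exp]
    have := mul_le_mul (sq_le_eig hm k) ht hτ.le ((sq_nonneg _).trans (sq_le_eig hm k))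
    linarith
  calc _ ≤ (B * K ^ k) * Real.exp (-k ^ 2 * τ) * 4 ^ k :=
        mul_le_mul (mul_le_mul (hc k) he (Real.exp_pos _).le (by positivity)) (hq k x hx)
          (abs_nonneg _) (by positivity)
    _ = _ := by rw [mul_pow]; ring

lemma summable_heatSum {t x : ℝ} (ht : τ ≤ t) (hx : |x| ≤ 2) :
    Summable fun k => c k * Real.exp (-eig m k * t) * (q k).eval x :=
  Summable.of_norm_bounded ((summable_pow_mul_exp (by positivity) hτ).mul_left B)
    (norm_heatSum_term_le hm hq hB hK hτ hc ht hx)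

lemma abs_heatSum_le {t x : ℝ} (ht : τ ≤ t) (hx : |x| ≤ 2) :
    |heatSum m q c t x| ≤ B * heatBound K τ := by
  have hs := (summable_pow_mul_exp (K := K * 4) (by positivity) hτ).mul_left B
  rw [heatBound, ← tsum_mul_left]
  exact tsum_of_norm_bounded hs.hasSum (norm_heatSum_term_le hm hq hB hK hτ hc ht hx)

lemma continuousOn_heatSum :
    ContinuousOn (fun z : ℝ × ℝ => heatSum m q c z.1 z.2) (Set.Ici τ ×ˢ Set.Icc (-2) 2) := by
  refine continuousOn_tsum (fun k => ?_)
    ((summable_pow_mul_exp (K := K * 4) (by positivity) hτ).mul_left B)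
    fun k z hz => norm_heatSum_term_le hm hq hB hK hτ hc hz.1 (abs_le.2 hz.2) k
  exact (((continuous_const.mul (Real.continuous_exp.comp
    (continuous_const.mul continuous_fst))).mul
    ((q k).continuous.comp continuous_snd))).continuousOn

lemma heatSum_sub {c' : ℕ → ℝ} {B' : ℝ} (hB' : 0 ≤ B') (hc' : ∀ k, |c' k| ≤ B' * K ^ k)
    {t x : ℝ} (ht : τ ≤ t) (hx : |x| ≤ 2) :
    heatSum m q (fun k => c k - c' k) t x = heatSum m q c t x - heatSum m q c' t x := by
  rw [heatSum, heatSum, heatSum, ← (summable_heatSum hm hq hB hK hτ hc ht hx).tsum_sub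
    (summable_heatSum hm hq hB' hK hτ hc' ht hx)]
  exact tsum_congr fun k => by ring

omit hq in
lemma hasDerivAt_heatSum {t x : ℝ} (ht : τ ≤ t) (hx : x ∈ Set.Ioo (-2 : ℝ) 2) :
    HasDerivAt (heatSum m (geg m) c t) (heatSum m (fun k => derivative (geg m k)) c t x) x := by
  have hq1 : ∀ k x, |x| ≤ 2 → |(geg m k).eval x| ≤ 4 ^ k := fun k x hx =>
    (abs_eval_geg_le hm k hx).trans (pow_le_pow_left₀ (by norm_num) (by norm_num) k)
  have hq2 : ∀ k x, |x| ≤ 2 → |(derivative (geg m k)).eval x| ≤ 4 ^ k := fun k x hx =>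
    abs_eval_derivative_geg_le hm k hx
  refine hasDerivAt_tsum_of_isPreconnected
    (u := fun k : ℕ => B * ((K * 4) ^ k * Real.exp (-k ^ 2 * τ)))
    ((summable_pow_mul_exp (K := K * 4) (by positivity) hτ).mul_left B) isOpen_Ioo
    isPreconnected_Ioo (fun k y _ => ((geg m k).hasDerivAt y).const_mul _) ?_
    (y₀ := 0) (by norm_num) (summable_heatSum hm hq1 hB hK hτ hc ht (by norm_num)) hx
  intro k y hy
  exact norm_heatSum_term_le hm hq2 hB hK hτ hc ht (abs_le.2 ⟨hy.1.le, hy.2.le⟩) k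

end

lemma integral_heatSum_mul_geg (hN : 3 ≤ N) (j : Fin N) {c : ℕ → ℝ} {B K τ : ℝ} (hB : 0 ≤ B)
    (hK : 0 < K) (hτ : 0 < τ) (hc : ∀ k, |c k| ≤ B * K ^ k) (k : ℕ) :
    ∫ v, heatSum (N - 2) (geg (N - 2)) c τ (v.1 j) * (geg (N - 2) k).eval (v.1 j)
      ∂sphereUniform N = c k * Real.exp (-eig (N - 2) k * τ) * gegNormSq (N - 2) k := by
  have hm := one_le_natCast_sub_two hN
  have := isProbabilityMeasure_sphereUniform hN
  have hq1 : ∀ k x, |x| ≤ 2 → |(geg ((N : ℝ) - 2) k).eval x| ≤ 4 ^ k := fun k x hx =>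
    (abs_eval_geg_le hm k hx).trans (pow_le_pow_left₀ (by norm_num) (by norm_num) k)
  have h2 : ∀ v : USphere N, |v.1 j| ≤ 2 := fun v => (abs_coord_le v j).trans one_le_two
  have hcont := fun i => (continuous_const (y := c i * Real.exp (-eig ((N : ℝ) - 2) i * τ))).mul
    (continuous_eval_coord (geg ((N : ℝ) - 2) i * geg ((N : ℝ) - 2) k) j)
  have hbd : ∀ i, ∀ v : USphere N, ‖c i * Real.exp (-eig ((N : ℝ) - 2) i * τ) *
      (geg ((N : ℝ) - 2) i * geg ((N : ℝ) - 2) k).eval (v.1 j)‖ ≤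
      B * ((K * 4) ^ i * Real.exp (-i ^ 2 * τ)) * 4 ^ k := fun i v => by
    rw [eval_mul, ← mul_assoc, norm_mul]
    exact mul_le_mul (norm_heatSum_term_le hm hq1 hB hK hτ hc le_rfl (h2 v) i)
      (hq1 k _ (h2 v)) (norm_nonneg _) (by positivity)
  have h := hasSum_integral_of_summable_integral_norm (μ := sphereUniform N)
    (F := fun i v => c i * Real.exp (-eig ((N : ℝ) - 2) i * τ) *
      (geg ((N : ℝ) - 2) i * geg ((N : ℝ) - 2) k).eval (v.1 j))
    (fun i => integrable_of_continuous (hcont i)) (by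
      refine Summable.of_nonneg_of_le (fun i => integral_nonneg fun _ => norm_nonneg _) (fun i => ?_)
        (((summable_pow_mul_exp (K := K * 4) (by positivity) hτ).mul_left B).mul_right (4 ^ k))
      have := integral_mono (μ := sphereUniform N) (integrable_of_continuous (hcont i)).norm
        (integrable_const _) (fun v => hbd i v)
      simpa using this)
  have e : ∀ v : USphere N, heatSum (N - 2) (geg (N - 2)) c τ (v.1 j) *
      (geg (N - 2) k).eval (v.1 j) = ∑' i, c i * Real.exp (-eig ((N : ℝ) - 2) i * τ) *
      (geg ((N : ℝ) - 2) i * geg ((N : ℝ) - 2) k).eval (v.1 j) := fun v => by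
    rw [heatSum, ← tsum_mul_right]
    exact tsum_congr fun i => by rw [eval_mul]; ring
  simp only [e]
  rw [← h.tsum_eq, tsum_eq_single k]
  · rw [integral_const_mul]
    simp only [eval_mul]
    rw [integral_geg_mul_self hN]
  · intro i hi
    rw [integral_const_mul]
    simp only [eval_mul]
    rw [integral_geg_mul_geg_of_ne hN j hi, mul_zero]

lemma measurable_coord (j : Fin N) : Measurable fun v : USphere N => v.1 j :=
  (continuous_coord j).measurable

/-- The law of the `j`-th coordinate under the uniform measure. -/
noncomputable def coordLaw (j : Fin N) : Measure ℝ := (sphereUniform N).map fun v => v.1 j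

instance (j : Fin N) : IsFiniteMeasure (coordLaw j) :=
  Measure.isFiniteMeasure_map _ _

lemma integrable_coordLaw_iff {j : Fin N} {h : ℝ → ℝ} (hh : Measurable h) :
    Integrable h (coordLaw j) ↔
      Integrable (fun v : USphere N => h (v.1 j)) (sphereUniform N) :=
  integrable_map_measure hh.aestronglyMeasurable (measurable_coord j).aemeasurable

lemma integral_coordLaw (j : Fin N) {f : ℝ → ℝ} (hf : Measurable f) :
    ∫ x, f x ∂coordLaw j = ∫ v, f (v.1 j) ∂sphereUniform N :=
  integral_map (measurable_coord j).aemeasurable hf.aestronglyMeasurable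

lemma integrable_mul_continuous {j : Fin N} {h g : ℝ → ℝ}
    (hi : Integrable (fun v : USphere N => h (v.1 j)) (sphereUniform N)) (hg : Continuous g) :
    Integrable (fun v : USphere N => h (v.1 j) * g (v.1 j)) (sphereUniform N) := by
  have c : Continuous fun v : USphere N => g (v.1 j) := hg.comp (continuous_coord j)
  obtain ⟨C, hC⟩ := isCompact_univ.exists_bound_of_continuousOn c.continuousOn
  exact hi.mul_bdd (c := C) c.aestronglyMeasurable
    (Eventually.of_forall fun v => hC v (Set.mem_univ v))

lemma exists_polynomial_pos_integral_sub_le (hN : 3 ≤ N) (j : Fin N) {h : ℝ → ℝ}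
    (hh : Measurable h) (h0 : ∀ x, 0 ≤ h x)
    (hi : Integrable (fun v : USphere N => h (v.1 j)) (sphereUniform N)) {ε : ℝ} (hε : 0 < ε) :
    ∃ q : ℝ[X], (∀ x ∈ Set.Icc (-1 : ℝ) 1, 0 < q.eval x) ∧
      ∫ v, |q.eval (v.1 j) - h (v.1 j)| ∂sphereUniform N ≤ ε := by
  have := isProbabilityMeasure_sphereUniform hN
  obtain ⟨g, -, hg, hgc, -⟩ := ((integrable_coordLaw_iff hh).2
    hi).exists_hasCompactSupport_integral_sub_le (half_pos hε)
  rw [integral_coordLaw j (f := fun x => ‖h x - g x‖) (hh.sub hgc.measurable).norm] at hg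
  obtain ⟨q, hq⟩ := exists_polynomial_near_of_continuousOn (-1) 1 (fun x => max (g x) 0 + ε / 4)
    ((hgc.max continuous_const).add continuous_const).continuousOn (ε / 4) (by positivity)
  refine ⟨q, fun x hx => ?_, ?_⟩
  · have := (abs_lt.1 (hq x hx)).1
    have := le_max_right (g x) 0
    linarith
  · have hgi := integrable_of_continuous (hgc.comp (continuous_coord j))
    have hni : Integrable (fun v : USphere N => ‖h (v.1 j) - g (v.1 j)‖) (sphereUniform N) :=
      (hi.sub hgi).norm
    have hbd : ∀ v : USphere N, |q.eval (v.1 j) - h (v.1 j)| ≤ ‖h (v.1 j) - g (v.1 j)‖ + ε / 2 :=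
      fun v => by
      have h1 := abs_lt.1 (hq _ (coord_mem_Icc v j))
      have h2 : |max (g (v.1 j)) 0 - h (v.1 j)| ≤ ‖h (v.1 j) - g (v.1 j)‖ := by
        rw [Real.norm_eq_abs, abs_sub_comm (h (v.1 j))]
        conv_lhs => rw [← max_eq_left (h0 (v.1 j))]
        exact abs_max_sub_max_le_abs _ _ _
      have h3 := abs_le.1 h2
      rw [abs_le]
      constructor <;> linarith [h1.1, h1.2, h3.1, h3.2]
    calc _ ≤ ∫ v, (‖h (v.1 j) - g (v.1 j)‖ + ε / 2) ∂sphereUniform N :=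
          integral_mono ((integrable_of_continuous (continuous_eval_coord q j)).sub hi).abs
            (hni.add (integrable_const _)) hbd
      _ ≤ ε := by
          rw [integral_add hni (integrable_const _)]
          simp only [integral_const, probReal_univ, one_smul]
          linarith

lemma ae_tendsto_of_integral_le_pow {j : Fin N} {h : ℝ → ℝ} {q : ℕ → ℝ[X]}
    (hi : Integrable (fun v : USphere N => h (v.1 j)) (sphereUniform N))
    (hq : ∀ n, ∫ v, |(q n).eval (v.1 j) - h (v.1 j)| ∂sphereUniform N ≤ (1 / 2) ^ n) :
    ∀ᵐ v ∂sphereUniform N, Tendsto (fun n => (q n).eval (v.1 j)) atTop (𝓝 (h (v.1 j))) := by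
  have hint : ∀ n, Integrable (fun v : USphere N => |(q n).eval (v.1 j) - h (v.1 j)|)
      (sphereUniform N) := fun n =>
    ((integrable_of_continuous (continuous_eval_coord (q n) j)).sub hi).abs
  have hle : ∫⁻ v, ∑' n, ENNReal.ofReal |(q n).eval (v.1 j) - h (v.1 j)| ∂sphereUniform N ≤
      ∑' n : ℕ, (2⁻¹ : ℝ≥0∞) ^ n := by
    rw [lintegral_tsum fun n => (hint n).aestronglyMeasurable.aemeasurable.ennreal_ofReal]
    refine ENNReal.tsum_le_tsum fun n => ?_
    rw [← ofReal_integral_eq_lintegral_ofReal (hint n) (Eventually.of_forall fun _ => abs_nonneg _)]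
    refine (ENNReal.ofReal_le_ofReal (hq n)).trans_eq ?_
    rw [ENNReal.ofReal_pow (by norm_num), one_div, ENNReal.ofReal_inv_of_pos two_pos,
      ENNReal.ofReal_ofNat]
  have hfin : ∫⁻ v, ∑' n, ENNReal.ofReal |(q n).eval (v.1 j) - h (v.1 j)| ∂sphereUniform N ≠ ∞ := by
    refine ne_top_of_le_ne_top ?_ hle
    rw [ENNReal.tsum_geometric, ENNReal.one_sub_inv_two, inv_inv]
    exact ENNReal.ofNat_ne_top
  have hmeas : AEMeasurable (fun v : USphere N =>
      ∑' n, ENNReal.ofReal |(q n).eval (v.1 j) - h (v.1 j)|) (sphereUniform N) :=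
    AEMeasurable.tsum fun n => (hint n).aestronglyMeasurable.aemeasurable.ennreal_ofReal
  filter_upwards [ae_lt_top' hmeas hfin] with v hv
  have h1 := ENNReal.tendsto_atTop_zero_of_tsum_ne_top hv.ne
  rw [← tendsto_sub_nhds_zero_iff, tendsto_zero_iff_abs_tendsto_zero]
  have h2 := (ENNReal.tendsto_toReal ENNReal.zero_ne_top).comp h1
  simpa only [Function.comp_def, ENNReal.toReal_ofReal (abs_nonneg _), ENNReal.toReal_zero] using h2

lemma integral_mul_eval_eq_zero (hN : 3 ≤ N) {j : Fin N} {h : ℝ → ℝ}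
    (hi : Integrable (fun v : USphere N => h (v.1 j)) (sphereUniform N))
    (hc : ∀ k, coef j h k = 0) (q : ℝ[X]) :
    ∫ v, h (v.1 j) * q.eval (v.1 j) ∂sphereUniform N = 0 := by
  have hm := one_le_natCast_sub_two hN
  have hint : ∀ q : ℝ[X],
      Integrable (fun v : USphere N => h (v.1 j) * q.eval (v.1 j)) (sphereUniform N) := fun q =>
    integrable_mul_continuous hi q.continuous
  refine Submodule.span_induction (p := fun q _ =>
    ∫ v, h (v.1 j) * q.eval (v.1 j) ∂sphereUniform N = 0) ?_ ?_ ?_ ?_ (mem_span_geg ((N : ℝ) - 2) q)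
  · rintro _ ⟨k, rfl⟩
    exact (div_eq_zero_iff.1 (hc k)).resolve_right (gegNormSq_pos hm k).ne'
  · simp
  · intro a b _ _ ha hb
    simp only [eval_add, mul_add]
    rw [integral_add (hint a) (hint b), ha, hb, add_zero]
  · intro r a _ ha
    simp only [eval_smul, smul_eq_mul, mul_left_comm _ r]
    rw [integral_const_mul, ha, mul_zero]

lemma ae_eq_zero_of_coef_eq_zero (hN : 3 ≤ N) {j : Fin N} {h : ℝ → ℝ} (hh : Measurable h)
    (hi : Integrable (fun v : USphere N => h (v.1 j)) (sphereUniform N))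
    (hc : ∀ k, coef j h k = 0) : ∀ᵐ v ∂sphereUniform N, h (v.1 j) = 0 := by
  have hL := (integrable_coordLaw_iff hh).2 hi
  refine ae_of_ae_map (measurable_coord j).aemeasurable (p := fun x => h x = 0) ?_
  refine ae_eq_zero_of_integral_contDiff_smul_eq_zero hL.locallyIntegrable fun g hg _ => ?_
  have hgc := hg.continuous
  have hmap := integral_coordLaw j (f := fun x => h x * g x) (hh.mul hgc.measurable)
  simp only [smul_eq_mul, mul_comm (g _)]
  refine hmap.trans ?_
  have hgi := integrable_mul_continuous hi hgc
  rw [← abs_nonpos_iff]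
  refine le_of_forall_pos_le_add fun ε hε => ?_
  rw [zero_add]
  set A := ∫ v, |h (v.1 j)| ∂sphereUniform N with hA
  have hA0 : 0 ≤ A := integral_nonneg fun _ => abs_nonneg _
  obtain ⟨q, hq⟩ := exists_polynomial_near_of_continuousOn (-1) 1 g hgc.continuousOn
    (ε / (A + 1)) (by positivity)
  have hqi : Integrable (fun v : USphere N => h (v.1 j) * q.eval (v.1 j)) (sphereUniform N) :=
    integrable_mul_continuous hi q.continuous
  have h1 : ∫ v, h (v.1 j) * g (v.1 j) ∂sphereUniform N =
      ∫ v, (h (v.1 j) * g (v.1 j) - h (v.1 j) * q.eval (v.1 j)) ∂sphereUniform N := by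
    rw [integral_sub hgi hqi, integral_mul_eval_eq_zero hN hi hc, sub_zero]
  rw [h1, ← Real.norm_eq_abs]
  refine (norm_integral_le_of_norm_le (hi.abs.const_mul (ε / (A + 1)))
    (Eventually.of_forall fun v => ?_)).trans ?_
  · have := (hq _ (coord_mem_Icc v j)).le
    rw [abs_sub_comm] at this
    rw [Real.norm_eq_abs, ← mul_sub, abs_mul, mul_comm]
    exact mul_le_mul_of_nonneg_right this (abs_nonneg _)
  · rw [integral_const_mul, ← hA, div_mul_eq_mul_div, div_le_iff₀ (by positivity)]
    nlinarith

section

variable {u u' : Fin N → ℝ → ℝ}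
  (huc : ∀ j, ContinuousOn (u j) (Set.Icc (-1) 1))
  (huc' : ∀ j, ContinuousOn (u' j) (Set.Icc (-1) 1))
  (hflat : ∀ (v : USphere N) (j k : Fin N), j ≠ k → (∏ i, u i (v.1 i)) *
    (v.1 k * u' j (v.1 j) * u k (v.1 k) + v.1 j * u' k (v.1 k) * u j (v.1 j)) = 0)

include huc in
lemma continuous_prod_coord : Continuous fun v : USphere N => ∏ i, u i (v.1 i) :=
  continuous_finsetProd _ fun i _ =>
    (huc i).comp_continuous (continuous_coord i) fun v => coord_mem_Icc v i

include hflat in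
lemma coord_mul_coord_mul_deriv_eq_zero {j k l : Fin N} (hjk : j ≠ k) (hjl : j ≠ l) (hkl : k ≠ l)
    (v : USphere N) : (∏ i, u i (v.1 i)) * u' j (v.1 j) * (v.1 k * v.1 l) = 0 := by
  by_cases h : ∏ i, u i (v.1 i) = 0
  · rw [h, zero_mul, zero_mul]
  have h0 := fun i => Finset.prod_ne_zero_iff.1 h i (Finset.mem_univ i)
  have h1 := (mul_eq_zero.1 (hflat v j k hjk)).resolve_left h
  have h2 := (mul_eq_zero.1 (hflat v j l hjl)).resolve_left h
  have h3 := (mul_eq_zero.1 (hflat v k l hkl)).resolve_left h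
  have : u' j (v.1 j) * (v.1 k * v.1 l) * (2 * (u k (v.1 k) * u l (v.1 l))) = 0 := by
    linear_combination v.1 l * u l (v.1 l) * h1 + v.1 k * u k (v.1 k) * h2
      - v.1 j * u j (v.1 j) * h3
  rw [mul_assoc, (mul_eq_zero.1 this).resolve_right
    (mul_ne_zero two_ne_zero (mul_ne_zero (h0 k) (h0 l))), mul_zero]

include huc huc' hflat in
lemma prod_mul_deriv_eq_zero (hN : 3 ≤ N) (j : Fin N) (v : USphere N) :
    (∏ i, u i (v.1 i)) * u' j (v.1 j) = 0 := by
  obtain ⟨k, hk, l, hl, hkl⟩ : ∃ k, k ≠ j ∧ ∃ l, l ≠ j ∧ k ≠ l := by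
    have h2 : 1 < (Finset.univ.erase j).card := by
      rw [Finset.card_erase_of_mem (Finset.mem_univ j), Finset.card_univ, Fintype.card_fin]
      omega
    obtain ⟨k, hk, l, hl, hkl⟩ := Finset.one_lt_card.1 h2
    exact ⟨k, Finset.ne_of_mem_erase hk, l, Finset.ne_of_mem_erase hl, hkl⟩
  have hcont : Continuous fun v : USphere N => (∏ i, u i (v.1 i)) * u' j (v.1 j) :=
    (continuous_prod_coord huc).mul
      ((huc' j).comp_continuous (continuous_coord j) fun v => coord_mem_Icc v j)
  have hnull := fun k : Fin N => compl_mem_ae_iff.2 (measure_coord_eq_zero k)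
  have hae : (fun v : USphere N => (∏ i, u i (v.1 i)) * u' j (v.1 j)) =ᵐ[sphereUniform N]
      fun _ => 0 := by
    filter_upwards [hnull k, hnull l] with v hvk hvl
    exact (mul_eq_zero.1 (coord_mul_coord_mul_deriv_eq_zero hflat hk.symm hl.symm hkl
      v)).resolve_right (mul_ne_zero hvk hvl)
  exact congrFun (hcont.ae_eq_iff_eq _ continuous_const |>.1 hae) v

/-- The great circle through the `j`-th pole and `v`. -/
noncomputable def greatCircle (j : Fin N) (v : USphere N) (θ : ℝ) (i : Fin N) : ℝ :=
  if i = j then Real.cos θ else Real.sin θ * (v.1 i / √(1 - v.1 j ^ 2))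

lemma sum_sq_greatCircle {j : Fin N} {v : USphere N} (hv : v.1 j ^ 2 < 1) (θ : ℝ) :
    ∑ i, greatCircle j v θ i ^ 2 = 1 := by
  have h1 : 0 < 1 - v.1 j ^ 2 := by linarith
  rw [← Finset.add_sum_erase _ _ (Finset.mem_univ j)]
  have : ∀ i ∈ Finset.univ.erase j, greatCircle j v θ i ^ 2 =
      Real.sin θ ^ 2 / (1 - v.1 j ^ 2) * v.1 i ^ 2 := fun i hi => by
    rw [greatCircle, if_neg (Finset.ne_of_mem_erase hi), mul_pow, div_pow, Real.sq_sqrt h1.le]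
    ring
  rw [Finset.sum_congr rfl this, ← Finset.mul_sum, sum_sq_coord_erase, div_mul_cancel₀ _ h1.ne',
    greatCircle, if_pos rfl, Real.cos_sq_add_sin_sq]

lemma exists_greatCircle_point {j : Fin N} {v : USphere N} (hv : v.1 j ^ 2 < 1) (θ : ℝ) :
    ∃ w : USphere N, ∀ i, w.1 i = greatCircle j v θ i :=
  ⟨⟨WithLp.toLp 2 (greatCircle j v θ), by
    rw [mem_sphere_zero_iff_norm, EuclideanSpace.norm_eq, Real.sqrt_eq_one]
    simpa using sum_sq_greatCircle hv θ⟩, fun _ => rfl⟩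

lemma greatCircle_arccos {j : Fin N} {v : USphere N} (hv : v.1 j ^ 2 < 1) (i : Fin N) :
    greatCircle j v (Real.arccos (v.1 j)) i = v.1 i := by
  have hs : √(1 - v.1 j ^ 2) ≠ 0 := (Real.sqrt_pos.2 (by linarith)).ne'
  rw [greatCircle]
  split_ifs with h
  · rw [h, Real.cos_arccos (coord_mem_Icc v j).1 (coord_mem_Icc v j).2]
  · rw [Real.sin_arccos, mul_div_cancel₀ _ hs]

include huc huc' hflat in
lemma deriv_eq_zero_of_flat (hN : 3 ≤ N)
    (hd : ∀ j, ∀ x ∈ Set.Icc (-1 : ℝ) 1, HasDerivAt (u j) (u' j x) x)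
    (hne : ∃ v : USphere N, ∏ i, u i (v.1 i) ≠ 0) (j : Fin N) {x : ℝ}
    (hx : x ∈ Set.Icc (-1 : ℝ) 1) : u' j x = 0 := by
  have hcont := continuous_prod_coord huc
  obtain ⟨v, hv, hvj⟩ : ∃ v : USphere N, ∏ i, u i (v.1 i) ≠ 0 ∧ v.1 j ^ 2 < 1 := by
    obtain ⟨k, hk⟩ : ∃ k, k ≠ j := by
      have : Nontrivial (Fin N) := Fin.nontrivial_iff_two_le.2 (by omega)
      exact exists_ne j
    by_contra! hcon
    have hae : (fun v : USphere N => ∏ i, u i (v.1 i)) =ᵐ[sphereUniform N] fun _ => 0 := by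
      filter_upwards [compl_mem_ae_iff.2 (measure_coord_eq_zero k)] with v hvk
      by_contra hne
      have h1 := hcon v hne
      have h2 := sum_sq_coord_erase v j
      have h3 := Finset.single_le_sum (f := fun i => v.1 i ^ 2) (fun i _ => sq_nonneg _)
        (Finset.mem_erase.2 ⟨hk, Finset.mem_univ k⟩)
      have h4 : 0 < v.1 k ^ 2 := by
        have : v.1 k ≠ 0 := hvk
        positivity
      simp only at h3
      linarith
    obtain ⟨v, hv⟩ := hne
    exact hv (congrFun (hcont.ae_eq_iff_eq _ continuous_const |>.1 hae) v)
  have hmem : ∀ θ i, greatCircle j v θ i ∈ Set.Icc (-1 : ℝ) 1 := fun θ i => by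
    obtain ⟨w, hw⟩ := exists_greatCircle_point hvj θ
    rw [← hw i]
    exact coord_mem_Icc w i
  have hflat' : ∀ θ l, (∏ i, u i (greatCircle j v θ i)) * u' l (greatCircle j v θ l) = 0 :=
    fun θ l => by
    obtain ⟨w, hw⟩ := exists_greatCircle_point hvj θ
    simpa only [hw] using prod_mul_deriv_eq_zero huc huc' hflat hN l w
  have hderiv : ∀ θ, HasDerivAt (fun θ => ∏ i, u i (greatCircle j v θ i) ^ 2) 0 θ := fun θ => by
    have hγ : ∀ i, ∃ g', HasDerivAt (fun θ => greatCircle j v θ i) g' θ := fun i => by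
      by_cases h : i = j
      · simp only [greatCircle, if_pos h]
        exact ⟨_, Real.hasDerivAt_cos θ⟩
      · simp only [greatCircle, if_neg h]
        exact ⟨_, (Real.hasDerivAt_sin θ).mul_const _⟩
    choose g' hg' using hγ
    have h : ∀ i ∈ Finset.univ, HasDerivAt (fun θ => u i (greatCircle j v θ i) ^ 2) _ θ :=
      fun i _ => (HasDerivAt.comp θ (hd i _ (hmem θ i)) (hg' i)).fun_pow 2
    refine (HasDerivAt.fun_finsetProd h).congr_deriv (Finset.sum_eq_zero fun l _ => ?_)
    have h1 := hflat' θ l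
    rw [← Finset.mul_prod_erase _ _ (Finset.mem_univ l)] at h1
    rw [Finset.prod_pow, smul_eq_mul]
    simp only [Function.comp_apply]
    push_cast
    linear_combination (2 * (∏ i ∈ Finset.univ.erase l, u i (greatCircle j v θ i)) * g' l) * h1
  have hconst := is_const_of_deriv_eq_zero (fun θ => (hderiv θ).differentiableAt)
    (fun θ => (hderiv θ).deriv) (Real.arccos x) (Real.arccos (v.1 j))
  simp only [greatCircle_arccos hvj, Finset.prod_pow] at hconst
  have h1 := hflat' (Real.arccos x) j
  have h2 : ∏ i, u i (greatCircle j v (Real.arccos x) i) ≠ 0 := fun h => by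
    rw [h, zero_pow two_ne_zero] at hconst
    exact hv (pow_eq_zero_iff two_ne_zero |>.1 hconst.symm)
  have h3 := (mul_eq_zero.1 h1).resolve_left h2
  rwa [greatCircle, if_pos rfl, Real.cos_arccos hx.1 hx.2] at h3

end

section

variable {m : ℝ} (hm : 1 ≤ m) {q : ℕ → ℝ[X]} (hq : ∀ k x, |x| ≤ 2 → |(q k).eval x| ≤ 4 ^ k)
  {c : ℕ → ℕ → ℝ} {c₀ : ℕ → ℝ} {B K τ : ℝ} (hB : 0 ≤ B) (hK : 0 < K) (hτ : 0 < τ)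
  (hc₀ : ∀ k, |c₀ k| ≤ B * K ^ k) {ε : ℕ → ℝ} (hε0 : ∀ n, 0 ≤ ε n)
  (hc : ∀ n k, |c n k - c₀ k| ≤ ε n * K ^ k)
include hm hq hB hK hτ hc₀ hε0 hc

omit hm hq hB hτ hε0 in
lemma abs_le_of_abs_sub_le (hε1 : ∀ n, ε n ≤ 1) (n k : ℕ) : |c n k| ≤ (B + 1) * K ^ k := by
  have h1 := abs_sub_abs_le_abs_sub (c n k) (c₀ k)
  have h2 := hc n k
  have h3 := hc₀ k
  have h4 := mul_le_mul_of_nonneg_right (hε1 n) (pow_pos hK k).le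
  linarith

omit hε0 in
lemma abs_heatSum_le_of_approx (hε1 : ∀ n, ε n ≤ 1) (n : ℕ) {t x : ℝ} (ht : τ ≤ t) (hx : |x| ≤ 2) :
    |heatSum m q (c n) t x| ≤ (B + 1) * heatBound K τ :=
  abs_heatSum_le hm hq (by linarith) hK hτ (abs_le_of_abs_sub_le hK hc₀ hc hε1 n) ht hx

lemma tendsto_heatSum (hε : Tendsto ε atTop (𝓝 0)) (hε1 : ∀ n, ε n ≤ 1) {s : ℕ → ℝ} {t x : ℝ}
    (hs : ∀ n, τ ≤ s n) (hst : Tendsto s atTop (𝓝 t)) (hx : |x| ≤ 2) :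
    Tendsto (fun n => heatSum m q (c n) (s n) x) atTop (𝓝 (heatSum m q c₀ t x)) := by
  have ht : τ ≤ t := ge_of_tendsto' hst hs
  have h1 : Tendsto (fun n => heatSum m q c₀ (s n) x) atTop (𝓝 (heatSum m q c₀ t x)) := by
    have hcont := continuousOn_heatSum hm hq hB hK hτ hc₀ (t, x) ⟨ht, abs_le.1 hx⟩
    refine Tendsto.comp (g := fun z : ℝ × ℝ => heatSum m q c₀ z.1 z.2) (f := fun n => (s n, x))
      hcont (tendsto_nhdsWithin_iff.2 ⟨?_, Eventually.of_forall fun n => ⟨hs n, abs_le.1 hx⟩⟩)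
    exact hst.prodMk_nhds tendsto_const_nhds
  have h2 : Tendsto (fun n => heatSum m q (c n) (s n) x - heatSum m q c₀ (s n) x) atTop (𝓝 0) := by
    refine squeeze_zero_norm (a := fun n => ε n * heatBound K τ) (fun n => ?_)
      (by simpa using hε.mul_const (heatBound K τ))
    rw [← heatSum_sub hm hq (by linarith : 0 ≤ B + 1) hK hτ
      (abs_le_of_abs_sub_le hK hc₀ hc hε1 n) hB hc₀ (hs n) hx]
    exact abs_heatSum_le hm hq (hε0 n) hK hτ (hc n) (hs n) hx
  simpa using h2.add h1

end

section

lemma abs_eval_geg_le_four_pow {m : ℝ} (hm : 1 ≤ m) (k : ℕ) (x : ℝ) (hx : |x| ≤ 2) :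
    |(geg m k).eval x| ≤ 4 ^ k :=
  (abs_eval_geg_le hm k hx).trans (pow_le_pow_left₀ (by norm_num) (by norm_num) k)

lemma heatPoly_eval_eq_heatSum {m : ℝ} {c : ℕ → ℝ} {d : ℕ} (hc : ∀ k, d ≤ k → c k = 0)
    (t x : ℝ) : (heatPoly m c d t).eval x = heatSum m (geg m) c t x := by
  rw [heatSum_eq_sum hc, eval_heatPoly]

lemma derivative_heatPoly_eval_eq_heatSum {m : ℝ} {c : ℕ → ℝ} {d : ℕ}
    (hc : ∀ k, d ≤ k → c k = 0) (t x : ℝ) :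
    (derivative (heatPoly m c d t)).eval x =
      heatSum m (fun k => derivative (geg m k)) c t x := by
  rw [heatSum_eq_sum hc, heatPoly, derivative_sum, eval_finsetSum]
  simp only [derivative_C_mul, eval_mul, eval_C]

end

/-- Positive polynomial approximations of the coordinate functions `h`, in terms of their
Gegenbauer coefficients. -/
structure IsApprox (h : Fin N → ℝ → ℝ) (c : ℕ → Fin N → ℕ → ℝ) (d : ℕ → Fin N → ℕ) : Prop where
  pos : ∀ n j, ∀ x ∈ Set.Icc (-1 : ℝ) 1, 0 < (flow (c n) (d n) 0 j).eval x
  eq_zero : ∀ n j k, d n j ≤ k → c n j k = 0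
  abs_sub_le : ∀ n j k, |c n j k - coef j (h j) k| ≤ (1 / 2) ^ n * (3 * N ^ 2 : ℝ) ^ k
  ae_tendsto : ∀ᵐ v ∂sphereUniform N, ∀ j,
    Tendsto (fun n => (flow (c n) (d n) 0 j).eval (v.1 j)) atTop (𝓝 (h j (v.1 j)))

lemma exists_isApprox (hN : 3 ≤ N) {h : Fin N → ℝ → ℝ} (hh : ∀ j, Measurable (h j))
    (h0 : ∀ j x, 0 ≤ h j x)
    (hi : ∀ j, Integrable (fun v : USphere N => h j (v.1 j)) (sphereUniform N)) :
    ∃ c d, IsApprox h c d := by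
  have hex := fun (n : ℕ) j => exists_polynomial_pos_integral_sub_le hN j (hh j) (h0 j) (hi j)
    (by positivity : (0 : ℝ) < (1 / 2) ^ n)
  choose q hq hqi using hex
  choose d hd hd0 using fun n j => exists_heatPoly_zero_eq hN j (q n j)
  refine ⟨fun n j => coef j fun x => (q n j).eval x, d, ⟨?_, hd0, ?_, ?_⟩⟩
  · intro n j
    rw [flow, hd]
    exact hq n j
  · intro n j k
    have hqI := integrable_of_continuous (continuous_eval_coord (q n j) j)
    rw [← coef_sub j hqI (hi j)]
    exact (abs_coef_le hN j _ (hqI.sub (hi j)) k).trans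
      (mul_le_mul_of_nonneg_right (hqi n j) (by positivity))
  · rw [ae_all_iff]
    intro j
    simp only [flow, hd]
    exact ae_tendsto_of_integral_le_pow (hi j) fun n => hqi n j

section

variable {h : Fin N → ℝ → ℝ} {c : ℕ → Fin N → ℕ → ℝ} {d : ℕ → Fin N → ℕ}

lemma lintegral_sqrtProd_flow (c : Fin N → ℕ → ℝ) (d : Fin N → ℕ) (t : ℝ) :
    ∫⁻ v, ENNReal.ofReal (sqrtProd (fun j x => (flow c d t j).eval x) v) ∂sphereUniform N =
      ENNReal.ofReal (youngFlow c d t) :=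
  (ofReal_integral_eq_lintegral_ofReal (integrable_of_continuous (continuous_sqrtProd _))
    (Eventually.of_forall fun v => sqrtProd_nonneg _ v)).symm

lemma IsApprox.tendsto_coef_zero (H : IsApprox h c d) (j : Fin N) :
    Tendsto (fun n => c n j 0) atTop (𝓝 (coef j (h j) 0)) := by
  rw [← tendsto_sub_nhds_zero_iff]
  refine squeeze_zero_norm (fun n => H.abs_sub_le n j 0) ?_
  simpa using tendsto_pow_atTop_nhds_zero_of_lt_one (by norm_num : (0 : ℝ) ≤ 1 / 2) (by norm_num)

/-- If equality holds for `h`, the Young functional of the approximations converges to its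
maximal value, uniformly along the heat flow. -/
lemma IsApprox.tendsto_youngFlow (H : IsApprox h c d) (hN : 3 ≤ N)
    (heq : ENNReal.ofReal (∏ j, √(coef j (h j) 0)) ≤
      ∫⁻ v, ENNReal.ofReal (sqrtProd h v) ∂sphereUniform N) {s : ℕ → ℝ} (hs : ∀ n, 0 ≤ s n) :
    Tendsto (fun n => youngFlow (c n) (d n) (s n)) atTop (𝓝 (∏ j, √(coef j (h j) 0))) := by
  have hP : Tendsto (fun n => ∏ j, √(c n j 0)) atTop (𝓝 (∏ j, √(coef j (h j) 0))) :=
    tendsto_finsetProd _ fun j _ => (H.tendsto_coef_zero j).sqrt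
  have hfatou : ∫⁻ v, ENNReal.ofReal (sqrtProd h v) ∂sphereUniform N ≤
      liminf (fun n => ENNReal.ofReal (youngFlow (c n) (d n) 0)) atTop := by
    simp only [← lintegral_sqrtProd_flow]
    refine le_trans (lintegral_mono_ae ?_) (lintegral_liminf_le fun n =>
      (continuous_sqrtProd _).measurable.ennreal_ofReal)
    filter_upwards [H.ae_tendsto] with v hv
    have : Tendsto (fun n => ENNReal.ofReal (sqrtProd (fun j x => (flow (c n) (d n) 0 j).eval x) v))
        atTop (𝓝 (ENNReal.ofReal (sqrtProd h v))) :=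
      ENNReal.tendsto_ofReal (tendsto_finsetProd _ fun j _ => (hv j).sqrt)
    exact this.liminf_eq.ge
  have h0 : Tendsto (fun n => ENNReal.ofReal (youngFlow (c n) (d n) 0)) atTop
      (𝓝 (ENNReal.ofReal (∏ j, √(coef j (h j) 0)))) := by
    refine tendsto_of_le_liminf_of_limsup_le (heq.trans hfatou) ?_
    rw [← (ENNReal.tendsto_ofReal hP).limsup_eq]
    exact limsup_le_limsup (Eventually.of_forall fun n =>
      ENNReal.ofReal_le_ofReal (youngFlow_le hN (H.pos n) le_rfl))
  have h1 : Tendsto (fun n => youngFlow (c n) (d n) 0) atTop (𝓝 (∏ j, √(coef j (h j) 0))) := by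
    have h2 := (ENNReal.tendsto_toReal ENNReal.ofReal_ne_top).comp h0
    rw [ENNReal.toReal_ofReal (Finset.prod_nonneg fun _ _ => Real.sqrt_nonneg _)] at h2
    refine h2.congr fun n => ENNReal.toReal_ofReal ?_
    exact integral_nonneg fun v => sqrtProd_nonneg _ v
  refine tendsto_of_tendsto_of_tendsto_of_le_of_le h1 hP (fun n => ?_) fun n => ?_
  · exact monotoneOn_youngFlow hN (H.pos n) (Set.self_mem_Ici) (hs n) (hs n)
  · exact youngFlow_le hN (H.pos n) (hs n)

end

lemma integral_le_dissipation (U : Fin N → ℝ[X]) {j k : Fin N} (hjk : j ≠ k) :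
    ∫ v, sqrtProd (fun j x => (U j).eval x) v *
      (v.1 k * logDer U j v + v.1 j * logDer U k v) ^ 2 ∂sphereUniform N ≤ 8 * dissipation U := by
  have hnn : ∀ j k, 0 ≤ (∫ v, sqrtProd (fun j x => (U j).eval x) v *
      (v.1 k * logDer U j v + v.1 j * logDer U k v) ^ 2 ∂sphereUniform N) / 8 := fun j k =>
    div_nonneg (integral_nonneg fun v => mul_nonneg (sqrtProd_nonneg _ v) (sq_nonneg _))
      (by norm_num)
  have h1 := Finset.single_le_sum (fun k _ => hnn j k)
    (Finset.mem_erase.2 ⟨hjk.symm, Finset.mem_univ k⟩)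
  have h2 := Finset.single_le_sum (f := fun j => ∑ k ∈ Finset.univ.erase j,
    (∫ v, sqrtProd (fun j x => (U j).eval x) v *
      (v.1 k * logDer U j v + v.1 j * logDer U k v) ^ 2 ∂sphereUniform N) / 8)
    (fun j _ => Finset.sum_nonneg fun k _ => hnn j k) (Finset.mem_univ j)
  have h3 := h1.trans h2
  rw [← dissipation] at h3
  linarith

lemma integral_flat_le_dissipation {U : Fin N → ℝ[X]}
    (hU : ∀ j, ∀ x ∈ Set.Icc (-1 : ℝ) 1, 0 < (U j).eval x) {M : ℝ}
    (hM : ∀ j, ∀ x ∈ Set.Icc (-1 : ℝ) 1, (U j).eval x ≤ M) {j k : Fin N} (hjk : j ≠ k) :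
    ∫ v, sqrtProd (fun j x => (U j).eval x) v *
      (v.1 k * (derivative (U j)).eval (v.1 j) * (U k).eval (v.1 k) +
        v.1 j * (derivative (U k)).eval (v.1 k) * (U j).eval (v.1 j)) ^ 2 ∂sphereUniform N ≤
      M ^ 4 * (8 * dissipation U) := by
  have cF := continuous_sqrtProd U
  have cl := continuous_logDer hU
  have c2 : Continuous fun v : USphere N => sqrtProd (fun j x => (U j).eval x) v *
      (v.1 k * logDer U j v + v.1 j * logDer U k v) ^ 2 :=
    cF.mul ((((continuous_coord k).mul (cl j)).add ((continuous_coord j).mul (cl k))).pow 2)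
  have c1 : Continuous fun v : USphere N => sqrtProd (fun j x => (U j).eval x) v *
      (v.1 k * (derivative (U j)).eval (v.1 j) * (U k).eval (v.1 k) +
        v.1 j * (derivative (U k)).eval (v.1 k) * (U j).eval (v.1 j)) ^ 2 :=
    cF.mul (((((continuous_coord k).mul (continuous_eval_coord _ j)).mul
      (continuous_eval_coord _ k)).add (((continuous_coord j).mul
        (continuous_eval_coord _ k)).mul (continuous_eval_coord _ j))).pow 2)
  refine le_trans ?_ (mul_le_mul_of_nonneg_left (integral_le_dissipation U hjk) (by positivity))
  rw [← integral_const_mul]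
  refine integral_mono (integrable_of_continuous c1) ((integrable_of_continuous c2).const_mul _)
    fun v => ?_
  have hj := hU j _ (coord_mem_Icc v j)
  have hk := hU k _ (coord_mem_Icc v k)
  have e : v.1 k * (derivative (U j)).eval (v.1 j) * (U k).eval (v.1 k) +
        v.1 j * (derivative (U k)).eval (v.1 k) * (U j).eval (v.1 j) =
      (U j).eval (v.1 j) * (U k).eval (v.1 k) *
        (v.1 k * logDer U j v + v.1 j * logDer U k v) := by
    simp only [logDer]
    field_simp
  simp only [e, mul_pow]
  have h1 : (U j).eval (v.1 j) ^ 2 * (U k).eval (v.1 k) ^ 2 ≤ M ^ 4 := by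
    have hj2 := pow_le_pow_left₀ hj.le (hM j _ (coord_mem_Icc v j)) 2
    have hk2 := pow_le_pow_left₀ hk.le (hM k _ (coord_mem_Icc v k)) 2
    calc _ ≤ M ^ 2 * M ^ 2 := mul_le_mul hj2 hk2 (by positivity) (by positivity)
      _ = M ^ 4 := by ring
  have h2 := mul_le_mul_of_nonneg_right h1 (mul_nonneg (sqrtProd_nonneg
    (fun j x => (U j).eval x) v) (sq_nonneg (v.1 k * logDer U j v + v.1 j * logDer U k v)))
  linarith

/-- Sequence of flow times at which the dissipation tends to zero. -/
lemma IsApprox.exists_dissipation_tendsto {h : Fin N → ℝ → ℝ} {c : ℕ → Fin N → ℕ → ℝ}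
    {d : ℕ → Fin N → ℕ} (H : IsApprox h c d) (hN : 3 ≤ N)
    (heq : ENNReal.ofReal (∏ j, √(coef j (h j) 0)) ≤
      ∫⁻ v, ENNReal.ofReal (sqrtProd h v) ∂sphereUniform N) :
    ∃ s : ℕ → ℝ, (∀ n, s n ∈ Set.Icc (1 : ℝ) 2) ∧
      Tendsto (fun n => dissipation (flow (c n) (d n) (s n))) atTop (𝓝 0) := by
  have hex : ∀ n, ∃ s ∈ Set.Ioo (1 : ℝ) 2, dissipation (flow (c n) (d n) s) =
      (youngFlow (c n) (d n) 2 - youngFlow (c n) (d n) 1) / (2 - 1) := fun n =>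
    exists_hasDerivAt_eq_slope _ _ one_lt_two (continuous_youngFlow _ _).continuousOn
      fun s hs => hasDerivAt_youngFlow hN (H.pos n) (by linarith [hs.1])
  choose s hs hsd using hex
  refine ⟨s, fun n => ⟨(hs n).1.le, (hs n).2.le⟩, ?_⟩
  simp only [hsd]
  have h1 := (H.tendsto_youngFlow hN heq (s := fun _ => 2) fun _ => by norm_num).sub
    (H.tendsto_youngFlow hN heq (s := fun _ => 1) fun _ => by norm_num)
  simpa [show (2 : ℝ) - 1 = 1 by norm_num] using h1

/-- Heat evolution of the coordinate functions. -/
noncomputable def heatCoord (h : Fin N → ℝ → ℝ) (t : ℝ) (j : Fin N) : ℝ → ℝ :=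
  heatSum (N - 2) (geg (N - 2)) (coef j (h j)) t

/-- Spatial derivative of `heatCoord`. -/
noncomputable def heatCoordDeriv (h : Fin N → ℝ → ℝ) (t : ℝ) (j : Fin N) : ℝ → ℝ :=
  heatSum (N - 2) (fun k => derivative (geg (N - 2) k)) (coef j (h j)) t

lemma abs_le_two_of_mem_Icc {x : ℝ} (hx : x ∈ Set.Icc (-1 : ℝ) 1) : |x| ≤ 2 :=
  abs_le.2 ⟨by linarith [hx.1], by linarith [hx.2]⟩

section

variable (hN : 3 ≤ N) {h : Fin N → ℝ → ℝ}
  (hi : ∀ j, Integrable (fun v : USphere N => h j (v.1 j)) (sphereUniform N))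
include hN hi

lemma abs_coef_le_sum (j : Fin N) (k : ℕ) : |coef j (h j) k| ≤
    (∑ i, ∫ v, |h i (v.1 i)| ∂sphereUniform N) * (3 * N ^ 2) ^ k :=
  (abs_coef_le hN j (h j) (hi j) k).trans <| mul_le_mul_of_nonneg_right
    (Finset.single_le_sum (f := fun i => ∫ v, |h i (v.1 i)| ∂sphereUniform N)
      (fun i _ => integral_nonneg fun _ => abs_nonneg _) (Finset.mem_univ j)) (by positivity)

lemma continuousOn_heatSum_coef {q : ℕ → ℝ[X]} (hq : ∀ k x, |x| ≤ 2 → |(q k).eval x| ≤ 4 ^ k)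
    {t : ℝ} (ht : 0 < t) (j : Fin N) :
    ContinuousOn (heatSum (N - 2) q (coef j (h j)) t) (Set.Icc (-1) 1) := by
  have hK : (0 : ℝ) < 3 * N ^ 2 := by
    have : (0 : ℝ) < N := by exact_mod_cast (by omega : 0 < N)
    positivity
  refine (continuousOn_heatSum (one_le_natCast_sub_two hN) hq
    (Finset.sum_nonneg fun i _ => integral_nonneg fun _ => abs_nonneg _) hK ht
    (abs_coef_le_sum hN hi j)).comp (f := fun x => (t, x))
    (Continuous.prodMk_right t).continuousOn fun x hx => ⟨Set.self_mem_Ici, ?_⟩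
  exact abs_le.1 (abs_le_two_of_mem_Icc hx)

lemma hasDerivAt_heatCoord {t x : ℝ} (ht : 0 < t) (hx : x ∈ Set.Icc (-1 : ℝ) 1) (j : Fin N) :
    HasDerivAt (heatCoord h t j) (heatCoordDeriv h t j x) x := by
  have hK : (0 : ℝ) < 3 * N ^ 2 := by
    have : (0 : ℝ) < N := by exact_mod_cast (by omega : 0 < N)
    positivity
  exact hasDerivAt_heatSum (one_le_natCast_sub_two hN)
    (Finset.sum_nonneg fun i _ => integral_nonneg fun _ => abs_nonneg _) hK ht
    (abs_coef_le_sum hN hi j) le_rfl ⟨by linarith [hx.1], by linarith [hx.2]⟩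

lemma exists_flat_time {c : ℕ → Fin N → ℕ → ℝ} {d : ℕ → Fin N → ℕ} (H : IsApprox h c d)
    (hpos : ∀ j, 0 < coef j (h j) 0)
    (heq : ENNReal.ofReal (∏ j, √(coef j (h j) 0)) ≤
      ∫⁻ v, ENNReal.ofReal (sqrtProd h v) ∂sphereUniform N) :
    ∃ t : ℝ, 0 < t ∧ (∀ j, ∀ x ∈ Set.Icc (-1 : ℝ) 1, 0 ≤ heatCoord h t j x) ∧
      (∃ v, sqrtProd (heatCoord h t) v ≠ 0) ∧
      ∀ (v : USphere N) (j k : Fin N), j ≠ k → sqrtProd (heatCoord h t) v *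
        (v.1 k * heatCoordDeriv h t j (v.1 j) * heatCoord h t k (v.1 k) +
          v.1 j * heatCoordDeriv h t k (v.1 k) * heatCoord h t j (v.1 j)) ^ 2 = 0 := by
  have hm := one_le_natCast_sub_two hN
  have hK : (0 : ℝ) < 3 * N ^ 2 := by
    have : (0 : ℝ) < N := by linarith
    positivity
  have hq1 := fun k x => abs_eval_geg_le_four_pow hm k x
  have hq2 : ∀ k x, |x| ≤ 2 → |(derivative (geg ((N : ℝ) - 2) k)).eval x| ≤ 4 ^ k :=
    fun k x hx => abs_eval_derivative_geg_le hm k hx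
  set B := ∑ i, ∫ v, |h i (v.1 i)| ∂sphereUniform N with hBdef
  have hB : 0 ≤ B := Finset.sum_nonneg fun i _ => integral_nonneg fun _ => abs_nonneg _
  have hc₀ := abs_coef_le_sum hN hi
  obtain ⟨s, hs, hsd⟩ := H.exists_dissipation_tendsto hN heq
  obtain ⟨t, ht, φ, hφ, hφt⟩ := isCompact_Icc.tendsto_subseq hs
  set V : ℕ → Fin N → ℝ[X] := fun n => flow (c (φ n)) (d (φ n)) (s (φ n)) with hV
  have hVpos : ∀ n j, ∀ x ∈ Set.Icc (-1 : ℝ) 1, 0 < (V n j).eval x := fun n j x hx =>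
    flow_pos hN (H.pos (φ n)) (zero_le_one.trans (hs _).1) j hx
  set M := (B + 1) * heatBound (3 * N ^ 2 : ℝ) 1 with hMdef
  have hε1 : ∀ n, (1 / 2 : ℝ) ^ φ n ≤ 1 := fun n => pow_le_one₀ (by norm_num) (by norm_num)
  have hε0 : ∀ n, (0 : ℝ) ≤ (1 / 2 : ℝ) ^ φ n := fun n => by positivity
  have hε : Tendsto (fun n => (1 / 2 : ℝ) ^ φ n) atTop (𝓝 0) :=
    (_root_.tendsto_pow_atTop_nhds_zero_of_lt_one (by norm_num) (by norm_num)).comp hφ.tendsto_atTop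
  have hVe : ∀ n j x, (V n j).eval x =
      heatSum (N - 2) (geg (N - 2)) (c (φ n) j) (s (φ n)) x := fun n j x =>
    heatPoly_eval_eq_heatSum (H.eq_zero (φ n) j) _ x
  have hVe' : ∀ n j x, (derivative (V n j)).eval x =
      heatSum (N - 2) (fun k => derivative (geg (N - 2) k)) (c (φ n) j) (s (φ n)) x :=
    fun n j x => derivative_heatPoly_eval_eq_heatSum (H.eq_zero (φ n) j) _ x
  have hVM : ∀ n j, ∀ x ∈ Set.Icc (-1 : ℝ) 1, |(V n j).eval x| ≤ M := fun n j x hx => by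
    rw [hVe]
    exact abs_heatSum_le_of_approx hm hq1 hB hK one_pos (hc₀ j)
      (fun n k => H.abs_sub_le (φ n) j k) hε1 n (hs _).1 (abs_le_two_of_mem_Icc hx)
  have hVM' : ∀ n j, ∀ x ∈ Set.Icc (-1 : ℝ) 1, |(derivative (V n j)).eval x| ≤ M :=
    fun n j x hx => by
    rw [hVe']
    exact abs_heatSum_le_of_approx hm hq2 hB hK one_pos (hc₀ j)
      (fun n k => H.abs_sub_le (φ n) j k) hε1 n (hs _).1 (abs_le_two_of_mem_Icc hx)
  have hlim : ∀ j, ∀ x ∈ Set.Icc (-1 : ℝ) 1,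
      Tendsto (fun n => (V n j).eval x) atTop (𝓝 (heatCoord h t j x)) := fun j x hx => by
    simp only [hVe]
    exact tendsto_heatSum hm hq1 hB hK one_pos (hc₀ j) hε0
      (fun n k => H.abs_sub_le (φ n) j k) hε hε1 (fun n => (hs _).1) hφt (abs_le_two_of_mem_Icc hx)
  have hlim' : ∀ j, ∀ x ∈ Set.Icc (-1 : ℝ) 1,
      Tendsto (fun n => (derivative (V n j)).eval x) atTop (𝓝 (heatCoordDeriv h t j x)) :=
    fun j x hx => by
    simp only [hVe']
    exact tendsto_heatSum hm hq2 hB hK one_pos (hc₀ j) hε0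
      (fun n k => H.abs_sub_le (φ n) j k) hε hε1 (fun n => (hs _).1) hφt (abs_le_two_of_mem_Icc hx)
  have hFlim : ∀ v, Tendsto (fun n => sqrtProd (fun j x => (V n j).eval x) v) atTop
      (𝓝 (sqrtProd (heatCoord h t) v)) := fun v =>
    tendsto_finsetProd _ fun j _ => (hlim j _ (coord_mem_Icc v j)).sqrt
  have hFM : ∀ n v, sqrtProd (fun j x => (V n j).eval x) v ≤ √M ^ N := fun n v => by
    rw [sqrtProd]
    refine (Finset.prod_le_prod (fun _ _ => Real.sqrt_nonneg _) fun j _ => Real.sqrt_le_sqrt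
      ((le_abs_self _).trans (hVM n j _ (coord_mem_Icc v j)))).trans_eq ?_
    simp
  have ht0 : 0 < t := zero_lt_one.trans_le ht.1
  have hM0 : 0 ≤ M := (abs_nonneg _).trans (hVM 0 ⟨0, by omega⟩ 0 (by norm_num))
  have cu := fun j => continuousOn_heatSum_coef hN hi hq1 ht0 j
  have cu' := fun j => continuousOn_heatSum_coef hN hi hq2 ht0 j
  have cc : ∀ j, Continuous fun v : USphere N => heatCoord h t j (v.1 j) := fun j =>
    (cu j).comp_continuous (continuous_coord j) fun v => coord_mem_Icc v j
  have cc' : ∀ j, Continuous fun v : USphere N => heatCoordDeriv h t j (v.1 j) := fun j =>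
    (cu' j).comp_continuous (continuous_coord j) fun v => coord_mem_Icc v j
  have cF : Continuous (sqrtProd (heatCoord h t)) := continuous_finsetProd _ fun j _ => (cc j).sqrt
  refine ⟨t, ht0, fun j x hx => ge_of_tendsto' (hlim j x hx) fun n => (hVpos n j x hx).le, ?_, ?_⟩
  · by_contra! hzero
    have h1 : Tendsto (fun n => youngFlow (c (φ n)) (d (φ n)) (s (φ n))) atTop
        (𝓝 (∫ v, sqrtProd (heatCoord h t) v ∂sphereUniform N)) := by
      refine tendsto_integral_of_dominated_convergence (fun _ => √M ^ N)
        (fun n => (continuous_sqrtProd _).aestronglyMeasurable) (integrable_const _)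
        (fun n => Eventually.of_forall fun v => ?_) (Eventually.of_forall hFlim)
      rw [Real.norm_of_nonneg (sqrtProd_nonneg _ _)]
      exact hFM n v
    have h2 := (H.tendsto_youngFlow hN heq fun n => zero_le_one.trans (hs n).1).comp
      hφ.tendsto_atTop
    have h3 := tendsto_nhds_unique h1 h2
    simp only [hzero, integral_zero] at h3
    exact (Finset.prod_pos fun j _ => Real.sqrt_pos.2 (hpos j)).ne h3
  · intro v j k hjk
    have c1 : ∀ n, Continuous fun v : USphere N => sqrtProd (fun j x => (V n j).eval x) v *
        (v.1 k * (derivative (V n j)).eval (v.1 j) * (V n k).eval (v.1 k) +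
          v.1 j * (derivative (V n k)).eval (v.1 k) * (V n j).eval (v.1 j)) ^ 2 := fun n =>
      (continuous_sqrtProd _).mul (((((continuous_coord k).mul (continuous_eval_coord _ j)).mul
        (continuous_eval_coord _ k)).add (((continuous_coord j).mul
          (continuous_eval_coord _ k)).mul (continuous_eval_coord _ j))).pow 2)
    have c2 : Continuous fun v : USphere N => sqrtProd (heatCoord h t) v *
        (v.1 k * heatCoordDeriv h t j (v.1 j) * heatCoord h t k (v.1 k) +
          v.1 j * heatCoordDeriv h t k (v.1 k) * heatCoord h t j (v.1 j)) ^ 2 :=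
      cF.mul (((((continuous_coord k).mul (cc' j)).mul (cc k)).add
        (((continuous_coord j).mul (cc' k)).mul (cc j))).pow 2)
    have h1 : Tendsto (fun n => ∫ v, sqrtProd (fun j x => (V n j).eval x) v *
        (v.1 k * (derivative (V n j)).eval (v.1 j) * (V n k).eval (v.1 k) +
          v.1 j * (derivative (V n k)).eval (v.1 k) * (V n j).eval (v.1 j)) ^ 2 ∂sphereUniform N)
        atTop (𝓝 (∫ v, sqrtProd (heatCoord h t) v *
        (v.1 k * heatCoordDeriv h t j (v.1 j) * heatCoord h t k (v.1 k) +
          v.1 j * heatCoordDeriv h t k (v.1 k) * heatCoord h t j (v.1 j)) ^ 2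
            ∂sphereUniform N)) := by
      refine tendsto_integral_of_dominated_convergence (fun _ => √M ^ N * (2 * M ^ 2) ^ 2)
        (fun n => (c1 n).aestronglyMeasurable) (integrable_const _)
        (fun n => Eventually.of_forall fun v => ?_) (Eventually.of_forall fun v => ?_)
      · rw [Real.norm_of_nonneg (mul_nonneg (sqrtProd_nonneg _ _) (sq_nonneg _)), ← sq_abs]
        refine mul_le_mul (hFM n v) (pow_le_pow_left₀ (abs_nonneg _) ?_ 2) (sq_nonneg _)
          (by positivity)
        have hb : ∀ j k, |v.1 k * (derivative (V n j)).eval (v.1 j) * (V n k).eval (v.1 k)| ≤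
            M ^ 2 := fun j k => by
          rw [abs_mul, abs_mul]
          calc _ ≤ 1 * M * M := mul_le_mul (mul_le_mul (abs_coord_le v k)
                (hVM' n j _ (coord_mem_Icc v j)) (abs_nonneg _) zero_le_one)
                (hVM n k _ (coord_mem_Icc v k)) (abs_nonneg _) (by positivity)
            _ = M ^ 2 := by ring
        refine (abs_add_le _ _).trans ?_
        linarith [hb j k, hb k j]
      · have lj := hlim j _ (coord_mem_Icc v j)
        have lk := hlim k _ (coord_mem_Icc v k)
        have lj' := hlim' j _ (coord_mem_Icc v j)
        have lk' := hlim' k _ (coord_mem_Icc v k)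
        exact (hFlim v).mul ((((lj'.const_mul _).mul lk).add ((lk'.const_mul _).mul lj)).pow 2)
    have h2 : Tendsto (fun n => M ^ 4 * (8 * dissipation (V n))) atTop (𝓝 0) := by
      simpa using ((hsd.comp hφ.tendsto_atTop).const_mul 8).const_mul (M ^ 4)
    have h3 := le_of_tendsto_of_tendsto' h1 h2 fun n =>
      integral_flat_le_dissipation (hVpos n)
        (fun j x hx => (le_abs_self _).trans (hVM n j x hx)) hjk
    have hnn : ∀ v : USphere N, 0 ≤ sqrtProd (heatCoord h t) v *
        (v.1 k * heatCoordDeriv h t j (v.1 j) * heatCoord h t k (v.1 k) +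
          v.1 j * heatCoordDeriv h t k (v.1 k) * heatCoord h t j (v.1 j)) ^ 2 := fun v =>
      mul_nonneg (sqrtProd_nonneg _ _) (sq_nonneg _)
    have h4 := (integral_eq_zero_iff_of_nonneg hnn (integrable_of_continuous c2)).1
      (le_antisymm h3 (integral_nonneg hnn))
    exact congrFun ((c2.ae_eq_iff_eq _ continuous_zero).1 h4) v

/-- If the Young inequality for the square roots of `h` is an equality, then all higher
Gegenbauer coefficients of `h` vanish. -/
lemma coef_eq_zero_of_equality {c : ℕ → Fin N → ℕ → ℝ} {d : ℕ → Fin N → ℕ} (H : IsApprox h c d)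
    (hpos : ∀ j, 0 < coef j (h j) 0)
    (heq : ENNReal.ofReal (∏ j, √(coef j (h j) 0)) ≤
      ∫⁻ v, ENNReal.ofReal (sqrtProd h v) ∂sphereUniform N) (j : Fin N) {k : ℕ} (hk : k ≠ 0) :
    coef j (h j) k = 0 := by
  have hm := one_le_natCast_sub_two hN
  have hK : (0 : ℝ) < 3 * N ^ 2 := by
    have : (0 : ℝ) < N := by linarith
    positivity
  obtain ⟨t, ht, hnn, ⟨v₀, hv₀⟩, hflat⟩ := exists_flat_time hN hi H hpos heq
  have hq1 := fun k x => abs_eval_geg_le_four_pow hm k x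
  have hq2 : ∀ k x, |x| ≤ 2 → |(derivative (geg ((N : ℝ) - 2) k)).eval x| ≤ 4 ^ k :=
    fun k x hx => abs_eval_derivative_geg_le hm k hx
  have hzero : ∀ v : USphere N, sqrtProd (heatCoord h t) v = 0 ↔
      ∏ i, heatCoord h t i (v.1 i) = 0 := fun v => by
    simp only [sqrtProd, Finset.prod_eq_zero_iff, Finset.mem_univ, true_and]
    exact exists_congr fun i => Real.sqrt_eq_zero (hnn i _ (coord_mem_Icc v i))
  have hder : ∀ x ∈ Set.Icc (-1 : ℝ) 1, heatCoordDeriv h t j x = 0 := fun x hx =>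
    deriv_eq_zero_of_flat (u := heatCoord h t) (u' := heatCoordDeriv h t)
      (fun j => continuousOn_heatSum_coef hN hi hq1 ht j)
      (fun j => continuousOn_heatSum_coef hN hi hq2 ht j)
      (fun v j k hjk => by
        refine mul_eq_zero.2 ((mul_eq_zero.1 (hflat v j k hjk)).imp (hzero v).1 ?_)
        exact (pow_eq_zero_iff two_ne_zero).1)
      hN (fun j x hx => hasDerivAt_heatCoord hN hi ht hx j) ⟨v₀, (hzero v₀).not.1 hv₀⟩ j hx
  have hconst : ∀ x ∈ Set.Icc (-1 : ℝ) 1, heatCoord h t j x = heatCoord h t j (-1) :=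
    constant_of_has_deriv_right_zero (continuousOn_heatSum_coef hN hi hq1 ht j) fun x hx => by
      have := hasDerivAt_heatCoord hN hi ht (Set.Ico_subset_Icc_self hx) j
      rw [hder x (Set.Ico_subset_Icc_self hx)] at this
      exact this.hasDerivWithinAt
  have h1 := integral_heatSum_mul_geg hN j (Finset.sum_nonneg fun i _ => integral_nonneg
    fun _ => abs_nonneg _) hK ht (abs_coef_le_sum hN hi j) k
  have h2 : ∀ v : USphere N, heatSum (N - 2) (geg (N - 2)) (coef j (h j)) t (v.1 j) =
      heatCoord h t j (-1) := fun v => hconst _ (coord_mem_Icc v j)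
  have h3 := integral_geg_mul_geg_of_ne hN j hk.symm
  simp only [geg, eval_one, one_mul] at h3
  simp only [h2] at h1
  rw [integral_const_mul, h3, mul_zero] at h1
  exact ((mul_eq_zero.1 ((mul_eq_zero.1 h1.symm).resolve_right
    (gegNormSq_pos hm k).ne')).resolve_right (Real.exp_pos _).ne')

end

lemma coef_const (hN : 3 ≤ N) (j : Fin N) (a : ℝ) {k : ℕ} (hk : k ≠ 0) :
    coef j (fun _ => a) k = 0 := by
  have h := integral_geg_mul_geg_of_ne hN j hk
  simp only [geg, Polynomial.eval_one, mul_one] at h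
  simp only [coef]
  rw [integral_const_mul, h, mul_zero, zero_div]

lemma ae_eq_integral_of_equality (hN : 3 ≤ N) {h : Fin N → ℝ → ℝ} (hh : ∀ j, Measurable (h j))
    (h0 : ∀ j x, 0 ≤ h j x)
    (hi : ∀ j, Integrable (fun v : USphere N => h j (v.1 j)) (sphereUniform N))
    (hpos : ∀ j, 0 < ∫ v, h j (v.1 j) ∂sphereUniform N)
    (heq : ENNReal.ofReal (∏ j, √(∫ v, h j (v.1 j) ∂sphereUniform N)) ≤
      ∫⁻ v, ENNReal.ofReal (sqrtProd h v) ∂sphereUniform N) (j : Fin N) :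
    ∀ᵐ v ∂sphereUniform N, h j (v.1 j) = ∫ w, h j (w.1 j) ∂sphereUniform N := by
  have := isProbabilityMeasure_sphereUniform hN
  obtain ⟨c, d, H⟩ := exists_isApprox hN hh h0 hi
  set a := ∫ w, h j (w.1 j) ∂sphereUniform N with ha
  simp only [← coef_zero] at hpos heq
  have hca : Integrable (fun _ : USphere N => a) (sphereUniform N) := integrable_const a
  have key := ae_eq_zero_of_coef_eq_zero hN (j := j) (h := fun x => h j x - a)
    ((hh j).sub_const a) ((hi j).sub hca) fun k => by
      rw [coef_sub j (g := fun _ => a) (hi j) hca]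
      rcases eq_or_ne k 0 with rfl | hk
      · simp [coef_zero, ← ha]
      · rw [coef_const hN j a hk, sub_zero]
        exact coef_eq_zero_of_equality hN hi H hpos heq j hk
  filter_upwards [key] with v hv
  exact sub_eq_zero.1 hv

/-- Monotonicity of `L^p` norms of a nonnegative function on a probability space. -/
lemma lintegral_sq_rpow_le {α : Type*} [MeasurableSpace α] {μ : Measure α} [IsProbabilityMeasure μ]
    {f : α → ℝ≥0∞} (hf : AEMeasurable f μ) {p : ℝ} (hp : 2 ≤ p) :
    (∫⁻ v, f v ^ 2 ∂μ) ^ (1 / 2 : ℝ) ≤ (∫⁻ v, f v ^ p ∂μ) ^ (1 / p) := by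
  have h := eLpNorm'_le_eLpNorm'_of_exponent_le (f := f) (two_pos (α := ℝ)) hp μ
    hf.aestronglyMeasurable
  simpa [eLpNorm'] using h

end SphereYoung

open SphereYoung

/-- for `N ≥ 3`, `p ≥ 2`, equality in the spherical Young inequality
holds (for nonnegative `f_j`, none of them a.e. zero and with finite `L^p` norms)
if and only if each `f_j` is constant (a.e. on the sphere). -/
theorem sphere_young_equality_iff_const (N : ℕ) (hN : 3 ≤ N) (p : ℝ) (hp : 2 ≤ p)
    (f : Fin N → ℝ → ℝ) (hmeas : ∀ j, Measurable (f j)) (hpos : ∀ j x, 0 ≤ f j x)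
    (hfin : ∀ j, (∫⁻ v, ENNReal.ofReal (f j ((v : EuclideanSpace ℝ (Fin N)) j)) ^ p
        ∂(sphereUniform N)) < ⊤)
    (hne : ∀ j, (∫⁻ v, ENNReal.ofReal (f j ((v : EuclideanSpace ℝ (Fin N)) j)) ^ p
        ∂(sphereUniform N)) ≠ 0) :
    ((∫⁻ v, ∏ j, ENNReal.ofReal (f j ((v : EuclideanSpace ℝ (Fin N)) j))
        ∂(sphereUniform N)) =
      ∏ j, (∫⁻ v, ENNReal.ofReal (f j ((v : EuclideanSpace ℝ (Fin N)) j)) ^ p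
        ∂(sphereUniform N)) ^ ((1 : ℝ) / p)) ↔
    (∀ j, ∃ c : ℝ, ∀ᵐ (v : Metric.sphere (0 : EuclideanSpace ℝ (Fin N)) 1) ∂(sphereUniform N),
        f j ((v : EuclideanSpace ℝ (Fin N)) j) = c) := by
  have hp0 : 0 < p := by linarith
  have := isProbabilityMeasure_sphereUniform hN
  constructor
  · intro heq
    have hm : ∀ j, Measurable fun v : USphere N => f j (v.1 j) := fun j =>
      (hmeas j).comp (measurable_coord j)
    have hle := fun j => lintegral_sq_rpow_le (μ := sphereUniform N)
      (hm j).ennreal_ofReal.aemeasurable hp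
    have hsq : ∀ j, ∀ v : USphere N, ENNReal.ofReal (f j (v.1 j) ^ 2) =
        ENNReal.ofReal (f j (v.1 j)) ^ 2 := fun j v => ENNReal.ofReal_pow (hpos j _) 2
    have hlt : ∀ j, ∫⁻ v : USphere N, ENNReal.ofReal (f j (v.1 j)) ^ 2 ∂sphereUniform N < ⊤ :=
      fun j => (ENNReal.rpow_lt_top_iff_of_pos one_half_pos).1 <| (hle j).trans_lt <|
        ENNReal.rpow_lt_top_of_nonneg (one_div_pos.2 hp0).le (hfin j).ne
    have hi : ∀ j, Integrable (fun v : USphere N => f j (v.1 j) ^ 2) (sphereUniform N) := fun j => by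
      refine ⟨((hm j).pow_const 2).aestronglyMeasurable, ?_⟩
      rw [hasFiniteIntegral_iff_ofReal (.of_forall fun v => sq_nonneg _)]
      simpa only [hsq] using hlt j
    have hint : ∀ j, ENNReal.ofReal (∫ v : USphere N, f j (v.1 j) ^ 2 ∂sphereUniform N) =
        ∫⁻ v : USphere N, ENNReal.ofReal (f j (v.1 j)) ^ 2 ∂sphereUniform N := fun j => by
      rw [ofReal_integral_eq_lintegral_ofReal (hi j) (.of_forall fun v => sq_nonneg _)]
      simp only [hsq]
    have h2pos : ∀ j, 0 < ∫ v : USphere N, f j (v.1 j) ^ 2 ∂sphereUniform N := fun j => by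
      rw [← ENNReal.ofReal_pos, hint, pos_iff_ne_zero]
      intro h0
      rw [lintegral_eq_zero_iff ((hm j).ennreal_ofReal.pow_const 2)] at h0
      refine hne j ((lintegral_eq_zero_iff ((hm j).ennreal_ofReal.pow_const p)).2 ?_)
      filter_upwards [h0] with v hv
      have := pow_eq_zero_iff (two_ne_zero) |>.1 hv
      simp [this, hp0]
    have hF := ae_eq_integral_of_equality hN (h := fun j x => f j x ^ 2)
      (fun j => (hmeas j).pow_const 2) (fun j x => sq_nonneg _) hi h2pos (by
        have h1 : ∀ v : USphere N, ENNReal.ofReal (sqrtProd (fun j x => f j x ^ 2) v) =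
            ∏ j, ENNReal.ofReal (f j (v.1 j)) := fun v => by
          simp only [sqrtProd, Real.sqrt_sq (hpos _ _)]
          exact ENNReal.ofReal_prod_of_nonneg fun j _ => hpos j _
        simp only [h1]
        rw [heq, ENNReal.ofReal_prod_of_nonneg fun j _ => Real.sqrt_nonneg _]
        refine Finset.prod_le_prod' fun j _ => ?_
        rw [Real.sqrt_eq_rpow, ← ENNReal.ofReal_rpow_of_pos (h2pos j), hint]
        exact hle j)
    intro j
    refine ⟨√(∫ v : USphere N, f j (v.1 j) ^ 2 ∂sphereUniform N), ?_⟩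
    filter_upwards [hF j] with v hv
    rw [← hv, Real.sqrt_sq (hpos _ _)]
  · intro h
    choose c hc using h
    have hall := ae_all_iff.2 hc
    have hr : ∀ j, (∫⁻ v : USphere N, ENNReal.ofReal (f j (v.1 j)) ^ p ∂sphereUniform N) ^ (1 / p) =
        ENNReal.ofReal (c j) := fun j => by
      have h1 : ∫⁻ v : USphere N, ENNReal.ofReal (f j (v.1 j)) ^ p ∂sphereUniform N =
          ∫⁻ _ : USphere N, ENNReal.ofReal (c j) ^ p ∂sphereUniform N :=
        lintegral_congr_ae ((hc j).mono fun v hv => by simp only [hv])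
      rw [h1, lintegral_const, measure_univ, mul_one, ← ENNReal.rpow_mul,
        mul_one_div_cancel hp0.ne', ENNReal.rpow_one]
    have hl : ∫⁻ v : USphere N, ∏ j, ENNReal.ofReal (f j (v.1 j)) ∂sphereUniform N =
        ∫⁻ _ : USphere N, ∏ j, ENNReal.ofReal (c j) ∂sphereUniform N :=
      lintegral_congr_ae (hall.mono fun v hv => by simp only [hv])
    rw [hl, lintegral_const, measure_univ, mul_one]
    exact (Finset.prod_congr rfl fun j _ => hr j).symm
end

section
/- For all N ≥ 2 and every probability density F on S^{N-1} (with respect to the uniform probability measure μ), letting f_j denote the j-th marginal of F (the conditional expectation of F given v_j), one has ∑_{j=1}^N S(f_j) ≤ 2 S(F), where S(G) = ∫ G ln G dμ. -/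
open MeasureTheory ENNReal

/-- The σ-algebra on the sphere generated by the `j`-th coordinate function. -/
def coordSigma (N : ℕ) (j : Fin N) :
    MeasurableSpace (Metric.sphere (0 : EuclideanSpace ℝ (Fin N)) 1) :=
  MeasurableSpace.comap (fun v => (v : EuclideanSpace ℝ (Fin N)) j) inferInstance

open Set Filter Topology Polynomial
open scoped Pointwise

/-- The unit sphere of `ℝ^N`. -/
abbrev UnitSphere (N : ℕ) := Metric.sphere (0 : EuclideanSpace ℝ (Fin N)) 1

theorem isProbabilityMeasure_sphereUniform {N : ℕ} (hN : 2 ≤ N) :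
    IsProbabilityMeasure (sphereUniform N) := by
  have : Nontrivial (EuclideanSpace ℝ (Fin N)) := by
    apply Module.nontrivial_of_finrank_pos (R := ℝ)
    rw [finrank_euclideanSpace_fin]; omega
  have h0 : (volume : Measure (EuclideanSpace ℝ (Fin N))).toSphere univ ≠ 0 := by
    simpa only [ne_eq, Measure.measure_univ_eq_zero] using Measure.toSphere_ne_zero volume
  constructor
  rw [sphereUniform, Measure.smul_apply, smul_eq_mul]
  exact ENNReal.inv_mul_cancel h0 (measure_ne_top _ _)

/-- The restriction of a linear isometry equivalence to the unit sphere. -/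
def LinearIsometryEquiv.sphereMap {E : Type*} [NormedAddCommGroup E] [NormedSpace ℝ E]
    (e : E ≃ₗᵢ[ℝ] E) (v : Metric.sphere (0 : E) 1) : Metric.sphere (0 : E) 1 :=
  ⟨e v, by simp⟩

theorem LinearIsometryEquiv.measurePreserving_sphereMap {E : Type*} [NormedAddCommGroup E]
    [NormedSpace ℝ E] [MeasurableSpace E] [BorelSpace E] {μ : Measure E} (e : E ≃ₗᵢ[ℝ] E)
    (he : MeasurePreserving e μ μ) : MeasurePreserving e.sphereMap μ.toSphere μ.toSphere := by
  have hm : Measurable e.sphereMap := by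
    apply Continuous.measurable
    exact (e.continuous.comp continuous_subtype_val).subtype_mk _
  refine ⟨hm, ?_⟩
  ext s hs
  rw [Measure.map_apply hm hs, Measure.toSphere_apply' _ hs, Measure.toSphere_apply' _ (hm hs)]
  congr 1
  rw [← he.measure_preimage_emb e.toHomeomorph.measurableEmbedding
    (Ioo (0 : ℝ) 1 • (Subtype.val '' s))]
  congr 1
  ext x
  simp only [Set.mem_smul, mem_preimage, mem_image]
  constructor
  · rintro ⟨r, hr, _, ⟨y, hy, rfl⟩, rfl⟩
    exact ⟨r, hr, _, ⟨_, hy, rfl⟩, by simp [sphereMap]⟩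
  · rintro ⟨r, hr, _, ⟨y, hy, rfl⟩, h⟩
    refine ⟨r, hr, _, ⟨⟨e.symm y, by simp⟩, ?_, rfl⟩, ?_⟩
    · simpa [sphereMap] using hy
    · apply e.injective
      simpa using h

theorem measurePreserving_sphereMap_sphereUniform {N : ℕ}
    (e : EuclideanSpace ℝ (Fin N) ≃ₗᵢ[ℝ] EuclideanSpace ℝ (Fin N)) :
    MeasurePreserving e.sphereMap (sphereUniform N) (sphereUniform N) :=
  (e.measurePreserving_sphereMap e.measurePreserving).smul_measure _

/-- The rotation of angle `θ` in the plane of the `i`-th and `j`-th coordinates. -/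
noncomputable def planeRotationLinear {N : ℕ} (i j : Fin N) (θ : ℝ) :
    EuclideanSpace ℝ (Fin N) →ₗ[ℝ] EuclideanSpace ℝ (Fin N) where
  toFun v := WithLp.toLp 2 fun k =>
    if k = i then Real.cos θ * v i - Real.sin θ * v j
    else if k = j then Real.sin θ * v i + Real.cos θ * v j else v k
  map_add' v w := by
    ext k
    simp only [PiLp.add_apply]
    split_ifs <;> ring
  map_smul' c v := by
    ext k
    simp only [PiLp.smul_apply, smul_eq_mul, RingHom.id_apply]
    split_ifs <;> ring

theorem norm_planeRotationLinear {N : ℕ} {i j : Fin N} (hij : i ≠ j) (θ : ℝ)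
    (v : EuclideanSpace ℝ (Fin N)) : ‖planeRotationLinear i j θ v‖ = ‖v‖ := by
  rw [EuclideanSpace.norm_eq, EuclideanSpace.norm_eq]
  congr 1
  have hj : j ∈ Finset.univ.erase i := by simp [hij.symm]
  simp only [Real.norm_eq_abs, sq_abs]
  rw [← Finset.add_sum_erase _ _ (Finset.mem_univ i), ← Finset.add_sum_erase _ _ hj,
    ← Finset.add_sum_erase _ _ (Finset.mem_univ i), ← Finset.add_sum_erase _ _ hj]
  have : ∑ k ∈ (Finset.univ.erase i).erase j, (planeRotationLinear i j θ v k) ^ 2 =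
      ∑ k ∈ (Finset.univ.erase i).erase j, (v k) ^ 2 := by
    refine Finset.sum_congr rfl fun k hk => ?_
    simp only [Finset.mem_erase] at hk
    simp [planeRotationLinear, hk.1, hk.2.1]
  rw [this]
  simp only [planeRotationLinear, LinearMap.coe_mk, AddHom.coe_mk, if_true, hij.symm, if_false]
  linear_combination (v i ^ 2 + v j ^ 2) * Real.sin_sq_add_cos_sq θ

/-- The rotation of angle `θ` in the plane of two distinct coordinates, as an isometry. -/
noncomputable def planeRotation {N : ℕ} {i j : Fin N} (hij : i ≠ j) (θ : ℝ) :
    EuclideanSpace ℝ (Fin N) ≃ₗᵢ[ℝ] EuclideanSpace ℝ (Fin N) :=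
  LinearIsometry.toLinearIsometryEquiv
    ⟨planeRotationLinear i j θ, norm_planeRotationLinear hij θ⟩ rfl

theorem planeRotation_apply {N : ℕ} {i j : Fin N} (hij : i ≠ j) (θ : ℝ)
    (v : EuclideanSpace ℝ (Fin N)) (k : Fin N) :
    planeRotation hij θ v k = if k = i then Real.cos θ * v i - Real.sin θ * v j
      else if k = j then Real.sin θ * v i + Real.cos θ * v j else v k := rfl

theorem Continuous.integrable_of_compactSpace {X : Type*} [TopologicalSpace X]
    [CompactSpace X] [MeasurableSpace X] [OpensMeasurableSpace X] {μ : Measure X}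
    [IsFiniteMeasure μ] {f : X → ℝ} (hf : Continuous f) : Integrable f μ :=
  hf.integrable_of_hasCompactSupport (HasCompactSupport.of_compactSpace f)

theorem integral_sub_eq_intervalIntegral_integral {X : Type*} [TopologicalSpace X]
    [CompactSpace X] [SecondCountableTopology X] [MeasurableSpace X] [BorelSpace X]
    [T2Space X] {μ : Measure X} [IsFiniteMeasure μ]
    {T : ℝ} (hT : 0 ≤ T) {g g' : ℝ → X → ℝ}
    (hg : ∀ t ∈ Icc 0 T, ∀ x, HasDerivAt (fun s => g s x) (g' t x) t)
    (hg' : ContinuousOn (Function.uncurry g') (Icc 0 T ×ˢ univ))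
    (h0 : Integrable (g 0) μ) (h1 : Integrable (g T) μ) :
    (∫ x, g T x ∂μ) - ∫ x, g 0 x ∂μ = ∫ t in 0..T, ∫ x, g' t x ∂μ := by
  have hint : Integrable (Function.uncurry g')
      ((volume.restrict (uIoc 0 T)).prod μ) := by
    have h := hg'.integrableOn_compact (μ := (volume : Measure ℝ).prod μ)
      (isCompact_Icc.prod isCompact_univ)
    rw [IntegrableOn, ← Measure.prod_restrict, Measure.restrict_univ] at h
    refine h.mono_measure ?_
    gcongr
    rw [uIoc_of_le hT]
    exact Ioc_subset_Icc_self
  rw [intervalIntegral_integral_swap hint, ← integral_sub h1 h0]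
  refine integral_congr_ae (ae_of_all _ fun x => ?_)
  symm
  apply intervalIntegral.integral_eq_sub_of_hasDerivAt
  · intro t ht
    rw [uIcc_of_le hT] at ht
    exact hg t ht x
  · apply ContinuousOn.intervalIntegrable
    rw [uIcc_of_le hT]
    exact hg'.comp (f := fun t : ℝ => (t, x)) (by fun_prop) fun t ht => ⟨ht, mem_univ _⟩

theorem norm_planeRotation_coe {N : ℕ} {i j : Fin N} (hij : i ≠ j) (t : ℝ) (v : UnitSphere N) :
    ‖planeRotation hij t v‖ = 1 := by
  rw [LinearIsometryEquiv.norm_map]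
  exact norm_eq_of_mem_sphere v

theorem integral_comp_planeRotation {N : ℕ} {i j : Fin N} (hij : i ≠ j)
    {G : EuclideanSpace ℝ (Fin N) → ℝ} (t : ℝ) (hG : ContinuousOn G (Metric.sphere 0 1)) :
    ∫ v : UnitSphere N, G (planeRotation hij t v) ∂(sphereUniform N) =
      ∫ v : UnitSphere N, G v ∂(sphereUniform N) := by
  have hmp := measurePreserving_sphereMap_sphereUniform (planeRotation hij t)
  have hG1 : Continuous fun v : UnitSphere N => G v :=
    continuousOn_iff_continuous_domRestrict.1 hG
  have h := integral_map (μ := sphereUniform N) (f := fun v : UnitSphere N => G v)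
    hmp.measurable.aemeasurable
    hG1.aestronglyMeasurable
  rw [hmp.map_eq] at h
  exact h.symm

theorem continuous_planeRotation {N : ℕ} {i j : Fin N} (hij : i ≠ j) :
    Continuous fun p : ℝ × UnitSphere N => planeRotation hij p.1 p.2 := by
  apply (PiLp.continuous_toLp 2 _).comp
  refine continuous_pi fun k => ?_
  dsimp only
  split_ifs <;> fun_prop

theorem hasDerivAt_planeRotation {N : ℕ} {i j : Fin N} (hij : i ≠ j) (t : ℝ)
    (v : EuclideanSpace ℝ (Fin N)) (k : Fin N) :
    HasDerivAt (fun s => planeRotation hij s v k)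
      (if k = i then - planeRotation hij t v j
        else if k = j then planeRotation hij t v i else 0) t := by
  simp only [planeRotation_apply, if_true, hij.symm, if_false]
  have hc := Real.hasDerivAt_cos t
  have hs := Real.hasDerivAt_sin t
  split_ifs
  · exact ((hc.mul_const (v i)).sub (hs.mul_const (v j))).congr_deriv (by ring)
  · exact ((hs.mul_const (v i)).add (hc.mul_const (v j))).congr_deriv (by ring)
  · exact hasDerivAt_const _ _

theorem integral_rotationField_eq_zero {N : ℕ} (hN : 2 ≤ N) {i j : Fin N} (hij : i ≠ j)
    {G G' : EuclideanSpace ℝ (Fin N) → ℝ}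
    (hG : ContinuousOn G (Metric.sphere 0 1)) (hG' : ContinuousOn G' (Metric.sphere 0 1))
    (h : ∀ (c : ℝ → EuclideanSpace ℝ (Fin N)) (t : ℝ), ‖c t‖ = 1 →
      (∀ k, HasDerivAt (fun s => c s k)
        (if k = i then - c t j else if k = j then c t i else 0) t) →
      HasDerivAt (fun s => G (c s)) (G' (c t)) t) :
    ∫ v : UnitSphere N, G' v ∂(sphereUniform N) = 0 := by
  have := isProbabilityMeasure_sphereUniform hN
  have hsph : ∀ t (v : UnitSphere N), planeRotation hij t v ∈ Metric.sphere 0 1 := fun t v => by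
    rw [mem_sphere_zero_iff_norm, norm_planeRotation_coe]
  have hint : ∀ t, Integrable (fun v : UnitSphere N => G (planeRotation hij t v))
      (sphereUniform N) := fun t => by
    have hc : Continuous fun v : UnitSphere N => planeRotation hij t v :=
      (planeRotation hij t).continuous.comp continuous_subtype_val
    exact (hG.comp_continuous hc fun v => hsph t v).integrable_of_compactSpace
  have hderiv : ∀ t ∈ Icc (0 : ℝ) 1, ∀ v : UnitSphere N,
      HasDerivAt (fun s => G (planeRotation hij s v)) (G' (planeRotation hij t v)) t :=
    fun t _ v => h (fun s => planeRotation hij s v) t (norm_planeRotation_coe hij t v)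
      fun k => hasDerivAt_planeRotation hij t v k
  have hcont : Continuous
      (Function.uncurry fun t (v : UnitSphere N) => G' (planeRotation hij t v)) :=
    hG'.comp_continuous (continuous_planeRotation hij) fun p => hsph _ _
  have key := integral_sub_eq_intervalIntegral_integral (μ := sphereUniform N) zero_le_one
    hderiv hcont.continuousOn (hint 0) (hint 1)
  simp only [integral_comp_planeRotation hij _ hG, integral_comp_planeRotation hij _ hG',
    sub_self, intervalIntegral.integral_const, sub_zero, one_smul] at key
  exact key.symm

theorem HasDerivAt.nonneg_of_eventually_ge_right {f : ℝ → ℝ} {f' a : ℝ} (hf : HasDerivAt f f' a)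
    (h : ∀ᶠ x in 𝓝[>] a, f a ≤ f x) : 0 ≤ f' := by
  have ht := (hasDerivAt_iff_tendsto_slope.1 hf).mono_left
    (nhdsWithin_mono a (s := Ioi a) fun x hx => ne_of_gt hx)
  refine ge_of_tendsto ht ?_
  filter_upwards [h, self_mem_nhdsWithin] with x hx hax
  rw [slope_def_field]
  exact div_nonneg (sub_nonneg.2 hx) (sub_nonneg.2 (le_of_lt hax))

theorem HasDerivAt.nonpos_of_eventually_ge_left {f : ℝ → ℝ} {f' a : ℝ} (hf : HasDerivAt f f' a)
    (h : ∀ᶠ x in 𝓝[<] a, f a ≤ f x) : f' ≤ 0 := by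
  have ht := (hasDerivAt_iff_tendsto_slope.1 hf).mono_left
    (nhdsWithin_mono a (s := Iio a) fun x hx => ne_of_lt hx)
  refine le_of_tendsto ht ?_
  filter_upwards [h, self_mem_nhdsWithin] with x hx hax
  rw [slope_def_field]
  exact div_nonpos_of_nonneg_of_nonpos (sub_nonneg.2 hx) (sub_nonpos.2 (le_of_lt hax))

theorem IsLocalMin.deriv_deriv_nonneg {f : ℝ → ℝ} {a : ℝ} (h : IsLocalMin f a)
    (hf : ContinuousAt f a) : 0 ≤ deriv (deriv f) a := by
  by_contra! hneg
  have hmax := isLocalMax_of_deriv_deriv_neg hneg h.deriv_eq_zero hf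
  have heq : f =ᶠ[𝓝 a] fun _ => f a := by
    filter_upwards [h, hmax] with x h1 h2 using le_antisymm h2 h1
  have := heq.deriv.deriv_eq
  simp only [deriv_const'] at this
  exact hneg.ne this

/-- The operator `(1 - x²) ∂²p - b x ∂p` on polynomials, which for `b = N - 1` is the
Laplace-Beltrami operator of `S^{N-1}` on polynomials in one coordinate. -/
noncomputable def jacobiOp (b : ℝ) : ℝ[X] →ₗ[ℝ] ℝ[X] :=
  LinearMap.mulLeft ℝ (1 - X ^ 2) ∘ₗ derivative ∘ₗ derivative
    - b • (LinearMap.mulLeft ℝ X ∘ₗ derivative)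

theorem eval_jacobiOp (b x : ℝ) (p : ℝ[X]) : (jacobiOp b p).eval x =
    (1 - x ^ 2) * p.derivative.derivative.eval x - b * (x * p.derivative.eval x) := by
  simp [jacobiOp]

theorem eval_jacobiOp_nonneg_of_isMinOn {b : ℝ} (hb : 0 ≤ b) {p : ℝ[X]} {x : ℝ}
    (hx : x ∈ Icc (-1 : ℝ) 1) (h : IsMinOn (fun y => p.eval y) (Icc (-1) 1) x) :
    0 ≤ (jacobiOp b p).eval x := by
  rw [eval_jacobiOp]
  have hd := p.hasDerivAt x
  rcases hx.1.eq_or_lt with rfl | h1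
  · have : 0 ≤ p.derivative.eval (-1) := by
      refine hd.nonneg_of_eventually_ge_right ?_
      filter_upwards [Ioo_mem_nhdsGT (show (-1 : ℝ) < 1 by norm_num)] with y hy
      exact h ⟨hy.1.le, hy.2.le⟩
    nlinarith
  rcases hx.2.eq_or_lt with rfl | h2
  · have : p.derivative.eval 1 ≤ 0 := by
      refine hd.nonpos_of_eventually_ge_left ?_
      filter_upwards [Ioo_mem_nhdsLT (show (-1 : ℝ) < 1 by norm_num)] with y hy
      exact h ⟨hy.1.le, hy.2.le⟩
    nlinarith
  · have hloc : IsLocalMin (fun y => p.eval y) x := h.isLocalMin (Icc_mem_nhds h1 h2)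
    have h3 := hloc.deriv_deriv_nonneg p.continuous.continuousAt
    have h4 := hloc.hasDerivAt_eq_zero hd
    have h5 : deriv (fun y => p.eval y) = fun y => p.derivative.eval y :=
      funext fun y => p.deriv
    rw [h5, Polynomial.deriv] at h3
    rw [h4]
    have : 0 ≤ 1 - x ^ 2 := by nlinarith
    have := mul_nonneg this h3
    linarith

/-- `P` is a solution of the heat equation `∂ₜ P = jacobiOp b P` in the polynomials. -/
structure IsJacobiFlow (b : ℝ) (P : ℝ → ℝ[X]) : Prop where
  hasDerivAt : ∀ t x, HasDerivAt (fun s => (P s).eval x) ((jacobiOp b (P t)).eval x) t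
  continuous_eval : Continuous fun p : ℝ × ℝ => (P p.1).eval p.2
  continuous_eval_jacobiOp : Continuous fun p : ℝ × ℝ => (jacobiOp b (P p.1)).eval p.2

theorem IsJacobiFlow.le_eval {b : ℝ} (hb : 0 ≤ b) {P : ℝ → ℝ[X]} (hP : IsJacobiFlow b P) {m : ℝ}
    (hm : ∀ x ∈ Icc (-1 : ℝ) 1, m ≤ (P 0).eval x) {T : ℝ} (hT : 0 ≤ T) {x : ℝ}
    (hx : x ∈ Icc (-1 : ℝ) 1) : m ≤ (P T).eval x := by
  by_contra! hlt
  obtain ⟨δ, hδ, hδT⟩ : ∃ δ : ℝ, 0 < δ ∧ (P T).eval x + δ * T < m := by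
    refine ⟨(m - (P T).eval x) / (T + 1), by apply div_pos <;> linarith, ?_⟩
    have : (m - (P T).eval x) / (T + 1) * T < m - (P T).eval x := by
      rw [div_mul_eq_mul_div, div_lt_iff₀ (by linarith)]
      nlinarith
    linarith
  have hcont : Continuous fun p : ℝ × ℝ => (P p.1).eval p.2 + δ * p.1 :=
    hP.continuous_eval.add (by fun_prop)
  obtain ⟨⟨t₀, x₀⟩, ⟨ht₀, hx₀⟩, hmin⟩ := (isCompact_Icc.prod isCompact_Icc).exists_isMinOn
    (⟨(T, x), ⟨hT, le_rfl⟩, hx⟩ : (Icc (0 : ℝ) T ×ˢ Icc (-1 : ℝ) 1).Nonempty) hcont.continuousOn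
  simp only at ht₀ hx₀
  have h1 : (P t₀).eval x₀ + δ * t₀ < m :=
    lt_of_le_of_lt (hmin (⟨⟨hT, le_rfl⟩, hx⟩ : (T, x) ∈ Icc (0 : ℝ) T ×ˢ Icc (-1 : ℝ) 1)) hδT
  have ht : 0 < t₀ := by
    rcases ht₀.1.eq_or_lt with rfl | h
    · have := hm x₀ hx₀
      linarith
    · exact h
  have hd : HasDerivAt (fun s => (P s).eval x₀ + δ * s) ((jacobiOp b (P t₀)).eval x₀ + δ * 1) t₀ :=
    (hP.hasDerivAt t₀ x₀).add ((hasDerivAt_id t₀).const_mul δ)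
  have h2 := hd.nonpos_of_eventually_ge_left (by
    filter_upwards [Ioo_mem_nhdsLT ht] with s hs
    exact hmin (⟨⟨hs.1.le, hs.2.le.trans ht₀.2⟩, hx₀⟩ :
      (s, x₀) ∈ Icc (0 : ℝ) T ×ˢ Icc (-1 : ℝ) 1))
  have h3 : 0 ≤ (jacobiOp b (P t₀)).eval x₀ := by
    refine eval_jacobiOp_nonneg_of_isMinOn hb hx₀ fun y hy => ?_
    have := hmin (⟨ht₀, hy⟩ : (t₀, y) ∈ Icc (0 : ℝ) T ×ˢ Icc (-1 : ℝ) 1)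
    simpa using this
  linarith

/-- The `n`-th eigenvalue of `-jacobiOp b`. -/
def jacobiEigenvalue (b : ℝ) (n : ℕ) : ℝ := n * (n - 1) + b * n

theorem jacobiEigenvalue_strictMono {b : ℝ} (hb : 0 < b) : StrictMono (jacobiEigenvalue b) := by
  refine strictMono_nat_of_lt_succ fun n => ?_
  simp only [jacobiEigenvalue, Nat.cast_add, Nat.cast_one]
  nlinarith [(Nat.cast_nonneg n : (0 : ℝ) ≤ n)]

theorem coeff_jacobiOp (b : ℝ) (p : ℝ[X]) (k : ℕ) : (jacobiOp b p).coeff k =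
    (k + 2) * (k + 1) * p.coeff (k + 2) - jacobiEigenvalue b k * p.coeff k := by
  have h1 : (X ^ 2 * derivative (derivative p)).coeff k = k * (k - 1) * p.coeff k := by
    rcases k with _ | _ | k
    · simp
    · simp [coeff_X_pow_mul']
    · rw [coeff_X_pow_mul, coeff_derivative, coeff_derivative]
      push_cast; ring
  have h2 : (X * derivative p).coeff k = k * p.coeff k := by
    rcases k with _ | k
    · simp
    · rw [coeff_X_mul, coeff_derivative]
      push_cast; ring
  have h3 : jacobiOp b p = derivative (derivative p) - X ^ 2 * derivative (derivative p)
      - b • (X * derivative p) := by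
    simp [jacobiOp, sub_mul]
  rw [h3, coeff_sub, coeff_sub, coeff_smul, h1, h2, coeff_derivative, coeff_derivative,
    jacobiEigenvalue, smul_eq_mul]
  push_cast; ring

theorem exists_eq_sum_jacobiOp_eigenvectors {b : ℝ} (hb : 0 < b) (n : ℕ) (p : ℝ[X])
    (hp : ∀ k, n ≤ k → p.coeff k = 0) : ∃ a : ℕ → ℝ[X], p = ∑ m ∈ Finset.range n, a m ∧
      ∀ m, jacobiOp b (a m) = -jacobiEigenvalue b m • a m := by
  induction n generalizing p with
  | zero => exact ⟨fun _ => 0, by ext k; simp [hp k], by simp⟩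
  | succ n ih =>
    obtain ⟨a, ha, hA⟩ := ih (jacobiOp b p + jacobiEigenvalue b n • p) fun k hk => by
      rw [coeff_add, coeff_jacobiOp, coeff_smul, hp (k + 2) (by omega), smul_eq_mul]
      rcases hk.eq_or_lt with rfl | hk
      · ring
      · rw [hp k hk]; ring
    have hne : ∀ m ∈ Finset.range n, jacobiEigenvalue b n - jacobiEigenvalue b m ≠ 0 :=
      fun m hm => sub_ne_zero.2 (jacobiEigenvalue_strictMono hb (Finset.mem_range.1 hm)).ne'
    set c : ℕ → ℝ[X] := fun m => (jacobiEigenvalue b n - jacobiEigenvalue b m)⁻¹ • a m with hc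
    have hcA : ∀ m, jacobiOp b (c m) = -jacobiEigenvalue b m • c m := fun m => by
      simp only [hc]
      rw [map_smul, hA, smul_comm]
    refine ⟨Function.update c n (p - ∑ m ∈ Finset.range n, c m), ?_, fun m => ?_⟩
    · rw [Finset.sum_range_succ, Function.update_self, Finset.sum_congr rfl fun m hm =>
        Function.update_of_ne (Finset.mem_range.1 hm).ne _ _]
      abel
    · by_cases hm : m = n
      · subst hm
        rw [Function.update_self, map_sub, map_sum, eq_sub_of_add_eq ha, smul_sub,
          Finset.smul_sum]
        have : ∀ k ∈ Finset.range m, a k =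
            (jacobiEigenvalue b m - jacobiEigenvalue b k) • c k := fun k hk => by
          simp only [hc, smul_smul, mul_inv_cancel₀ (hne k hk), one_smul]
        rw [Finset.sum_congr rfl this]
        simp only [hcA, sub_smul, Finset.sum_sub_distrib, neg_smul, Finset.sum_neg_distrib]
        abel
      · rw [Function.update_of_ne hm, hcA]

theorem eq_C_of_jacobiOp_eq_zero {b : ℝ} (hb : 0 < b) {p : ℝ[X]} (hp : jacobiOp b p = 0) :
    p = C (p.coeff 0) := by
  apply eq_C_of_natDegree_eq_zero
  by_contra h0
  have h := coeff_jacobiOp b p p.natDegree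
  rw [hp, coeff_zero, coeff_eq_zero_of_natDegree_lt (n := p.natDegree + 2) (by omega)] at h
  have hpos : 0 < jacobiEigenvalue b p.natDegree := by
    have := jacobiEigenvalue_strictMono hb (Nat.pos_of_ne_zero h0)
    simpa [jacobiEigenvalue] using this
  have hl : p.coeff p.natDegree ≠ 0 := by
    rw [coeff_natDegree, Ne, leadingCoeff_eq_zero]
    rintro rfl
    simp at h0
  have := mul_ne_zero hpos.ne' hl
  apply this
  linarith

/-- The flow of `jacobiOp b` started at the sum of the eigenvectors `a m`, `m < n`. -/
noncomputable def jacobiFlow (b : ℝ) (n : ℕ) (a : ℕ → ℝ[X]) (t : ℝ) : ℝ[X] :=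
  ∑ m ∈ Finset.range n, Real.exp (-jacobiEigenvalue b m * t) • a m

theorem eval_jacobiFlow (b : ℝ) (n : ℕ) (a : ℕ → ℝ[X]) (t x : ℝ) : (jacobiFlow b n a t).eval x =
    ∑ m ∈ Finset.range n, Real.exp (-jacobiEigenvalue b m * t) * (a m).eval x := by
  simp [jacobiFlow, eval_finsetSum]

theorem isJacobiFlow_jacobiFlow {b : ℝ} {n : ℕ} {a : ℕ → ℝ[X]}
    (ha : ∀ m, jacobiOp b (a m) = -jacobiEigenvalue b m • a m) :
    IsJacobiFlow b (jacobiFlow b n a) := by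
  have h : ∀ t x, (jacobiOp b (jacobiFlow b n a t)).eval x = ∑ m ∈ Finset.range n,
      (Real.exp (-jacobiEigenvalue b m * t) * -jacobiEigenvalue b m) * (a m).eval x := by
    intro t x
    simp only [jacobiFlow, map_sum, map_smul, ha, eval_finsetSum, eval_smul, smul_eq_mul,
      mul_assoc]
  refine ⟨fun t x => ?_, ?_, ?_⟩
  · simp only [eval_jacobiFlow, h]
    refine HasDerivAt.fun_sum fun m _ => HasDerivAt.mul_const ?_ _
    simpa using ((hasDerivAt_id t).const_mul (-jacobiEigenvalue b m)).exp
  · simp only [eval_jacobiFlow]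
    have := fun m => (a m).continuous
    fun_prop
  · simp only [h]
    have := fun m => (a m).continuous
    fun_prop

theorem HasDerivAt.prod_sqrt {ι : Type*} [Fintype ι] {u : ι → ℝ → ℝ} {u' : ι → ℝ} {t : ℝ}
    (hu : ∀ k, HasDerivAt (u k) (u' k) t) (hpos : ∀ k, 0 < u k t) :
    HasDerivAt (fun s => ∏ k, √(u k s)) ((∏ k, √(u k t)) * (2⁻¹ * ∑ k, u' k / u k t)) t := by
  classical
  refine (HasDerivAt.fun_finsetProd fun k _ => (hu k).sqrt (hpos k).ne').congr_deriv ?_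
  rw [Finset.mul_sum, Finset.mul_sum]
  refine Finset.sum_congr rfl fun k hk => ?_
  rw [← Finset.mul_prod_erase _ _ hk, smul_eq_mul]
  have h1 := Real.sq_sqrt (hpos k).le
  have h2 := Real.sqrt_pos.2 (hpos k)
  have h3 := hpos k
  rw [← h1]
  field_simp
  rw [Real.sqrt_sq h2.le]

theorem coord_mem_Icc_of_norm_eq_one {N : ℕ} {v : EuclideanSpace ℝ (Fin N)} (hv : ‖v‖ = 1)
    (k : Fin N) : v k ∈ Icc (-1 : ℝ) 1 := by
  have := PiLp.norm_apply_le v k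
  rw [hv, Real.norm_eq_abs] at this
  exact abs_le.1 this

theorem coord_mem_Icc_of_unitSphere {N : ℕ} (v : UnitSphere N) (k : Fin N) :
    v.1 k ∈ Icc (-1 : ℝ) 1 :=
  coord_mem_Icc_of_norm_eq_one (norm_eq_of_mem_sphere v) k

theorem sum_coord_sq_of_unitSphere {N : ℕ} (v : UnitSphere N) : ∑ k, v.1 k ^ 2 = 1 := by
  have := EuclideanSpace.real_norm_sq_eq v.1
  rw [norm_eq_of_mem_sphere v] at this
  simpa using this.symm

/-- The integrand produced by applying the rotation field of the `(i, j)` plane to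
`W(v) vᵢ (log hⱼ)'(vⱼ)`, where `W(v) = ∏ₖ √(hₖ(vₖ))`. -/
noncomputable def rotationIntegrand {N : ℕ} (h : Fin N → ℝ[X]) (i j : Fin N)
    (v : EuclideanSpace ℝ (Fin N)) : ℝ :=
  (∏ k, √((h k).eval (v k))) *
    (v i ^ 2 * ((h j).derivative.derivative.eval (v j) / (h j).eval (v j))
      - v j * ((h j).derivative.eval (v j) / (h j).eval (v j))
      - 2⁻¹ * (v i * ((h j).derivative.eval (v j) / (h j).eval (v j))) *
        (v i * ((h j).derivative.eval (v j) / (h j).eval (v j))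
          + v j * ((h i).derivative.eval (v i) / (h i).eval (v i))))

theorem continuousOn_eval_coord {N : ℕ} (p : ℝ[X]) (k : Fin N)
    (s : Set (EuclideanSpace ℝ (Fin N))) :
    ContinuousOn (fun v : EuclideanSpace ℝ (Fin N) => p.eval (v k)) s := by
  have := p.continuous
  exact Continuous.continuousOn (by fun_prop)

theorem continuousOn_rotationIntegrand {N : ℕ} {h : Fin N → ℝ[X]}
    (hpos : ∀ k, ∀ x ∈ Icc (-1 : ℝ) 1, 0 < (h k).eval x) (i j : Fin N) :
    ContinuousOn (rotationIntegrand h i j) (Metric.sphere 0 1) := by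
  have hne : ∀ k, ∀ v ∈ Metric.sphere (0 : EuclideanSpace ℝ (Fin N)) 1,
      (h k).eval (v k) ≠ 0 := fun k v hv =>
    (hpos k _ (coord_mem_Icc_of_norm_eq_one (mem_sphere_zero_iff_norm.1 hv) k)).ne'
  have h0 := fun k => continuousOn_eval_coord (h k) k (Metric.sphere 0 1)
  have h1 := fun k => continuousOn_eval_coord (h k).derivative k (Metric.sphere 0 1)
  have h2 := fun k => continuousOn_eval_coord (h k).derivative.derivative k (Metric.sphere 0 1)
  have hd1 := fun k => (h1 k).div (h0 k) (hne k)
  have hd2 := fun k => (h2 k).div (h0 k) (hne k)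
  have hv : ∀ k, ContinuousOn (fun v : EuclideanSpace ℝ (Fin N) => v k) (Metric.sphere 0 1) :=
    fun k => Continuous.continuousOn (by fun_prop)
  have hW := continuousOn_finsetProd Finset.univ fun k _ => (h0 k).sqrt
  exact hW.mul (((((hv i).pow 2).mul (hd2 j)).sub ((hv j).mul (hd1 j))).sub
    ((continuousOn_const.mul ((hv i).mul (hd1 j))).mul
      (((hv i).mul (hd1 j)).add ((hv j).mul (hd1 i)))))

theorem integral_rotationIntegrand {N : ℕ} (hN : 2 ≤ N) {h : Fin N → ℝ[X]}
    (hpos : ∀ k, ∀ x ∈ Icc (-1 : ℝ) 1, 0 < (h k).eval x) {i j : Fin N} (hij : i ≠ j) :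
    ∫ v : UnitSphere N, rotationIntegrand h i j v ∂(sphereUniform N) = 0 := by
  refine integral_rotationField_eq_zero hN hij
    (G := fun v => (∏ k, √((h k).eval (v k))) *
      (v i * ((h j).derivative.eval (v j) / (h j).eval (v j))))
    ?_ (continuousOn_rotationIntegrand hpos i j) fun c t hc hd => ?_
  · have h0 := fun k => continuousOn_eval_coord (h k) k (Metric.sphere 0 1)
    refine (continuousOn_finsetProd Finset.univ fun k _ => (h0 k).sqrt).mul
      (ContinuousOn.mul (Continuous.continuousOn (by fun_prop))
        ((continuousOn_eval_coord _ j _).div (h0 j) fun v hv => ?_))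
    exact (hpos j _ (coord_mem_Icc_of_norm_eq_one (mem_sphere_zero_iff_norm.1 hv) j)).ne'
  · have hp := fun k => hpos k _ (coord_mem_Icc_of_norm_eq_one hc k)
    have hu := fun (p : ℝ[X]) k => (p.hasDerivAt (c t k)).comp t (hd k)
    have hW := HasDerivAt.prod_sqrt (u := fun k s => (h k).eval (c s k)) (fun k => hu (h k) k) hp
    have hi : HasDerivAt (fun s => c s i) (- c t j) t := by simpa using hd i
    have hj := hW.mul (hi.mul ((hu (h j).derivative j).div (hu (h j) j) (hp j).ne'))
    refine hj.congr_deriv ?_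
    have hsum : ∑ k, (h k).derivative.eval (c t k) *
        (if k = i then - c t j else if k = j then c t i else 0) / (h k).eval (c t k) =
        (h i).derivative.eval (c t i) * (- c t j) / (h i).eval (c t i) +
        (h j).derivative.eval (c t j) * c t i / (h j).eval (c t j) := by
      rw [← Finset.add_sum_erase _ _ (Finset.mem_univ i),
        ← Finset.add_sum_erase _ _ (show j ∈ Finset.univ.erase i by simp [hij.symm]),
        Finset.sum_eq_zero]
      · simp [hij.symm]
      · intro k hk
        simp only [Finset.mem_erase] at hk
        simp [hk.1, hk.2.1]
    simp only [hsum, rotationIntegrand, Pi.mul_apply, Pi.div_apply, Function.comp_apply,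
      if_neg hij.symm, if_true]
    have hi0 := (hp i).ne'
    have hj0 := (hp j).ne'
    field_simp
    ring

theorem sum_rotation_le_sum_jacobi {N : ℕ} {x : Fin N → ℝ} (hx : ∑ i, x i ^ 2 = 1)
    (D E : Fin N → ℝ) :
    ∑ j, ∑ i, (if i = j then 0 else x i ^ 2 * E j - x j * D j
      - 2⁻¹ * (x i * D j) * (x i * D j + x j * D i)) ≤
    ∑ j, ((1 - x j ^ 2) * E j - ((N : ℝ) - 1) * (x j * D j)) := by
  set S := ∑ j, ∑ i, (if i = j then 0 else 2⁻¹ * (x i * D j) * (x i * D j + x j * D i)) with hS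
  have hS0 : 0 ≤ S := by
    have h2 : S + S = ∑ j, ∑ i, (if i = j then 0 else 2⁻¹ * (x i * D j + x j * D i) ^ 2) := by
      nth_rewrite 2 [hS]
      rw [Finset.sum_comm, hS, ← Finset.sum_add_distrib]
      refine Finset.sum_congr rfl fun j _ => ?_
      rw [← Finset.sum_add_distrib]
      refine Finset.sum_congr rfl fun i _ => ?_
      by_cases hij : i = j
      · simp [hij]
      · rw [if_neg hij, if_neg hij, if_neg (Ne.symm hij)]
        ring
    have h3 : 0 ≤ S + S := by
      rw [h2]
      refine Finset.sum_nonneg fun j _ => Finset.sum_nonneg fun i _ => ?_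
      split_ifs
      · exact le_rfl
      · positivity
    linarith
  have hmain : ∑ j, ∑ i, (if i = j then 0 else x i ^ 2 * E j - x j * D j
      - 2⁻¹ * (x i * D j) * (x i * D j + x j * D i)) =
      ∑ j, ((1 - x j ^ 2) * E j - ((N : ℝ) - 1) * (x j * D j)) - S := by
    rw [hS, ← Finset.sum_sub_distrib]
    refine Finset.sum_congr rfl fun j _ => ?_
    have h1 : (1 - x j ^ 2) * E j - ((N : ℝ) - 1) * (x j * D j) =
        ∑ i, (if i = j then 0 else x i ^ 2 * E j - x j * D j) := by
      rw [← Finset.sum_erase _ (a := j) (by simp), Finset.sum_congr rfl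
        fun i hi => if_neg (Finset.ne_of_mem_erase hi), Finset.sum_erase_eq_sub (Finset.mem_univ j),
        Finset.sum_sub_distrib, ← Finset.sum_mul, hx]
      simp
      ring
    rw [h1, ← Finset.sum_sub_distrib]
    refine Finset.sum_congr rfl fun i _ => ?_
    split_ifs <;> ring
  linarith

theorem continuous_prod_sqrt_mul_sum_div {N : ℕ} {P Q : Fin N → ℝ[X]}
    (hpos : ∀ k, ∀ x ∈ Icc (-1 : ℝ) 1, 0 < (P k).eval x) :
    Continuous fun v : UnitSphere N => (∏ k, √((P k).eval (v.1 k))) *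
      (2⁻¹ * ∑ k, (Q k).eval (v.1 k) / (P k).eval (v.1 k)) := by
  have h0 := fun k => (P k).continuous
  have h1 := fun k => (Q k).continuous
  have hne : ∀ k, ∀ v : UnitSphere N, (P k).eval (v.1 k) ≠ 0 := fun k v =>
    (hpos k _ (coord_mem_Icc_of_unitSphere v k)).ne'
  fun_prop (disch := simp_all)

theorem integral_prod_sqrt_mul_sum_jacobiOp_nonneg {N : ℕ} (hN : 2 ≤ N) {h : Fin N → ℝ[X]}
    (hpos : ∀ k, ∀ x ∈ Icc (-1 : ℝ) 1, 0 < (h k).eval x) :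
    0 ≤ ∫ v : UnitSphere N, (∏ k, √((h k).eval (v.1 k))) *
      (2⁻¹ * ∑ k, (jacobiOp (N - 1) (h k)).eval (v.1 k) / (h k).eval (v.1 k))
      ∂(sphereUniform N) := by
  have := isProbabilityMeasure_sphereUniform hN
  have hI : ∀ i j, Integrable (fun v : UnitSphere N => if i = j then 0 else
      rotationIntegrand h i j v) (sphereUniform N) := fun i j => by
    split_ifs
    · exact integrable_zero _ _ _
    · exact Continuous.integrable_of_compactSpace
        (continuousOn_iff_continuous_domRestrict.1 (continuousOn_rotationIntegrand hpos i j))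
  have h0 : ∫ v : UnitSphere N, 2⁻¹ * ∑ j, ∑ i, (if i = j then 0 else rotationIntegrand h i j v)
      ∂(sphereUniform N) = 0 := by
    rw [integral_const_mul,
      integral_finsetSum _ fun j _ => integrable_finsetSum _ fun i _ => hI i j]
    rw [Finset.sum_eq_zero, mul_zero]
    intro j _
    rw [integral_finsetSum _ fun i _ => hI i j]
    refine Finset.sum_eq_zero fun i _ => ?_
    split_ifs with hij
    · simp
    · exact integral_rotationIntegrand hN hpos hij
  rw [← h0]
  refine integral_mono ((integrable_finsetSum _ fun j _ =>
    integrable_finsetSum _ fun i _ => hI i j).const_mul _)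
    (continuous_prod_sqrt_mul_sum_div hpos).integrable_of_compactSpace fun v => ?_
  have key := sum_rotation_le_sum_jacobi (sum_coord_sq_of_unitSphere v)
    (fun k => (h k).derivative.eval (v.1 k) / (h k).eval (v.1 k))
    (fun k => (h k).derivative.derivative.eval (v.1 k) / (h k).eval (v.1 k))
  have hW : 0 ≤ ∏ k, √((h k).eval (v.1 k)) := Finset.prod_nonneg fun k _ => Real.sqrt_nonneg _
  have key2 := mul_le_mul_of_nonneg_left key hW
  calc _ = 2⁻¹ * ((∏ k, √((h k).eval (v.1 k))) * _) := by
        congr 1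
        rw [Finset.mul_sum]
        refine Finset.sum_congr rfl fun j _ => ?_
        rw [Finset.mul_sum]
        refine Finset.sum_congr rfl fun i _ => ?_
        rw [mul_ite, mul_zero]
        rfl
    _ ≤ _ := mul_le_mul_of_nonneg_left key2 (by norm_num)
    _ = _ := by
        rw [mul_left_comm]
        congr 2
        refine Finset.sum_congr rfl fun j _ => ?_
        rw [eval_jacobiOp, sub_div, mul_div_assoc, mul_div_assoc, mul_div_assoc]

theorem integral_prod_sqrt_le_of_isJacobiFlow {N : ℕ} (hN : 2 ≤ N) {P : Fin N → ℝ → ℝ[X]}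
    (hP : ∀ k, IsJacobiFlow (N - 1) (P k))
    (hpos : ∀ k, ∀ x ∈ Icc (-1 : ℝ) 1, 0 < (P k 0).eval x) {T : ℝ} (hT : 0 ≤ T) :
    ∫ v : UnitSphere N, ∏ k, √((P k 0).eval (v.1 k)) ∂(sphereUniform N) ≤
      ∫ v : UnitSphere N, ∏ k, √((P k T).eval (v.1 k)) ∂(sphereUniform N) := by
  have := isProbabilityMeasure_sphereUniform hN
  have hb : (0 : ℝ) ≤ (N : ℝ) - 1 := by
    have : (2 : ℝ) ≤ N := by exact_mod_cast hN
    linarith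
  have hpos' : ∀ k, ∀ t, 0 ≤ t → ∀ x ∈ Icc (-1 : ℝ) 1, 0 < (P k t).eval x := by
    intro k t ht x hx
    obtain ⟨x₀, hx₀, hmin⟩ := isCompact_Icc.exists_isMinOn
      (⟨0, by norm_num⟩ : (Icc (-1 : ℝ) 1).Nonempty) (P k 0).continuous.continuousOn
    exact (hpos k x₀ hx₀).trans_le ((hP k).le_eval hb (fun y hy => hmin hy) ht hx)
  have hint : ∀ t, Integrable (fun v : UnitSphere N => ∏ k, √((P k t).eval (v.1 k)))
      (sphereUniform N) := fun t => by
    apply Continuous.integrable_of_compactSpace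
    have := fun k => (P k t).continuous
    fun_prop
  have key := integral_sub_eq_intervalIntegral_integral (μ := sphereUniform N) hT
    (g := fun t v => ∏ k, √((P k t).eval (v.1 k)))
    (g' := fun t v => (∏ k, √((P k t).eval (v.1 k))) *
      (2⁻¹ * ∑ k, (jacobiOp (N - 1) (P k t)).eval (v.1 k) / (P k t).eval (v.1 k)))
    (fun t ht v => HasDerivAt.prod_sqrt (u := fun k s => (P k s).eval (v.1 k))
      (fun k => (hP k).hasDerivAt t _) fun k => hpos' k t ht.1 _ (coord_mem_Icc_of_unitSphere v k))
    ?_ (hint 0) (hint T)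
  · rw [← sub_nonneg, key]
    refine intervalIntegral.integral_nonneg hT fun t ht => ?_
    exact integral_prod_sqrt_mul_sum_jacobiOp_nonneg hN fun k => hpos' k t ht.1
  · have hc : ∀ k, Continuous fun p : ℝ × UnitSphere N => (p.1, p.2.1 k) := fun k => by fun_prop
    have h0 := fun k => ((hP k).continuous_eval.comp (hc k)).continuousOn (s := Icc 0 T ×ˢ univ)
    have h1 := fun k => ((hP k).continuous_eval_jacobiOp.comp (hc k)).continuousOn
      (s := Icc 0 T ×ˢ univ)
    refine (continuousOn_finsetProd Finset.univ fun k _ => (h0 k).sqrt).mul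
      (continuousOn_const.mul (continuousOn_finsetSum Finset.univ fun k _ =>
        (h1 k).div (h0 k) fun p hp => ?_))
    exact (hpos' k _ hp.1.1 _ (coord_mem_Icc_of_unitSphere p.2 k)).ne'

theorem integral_jacobiOp_coord {N : ℕ} (hN : 2 ≤ N) (p : ℝ[X]) (j : Fin N) :
    ∫ v : UnitSphere N, (jacobiOp (N - 1) p).eval (v.1 j) ∂(sphereUniform N) = 0 := by
  have := isProbabilityMeasure_sphereUniform hN
  have hp := fun q : ℝ[X] => q.continuous
  have hcont : ∀ i, Continuous fun v : EuclideanSpace ℝ (Fin N) =>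
      v i ^ 2 * p.derivative.derivative.eval (v j) - v j * p.derivative.eval (v j) :=
    fun i => by fun_prop
  have hI : ∀ i ∈ Finset.univ.erase j, Integrable (fun v : UnitSphere N =>
      v.1 i ^ 2 * p.derivative.derivative.eval (v.1 j) - v.1 j * p.derivative.eval (v.1 j))
      (sphereUniform N) := fun i _ =>
    ((hcont i).comp continuous_subtype_val).integrable_of_compactSpace
  have h0 : ∀ i ∈ Finset.univ.erase j, ∫ v : UnitSphere N, (v.1 i ^ 2 *
      p.derivative.derivative.eval (v.1 j) - v.1 j * p.derivative.eval (v.1 j))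
      ∂(sphereUniform N) = 0 := fun i hi => by
    have hij : i ≠ j := Finset.ne_of_mem_erase hi
    refine integral_rotationField_eq_zero hN hij (G := fun v => v i * p.derivative.eval (v j))
      (Continuous.continuousOn (by fun_prop)) (hcont i).continuousOn fun c t _ hd => ?_
    have hi : HasDerivAt (fun s => c s i) (- c t j) t := by simpa using hd i
    have hj : HasDerivAt (fun s => c s j) (c t i) t := by simpa [hij.symm] using hd j
    refine (hi.mul ((p.derivative.hasDerivAt (c t j)).comp t hj)).congr_deriv ?_
    simp only [Function.comp_apply]
    ring
  rw [← Finset.sum_eq_zero h0, ← integral_finsetSum _ hI]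
  refine integral_congr_ae (ae_of_all _ fun v => ?_)
  simp only
  rw [eval_jacobiOp, Finset.sum_sub_distrib, ← Finset.sum_mul,
    Finset.sum_erase_eq_sub (Finset.mem_univ j), sum_coord_sq_of_unitSphere v, Finset.sum_const,
    Finset.card_erase_of_mem (Finset.mem_univ j), Finset.card_univ, Fintype.card_fin,
    nsmul_eq_mul, Nat.cast_sub (by omega), Nat.cast_one]

theorem exists_isJacobiFlow_tendsto_integral {N : ℕ} (hN : 2 ≤ N) (p : ℝ[X]) (j : Fin N) :
    ∃ P : ℝ → ℝ[X], ∃ B : ℝ → ℝ, P 0 = p ∧ IsJacobiFlow (N - 1) P ∧ Continuous B ∧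
      (∀ t, 0 ≤ t → ∀ x, (P t).eval x ≤ B x) ∧
      ∀ x, Tendsto (fun t => (P t).eval x) atTop
        (𝓝 (∫ v : UnitSphere N, p.eval (v.1 j) ∂(sphereUniform N))) := by
  have := isProbabilityMeasure_sphereUniform hN
  have hb : (0 : ℝ) < (N : ℝ) - 1 := by
    have : (2 : ℝ) ≤ N := by exact_mod_cast hN
    linarith
  obtain ⟨a, hpa, ha⟩ := exists_eq_sum_jacobiOp_eigenvectors hb (p.natDegree + 1) p
    fun k hk => coeff_eq_zero_of_natDegree_lt (by omega)
  have hlam0 : jacobiEigenvalue (N - 1) 0 = 0 := by simp [jacobiEigenvalue]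
  have hlam : ∀ m ≠ 0, 0 < jacobiEigenvalue (N - 1) m := fun m hm => by
    simpa [hlam0] using jacobiEigenvalue_strictMono hb (Nat.pos_of_ne_zero hm)
  have hlam' : ∀ m, 0 ≤ jacobiEigenvalue (N - 1) m := fun m => by
    rcases eq_or_ne m 0 with rfl | hm
    · exact hlam0.ge
    · exact (hlam m hm).le
  have ha0 := eq_C_of_jacobiOp_eq_zero hb (by rw [ha 0, hlam0]; simp)
  have hint : ∀ m, Integrable (fun v : UnitSphere N => (a m).eval (v.1 j)) (sphereUniform N) :=
    fun m => by
      apply Continuous.integrable_of_compactSpace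
      have := (a m).continuous
      fun_prop
  have hmean : ∀ m ≠ 0, ∫ v : UnitSphere N, (a m).eval (v.1 j) ∂(sphereUniform N) = 0 := by
    intro m hm
    have h := integral_jacobiOp_coord hN (a m) j
    simp only [ha m, eval_smul, smul_eq_mul] at h
    rw [integral_const_mul] at h
    exact (mul_eq_zero.1 h).resolve_left (neg_ne_zero.2 (hlam m hm).ne')
  have hp : ∫ v : UnitSphere N, p.eval (v.1 j) ∂(sphereUniform N) = (a 0).coeff 0 := by
    conv_lhs => rw [hpa]
    simp only [eval_finsetSum]
    rw [integral_finsetSum _ fun m _ => hint m, Finset.sum_eq_single 0]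
    · rw [ha0]; simp
    · exact fun m _ hm => hmean m hm
    · simp
  refine ⟨jacobiFlow (N - 1) (p.natDegree + 1) a,
    fun x => ∑ m ∈ Finset.range (p.natDegree + 1), |(a m).eval x|, ?_,
    isJacobiFlow_jacobiFlow ha, ?_, fun t ht x => ?_, fun x => ?_⟩
  · conv_rhs => rw [hpa]
    simp [jacobiFlow]
  · have := fun m => (a m).continuous
    fun_prop
  · rw [eval_jacobiFlow]
    refine Finset.sum_le_sum fun m _ => (le_abs_self _).trans ?_
    rw [abs_mul, Real.abs_exp]
    refine mul_le_of_le_one_left (abs_nonneg _) (Real.exp_le_one_iff.2 ?_)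
    rw [neg_mul]
    exact neg_nonpos.2 (mul_nonneg (hlam' m) ht)
  · rw [hp]
    have hsum : (a 0).coeff 0 = ∑ m ∈ Finset.range (p.natDegree + 1),
        if m = 0 then (a 0).coeff 0 else 0 := by simp
    rw [hsum]
    simp only [eval_jacobiFlow]
    refine tendsto_finsetSum _ fun m _ => ?_
    split_ifs with hm
    · subst hm
      rw [hlam0, ha0]
      simp
    · have h1 : Tendsto (fun t : ℝ => -jacobiEigenvalue (N - 1) m * t) atTop atBot :=
        tendsto_id.const_mul_atTop_of_neg (neg_lt_zero.2 (hlam m hm))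
      simpa using (Real.tendsto_exp_atBot.comp h1).mul_const ((a m).eval x)

theorem integral_prod_sqrt_polynomial_le {N : ℕ} (hN : 2 ≤ N) {h : Fin N → ℝ[X]}
    (hpos : ∀ k, ∀ x ∈ Icc (-1 : ℝ) 1, 0 < (h k).eval x) :
    ∫ v : UnitSphere N, ∏ k, √((h k).eval (v.1 k)) ∂(sphereUniform N) ≤
      ∏ k, √(∫ v : UnitSphere N, (h k).eval (v.1 k) ∂(sphereUniform N)) := by
  have := isProbabilityMeasure_sphereUniform hN
  choose P B hP0 hP hB hPB hlim using fun k => exists_isJacobiFlow_tendsto_integral hN (h k) k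
  have hle : ∀ T : ℝ, 0 ≤ T → ∫ v : UnitSphere N, ∏ k, √((h k).eval (v.1 k)) ∂(sphereUniform N) ≤
      ∫ v : UnitSphere N, ∏ k, √((P k T).eval (v.1 k)) ∂(sphereUniform N) := fun T hT => by
    have := integral_prod_sqrt_le_of_isJacobiFlow hN hP (by simpa only [hP0] using hpos) hT
    simpa only [hP0] using this
  have hT : Tendsto (fun T => ∫ v : UnitSphere N, ∏ k, √((P k T).eval (v.1 k)) ∂(sphereUniform N))
      atTop (𝓝 (∫ _ : UnitSphere N, ∏ k,
        √(∫ v : UnitSphere N, (h k).eval (v.1 k) ∂(sphereUniform N)) ∂(sphereUniform N))) := by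
    refine tendsto_integral_filter_of_dominated_convergence
      (fun v => ∏ k, √(B k (v.1 k))) ?_ ?_ ?_ ?_
    · refine Eventually.of_forall fun T => Continuous.aestronglyMeasurable ?_
      have := fun k => (P k T).continuous
      fun_prop
    · filter_upwards [eventually_ge_atTop 0] with T hT
      refine ae_of_all _ fun v => ?_
      rw [Real.norm_of_nonneg (Finset.prod_nonneg fun k _ => Real.sqrt_nonneg _)]
      exact Finset.prod_le_prod (fun k _ => Real.sqrt_nonneg _)
        fun k _ => Real.sqrt_le_sqrt (hPB k T hT _)
    · apply Continuous.integrable_of_compactSpace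
      fun_prop
    · exact ae_of_all _ fun v => tendsto_finsetProd _ fun k _ => (hlim k _).sqrt
  rw [integral_const, probReal_univ, one_smul] at hT
  exact ge_of_tendsto hT ((eventually_ge_atTop 0).mono hle)

theorem integral_prod_sqrt_continuous_le {N : ℕ} (hN : 2 ≤ N) {h : Fin N → ℝ → ℝ}
    (hc : ∀ k, Continuous (h k)) (h0 : ∀ k x, 0 ≤ h k x) :
    ∫ v : UnitSphere N, ∏ k, √(h k (v.1 k)) ∂(sphereUniform N) ≤
      ∏ k, √(∫ v : UnitSphere N, h k (v.1 k) ∂(sphereUniform N)) := by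
  have := isProbabilityMeasure_sphereUniform hN
  have hint : ∀ k, Integrable (fun v : UnitSphere N => h k (v.1 k)) (sphereUniform N) :=
    fun k => by
      apply Continuous.integrable_of_compactSpace
      have := hc k
      fun_prop
  have key : ∀ ε : ℝ, 0 < ε → ∫ v : UnitSphere N, ∏ k, √(h k (v.1 k)) ∂(sphereUniform N) ≤
      ∏ k, √((∫ v : UnitSphere N, h k (v.1 k) ∂(sphereUniform N)) + 3 * ε) := by
    intro ε hε
    choose p hp using fun k => exists_polynomial_near_of_continuousOn (-1) 1
      (fun x => h k x + 2 * ε) ((hc k).add continuous_const).continuousOn ε hε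
    have hlow : ∀ k, ∀ x ∈ Icc (-1 : ℝ) 1, h k x + ε < (p k).eval x := fun k x hx => by
      have := abs_lt.1 (hp k x hx)
      linarith [this.1]
    have hup : ∀ k, ∀ x ∈ Icc (-1 : ℝ) 1, (p k).eval x < h k x + 3 * ε := fun k x hx => by
      have := abs_lt.1 (hp k x hx)
      linarith [this.2]
    have hpint : ∀ k, Integrable (fun v : UnitSphere N => (p k).eval (v.1 k)) (sphereUniform N) :=
      fun k => by
        apply Continuous.integrable_of_compactSpace
        have := (p k).continuous
        fun_prop
    calc _ ≤ ∫ v : UnitSphere N, ∏ k, √((p k).eval (v.1 k)) ∂(sphereUniform N) := by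
          refine integral_mono (Continuous.integrable_of_compactSpace (by fun_prop))
            (Continuous.integrable_of_compactSpace ?_) fun v => ?_
          · have := fun k => (p k).continuous
            fun_prop
          · refine Finset.prod_le_prod (fun k _ => Real.sqrt_nonneg _)
              fun k _ => Real.sqrt_le_sqrt ?_
            have := hlow k _ (coord_mem_Icc_of_unitSphere v k)
            linarith
      _ ≤ ∏ k, √(∫ v : UnitSphere N, (p k).eval (v.1 k) ∂(sphereUniform N)) :=
          integral_prod_sqrt_polynomial_le hN fun k x hx => by
            have := hlow k x hx
            have := h0 k x
            linarith
      _ ≤ _ := by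
          refine Finset.prod_le_prod (fun k _ => Real.sqrt_nonneg _)
            fun k _ => Real.sqrt_le_sqrt ?_
          have := integral_mono (hpint k) ((hint k).add (integrable_const (3 * ε)))
            fun v => (hup k _ (coord_mem_Icc_of_unitSphere v k)).le
          simp only [Pi.add_apply] at this
          rwa [integral_add (hint k) (integrable_const _), integral_const, probReal_univ,
            one_smul] at this
  have hlim : Tendsto (fun ε : ℝ =>
      ∏ k, √((∫ v : UnitSphere N, h k (v.1 k) ∂(sphereUniform N)) + 3 * ε)) (𝓝[>] 0)
      (𝓝 (∏ k, √((∫ v : UnitSphere N, h k (v.1 k) ∂(sphereUniform N)) + 3 * 0))) :=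
    (Continuous.tendsto (by fun_prop) 0).mono_left nhdsWithin_le_nhds
  simp only [mul_zero, add_zero] at hlim
  refine ge_of_tendsto hlim ?_
  filter_upwards [self_mem_nhdsWithin] with ε hε using key ε hε

theorem exists_continuous_nonneg_tendsto_ae {ν : Measure ℝ} [IsFiniteMeasure ν] {g : ℝ → ℝ}
    (hg : Integrable g ν) (h0 : ∀ x, 0 ≤ g x) : ∃ φ : ℕ → ℝ → ℝ, (∀ n, Continuous (φ n)) ∧
      (∀ n x, 0 ≤ φ n x) ∧ (∀ᵐ x ∂ν, Tendsto (fun n => φ n x) atTop (𝓝 (g x))) ∧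
      Tendsto (fun n => ∫ x, φ n x ∂ν) atTop (𝓝 (∫ x, g x ∂ν)) := by
  have hε : ∀ n : ℕ, (0 : ℝ) < 1 / (n + 1) := fun n => Nat.one_div_pos_of_nat
  choose ψ hψ hψi using fun n : ℕ => hg.exists_boundedContinuous_integral_sub_le (hε n)
  set φ : ℕ → ℝ → ℝ := fun n x => max (ψ n x) 0 with hφ
  have hφi : ∀ n, Integrable (φ n) ν := fun n => (hψi n).pos_part
  have hle : ∀ n, ∫ x, ‖φ n x - g x‖ ∂ν ≤ 1 / (n + 1) := fun n => by
    refine le_trans (integral_mono ((hφi n).sub hg).norm (hg.sub (hψi n)).norm fun x => ?_) (hψ n)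
    simp only [hφ, Pi.sub_apply, Real.norm_eq_abs]
    have h1 := abs_max_sub_max_le_abs (ψ n x) (g x) 0
    rwa [max_eq_left (h0 x), abs_sub_comm (ψ n x)] at h1
  have hL1 : Tendsto (fun n => ∫ x, ‖φ n x - g x‖ ∂ν) atTop (𝓝 0) :=
    squeeze_zero (fun n => integral_nonneg fun x => norm_nonneg _) hle
      tendsto_one_div_add_atTop_nhds_zero_nat
  have hL1' : Tendsto (fun n => eLpNorm (φ n - g) 1 ν) atTop (𝓝 0) := by
    have := ENNReal.tendsto_ofReal hL1
    rw [ENNReal.ofReal_zero] at this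
    refine this.congr fun n => ?_
    rw [eLpNorm_one_eq_lintegral_enorm]
    exact ofReal_integral_norm_eq_lintegral_enorm ((hφi n).sub hg)
  obtain ⟨ns, hns, hae⟩ := (tendstoInMeasure_of_tendsto_eLpNorm one_ne_zero
    (fun n => (hφi n).aestronglyMeasurable) hg.aestronglyMeasurable hL1').exists_seq_tendsto_ae
  refine ⟨fun n => φ (ns n), fun n => ?_, fun n x => le_max_right _ _, hae, ?_⟩
  · exact (ψ (ns n)).continuous.max continuous_const
  · have h1 := tendsto_integral_of_L1' g hg.aestronglyMeasurable (Eventually.of_forall hφi) hL1'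
    exact h1.comp hns.tendsto_atTop

theorem lintegral_prod_sqrt_le {N : ℕ} (hN : 2 ≤ N) {h : Fin N → ℝ → ℝ}
    (hm : ∀ k, Measurable (h k)) (h0 : ∀ k x, 0 ≤ h k x)
    (hint : ∀ k, Integrable (fun v : UnitSphere N => h k (v.1 k)) (sphereUniform N)) :
    ∫⁻ v : UnitSphere N, ENNReal.ofReal (∏ k, √(h k (v.1 k))) ∂(sphereUniform N) ≤
      ENNReal.ofReal (∏ k, √(∫ v : UnitSphere N, h k (v.1 k) ∂(sphereUniform N))) := by
  have := isProbabilityMeasure_sphereUniform hN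
  have hcoord : ∀ k : Fin N, Measurable fun v : UnitSphere N => v.1 k := fun k => by fun_prop
  have hmap : ∀ k (f : ℝ → ℝ), Measurable f → ∫ x, f x ∂((sphereUniform N).map fun v => v.1 k) =
      ∫ v : UnitSphere N, f (v.1 k) ∂(sphereUniform N) := fun k f hf =>
    integral_map (hcoord k).aemeasurable hf.aestronglyMeasurable
  have hgi : ∀ k, Integrable (h k) ((sphereUniform N).map fun v => v.1 k) := fun k =>
    (integrable_map_measure (hm k).aestronglyMeasurable (hcoord k).aemeasurable).2 (hint k)
  choose φ hφc hφ0 hφae hφi using fun k =>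
    exists_continuous_nonneg_tendsto_ae (hgi k) (h0 k)
  have hae : ∀ᵐ v : UnitSphere N ∂(sphereUniform N), ∀ k,
      Tendsto (fun n => φ k n (v.1 k)) atTop (𝓝 (h k (v.1 k))) :=
    ae_all_iff.2 fun k => ae_of_ae_map (hcoord k).aemeasurable (hφae k)
  have hle : ∀ n, ∫⁻ v : UnitSphere N, ENNReal.ofReal (∏ k, √(φ k n (v.1 k))) ∂(sphereUniform N) ≤
      ENNReal.ofReal (∏ k, √(∫ x, φ k n x ∂((sphereUniform N).map fun v => v.1 k))) := fun n => by
    rw [← ofReal_integral_eq_lintegral_ofReal]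
    · refine ENNReal.ofReal_le_ofReal ?_
      simp only [fun k => hmap k (φ k n) (hφc k n).measurable]
      exact integral_prod_sqrt_continuous_le hN (fun k => hφc k n) fun k => hφ0 k n
    · apply Continuous.integrable_of_compactSpace
      have := fun k => hφc k n
      fun_prop
    · exact ae_of_all _ fun v => Finset.prod_nonneg fun k _ => Real.sqrt_nonneg _
  calc ∫⁻ v : UnitSphere N, ENNReal.ofReal (∏ k, √(h k (v.1 k))) ∂(sphereUniform N)
      = ∫⁻ v : UnitSphere N, liminf (fun n => ENNReal.ofReal (∏ k, √(φ k n (v.1 k)))) atTop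
          ∂(sphereUniform N) := by
        refine lintegral_congr_ae ?_
        filter_upwards [hae] with v hv
        exact (ENNReal.tendsto_ofReal
          (tendsto_finsetProd _ fun k _ => (hv k).sqrt)).liminf_eq.symm
    _ ≤ liminf (fun n => ∫⁻ v : UnitSphere N, ENNReal.ofReal (∏ k, √(φ k n (v.1 k)))
          ∂(sphereUniform N)) atTop := by
        refine lintegral_liminf_le fun n => ENNReal.measurable_ofReal.comp ?_
        have := fun k => (hφc k n).measurable
        fun_prop
    _ ≤ liminf (fun n => ENNReal.ofReal
          (∏ k, √(∫ x, φ k n x ∂((sphereUniform N).map fun v => v.1 k)))) atTop :=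
        liminf_le_liminf (Eventually.of_forall hle)
    _ = _ := by
        simp only [← fun k => hmap k (h k) (hm k)]
        exact (ENNReal.tendsto_ofReal
          (tendsto_finsetProd _ fun k _ => (hφi k).sqrt)).liminf_eq

theorem integrable_mul_and_integral_mul_eq_of_condExp {Ω : Type*} {m m0 : MeasurableSpace Ω}
    {μ : Measure Ω} [IsFiniteMeasure μ] (hm : m ≤ m0) {F φ : Ω → ℝ} (hF : Measurable F)
    (hF0 : ∀ x, 0 ≤ F x) (hFi : Integrable F μ) (hφ : StronglyMeasurable[m] φ)
    (hi : Integrable (fun x => (μ[F | m]) x * φ x) μ) :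
    Integrable (fun x => F x * φ x) μ ∧
      ∫ x, F x * φ x ∂μ = ∫ x, (μ[F | m]) x * φ x ∂μ := by
  set f := μ[F | m] with hf
  have hfm : Measurable f := (stronglyMeasurable_condExp.mono hm).measurable
  have hf0 : 0 ≤ᵐ[μ] f := condExp_nonneg (ae_of_all _ hF0)
  have hfi : Integrable f μ := integrable_condExp
  have htrim : (μ.withDensity fun x => ENNReal.ofReal (F x)).trim hm =
      (μ.withDensity fun x => ENNReal.ofReal (f x)).trim hm := by
    refine @Measure.ext _ m _ _ fun s hs => ?_
    rw [trim_measurableSet_eq hm hs, trim_measurableSet_eq hm hs, withDensity_apply _ (hm s hs),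
      withDensity_apply _ (hm s hs),
      ← ofReal_integral_eq_lintegral_ofReal hFi.integrableOn (ae_of_all _ hF0),
      ← ofReal_integral_eq_lintegral_ofReal hfi.integrableOn (ae_restrict_of_ae hf0),
      setIntegral_condExp hm hFi hs]
  have hφf : Integrable φ (μ.withDensity fun x => ENNReal.ofReal (f x)) := by
    rw [integrable_withDensity_iff_integrable_smul' hfm.ennreal_ofReal
      (ae_of_all _ fun _ => ENNReal.ofReal_lt_top)]
    refine hi.congr ?_
    filter_upwards [hf0] with x hx
    rw [ENNReal.toReal_ofReal hx, smul_eq_mul]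
  have hφF : Integrable φ (μ.withDensity fun x => ENNReal.ofReal (F x)) := by
    apply integrable_of_integrable_trim hm
    rw [htrim]
    exact hφf.trim hm hφ
  constructor
  · rw [integrable_withDensity_iff_integrable_smul' hF.ennreal_ofReal
      (ae_of_all _ fun _ => ENNReal.ofReal_lt_top)] at hφF
    refine hφF.congr (ae_of_all _ fun x => ?_)
    simp only [ENNReal.toReal_ofReal (hF0 x), smul_eq_mul]
  · have h1 : ∫ x, φ x ∂(μ.withDensity fun x => ENNReal.ofReal (F x)) =
        ∫ x, φ x ∂(μ.withDensity fun x => ENNReal.ofReal (f x)) := by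
      rw [integral_trim hm hφ, htrim, ← integral_trim hm hφ]
    rw [integral_withDensity_eq_integral_toReal_smul hF.ennreal_ofReal
        (ae_of_all _ fun _ => ENNReal.ofReal_lt_top),
      integral_withDensity_eq_integral_toReal_smul hfm.ennreal_ofReal
        (ae_of_all _ fun _ => ENNReal.ofReal_lt_top)] at h1
    have h2 : ∫ x, (ENNReal.ofReal (f x)).toReal • φ x ∂μ = ∫ x, f x * φ x ∂μ := by
      refine integral_congr_ae ?_
      filter_upwards [hf0] with x hx
      rw [ENNReal.toReal_ofReal hx, smul_eq_mul]
    rw [← h2, ← h1]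
    simp only [ENNReal.toReal_ofReal (hF0 _), smul_eq_mul]

theorem ae_eq_zero_or_pos_condExp {Ω : Type*} {m m0 : MeasurableSpace Ω}
    {μ : Measure Ω} [IsFiniteMeasure μ] (hm : m ≤ m0) {F : Ω → ℝ}
    (hF0 : ∀ x, 0 ≤ F x) (hFi : Integrable F μ) :
    ∀ᵐ x ∂μ, F x = 0 ∨ 0 < (μ[F | m]) x := by
  have hfm : StronglyMeasurable[m] (μ[F | m]) := stronglyMeasurable_condExp
  have hs : MeasurableSet[m] {x | (μ[F | m]) x ≤ 0} := hfm.measurable measurableSet_Iic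
  have h0 : ∫ x in {x | (μ[F | m]) x ≤ 0}, F x ∂μ = 0 := by
    refine le_antisymm ?_ (integral_nonneg hF0)
    rw [← setIntegral_condExp hm hFi hs]
    exact setIntegral_nonpos (hm _ hs) fun x hx => hx
  rw [integral_eq_zero_iff_of_nonneg hF0 hFi.integrableOn, Filter.EventuallyEq,
    ae_restrict_iff' (hm _ hs)] at h0
  filter_upwards [h0] with x hx
  by_cases h : (μ[F | m]) x ≤ 0
  · exact Or.inl (hx h)
  · exact Or.inr (not_le.1 h)

theorem mul_sum_log_sub_mul_log_le {ι : Type*} [Fintype ι] {a : ℝ} {y : ι → ℝ} (ha : 0 ≤ a)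
    (hy : ∀ k, a = 0 ∨ 0 < y k) :
    2⁻¹ * ∑ k, a * Real.log (y k) - a * Real.log a ≤ (∏ k, √(y k)) - a := by
  rcases ha.eq_or_lt with rfl | ha
  · simpa using Finset.prod_nonneg fun k _ => Real.sqrt_nonneg (y k)
  have hy' : ∀ k, 0 < y k := fun k => (hy k).resolve_left ha.ne'
  have hW : 0 < ∏ k, √(y k) := Finset.prod_pos fun k _ => Real.sqrt_pos.2 (hy' k)
  have h1 := Real.log_le_sub_one_of_pos (div_pos hW ha)
  rw [Real.log_div hW.ne' ha.ne', Real.log_prod fun k _ => (Real.sqrt_pos.2 (hy' k)).ne',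
    Finset.sum_congr rfl fun k _ => Real.log_sqrt (hy' k).le, ← Finset.sum_div] at h1
  have h2 := mul_le_mul_of_nonneg_left h1 ha.le
  rw [mul_sub, mul_sub, mul_div_cancel₀ _ ha.ne'] at h2
  rw [← Finset.mul_sum]
  linarith

/-- spherical subadditivity of the entropy with the sharp constant 2:
for a probability density `F` on `S^{N-1}` with marginals `f_j = E[F | v_j]`,
`∑_j S(f_j) ≤ 2 S(F)`. -/
theorem sphere_entropy_subadditivity (N : ℕ) (hN : 2 ≤ N)
    (F : Metric.sphere (0 : EuclideanSpace ℝ (Fin N)) 1 → ℝ)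
    (hFmeas : Measurable F) (hFpos : ∀ v, 0 ≤ F v)
    (hFint : Integrable F (sphereUniform N))
    (hFprob : (∫ v, F v ∂(sphereUniform N)) = 1)
    (hFent : Integrable (fun v => F v * Real.log (F v)) (sphereUniform N))
    (f : Fin N → Metric.sphere (0 : EuclideanSpace ℝ (Fin N)) 1 → ℝ)
    (hf : ∀ j, f j = (sphereUniform N)[F | coordSigma N j])
    (hfent : ∀ j, Integrable (fun v => f j v * Real.log (f j v)) (sphereUniform N)) :
    ∑ j, (∫ v, f j v * Real.log (f j v) ∂(sphereUniform N)) ≤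
      2 * ∫ v, F v * Real.log (F v) ∂(sphereUniform N) := by
  have := isProbabilityMeasure_sphereUniform hN
  have hm : ∀ j, coordSigma N j ≤ Subtype.instMeasurableSpace := fun j =>
    Measurable.comap_le (by fun_prop)
  have hfm : ∀ j, StronglyMeasurable[coordSigma N j] (f j) := fun j => by
    rw [hf j]
    exact stronglyMeasurable_condExp
  have hfi : ∀ j, Integrable (f j) (sphereUniform N) := fun j => by
    rw [hf j]
    exact integrable_condExp
  have hf0 : ∀ j, 0 ≤ᵐ[sphereUniform N] f j := fun j => by
    rw [hf j]
    exact condExp_nonneg (ae_of_all _ hFpos)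
  have hf1 : ∀ j, ∫ v, f j v ∂(sphereUniform N) = 1 := fun j => by
    rw [hf j, integral_condExp (hm j), hFprob]
  choose g hgm hg using fun j => (hfm j).measurable.exists_eq_measurable_comp
  have hgf : ∀ j, (fun v : UnitSphere N => max (g j (v.1 j)) 0) =ᵐ[sphereUniform N] f j := by
    intro j
    filter_upwards [hf0 j] with v hv
    have hv' : f j v = g j (v.1 j) := congrFun (hg j) v
    have hv0 : 0 ≤ f j v := hv
    rw [← hv', max_eq_left hv0]
  have hprod : ∫⁻ v, ENNReal.ofReal (∏ j, √(f j v)) ∂(sphereUniform N) ≤ 1 := by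
    have h := lintegral_prod_sqrt_le hN (h := fun j x => max (g j x) 0)
      (fun j => (hgm j).max measurable_const) (fun j x => le_max_right _ _)
      fun j => (hfi j).congr (hgf j).symm
    simp only [integral_congr_ae (hgf _), hf1, Real.sqrt_one, Finset.prod_const_one,
      ENNReal.ofReal_one] at h
    refine le_of_eq_of_le (lintegral_congr_ae ?_) h
    filter_upwards [ae_all_iff.2 hgf] with v hv
    simp only [hv]
  have hprod0 : ∀ v, 0 ≤ ∏ j, √(f j v) := fun v =>
    Finset.prod_nonneg fun j _ => Real.sqrt_nonneg _
  have hprodm : Measurable fun v => ∏ j, √(f j v) := by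
    have := fun j => ((hfm j).mono (hm j)).measurable
    fun_prop
  have hprodi : Integrable (fun v => ∏ j, √(f j v)) (sphereUniform N) := by
    refine ⟨hprodm.aestronglyMeasurable, ?_⟩
    rw [hasFiniteIntegral_iff_ofReal (ae_of_all _ hprod0)]
    exact hprod.trans_lt ENNReal.one_lt_top
  have hprod1 : ∫ v, ∏ j, √(f j v) ∂(sphereUniform N) ≤ 1 := by
    rw [integral_eq_lintegral_of_nonneg_ae (ae_of_all _ hprod0) hprodm.aestronglyMeasurable]
    exact ENNReal.toReal_le_of_le_ofReal zero_le_one (by simpa using hprod)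
  have hlog : ∀ j, Integrable (fun v => F v * Real.log (f j v)) (sphereUniform N) ∧
      ∫ v, F v * Real.log (f j v) ∂(sphereUniform N) =
        ∫ v, f j v * Real.log (f j v) ∂(sphereUniform N) := fun j => by
    have hφ : StronglyMeasurable[coordSigma N j] fun v => Real.log (f j v) :=
      (Real.measurable_log.comp (hfm j).measurable).stronglyMeasurable
    have h := integrable_mul_and_integral_mul_eq_of_condExp (hm j) hFmeas hFpos hFint hφ
      (by rw [← hf j]; exact hfent j)
    rwa [← hf j] at h
  have hsum := integrable_finsetSum Finset.univ fun j _ => (hlog j).1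
  have hpt : ∀ᵐ v ∂(sphereUniform N), 2⁻¹ * ∑ j, F v * Real.log (f j v) -
      F v * Real.log (F v) ≤ (∏ j, √(f j v)) - F v := by
    have h : ∀ j, ∀ᵐ v ∂(sphereUniform N), F v = 0 ∨ 0 < f j v := fun j => by
      rw [hf j]
      exact ae_eq_zero_or_pos_condExp (hm j) hFpos hFint
    filter_upwards [ae_all_iff.2 h] with v hv
    exact mul_sum_log_sub_mul_log_le (hFpos v) hv
  have key := integral_mono_ae ((hsum.const_mul 2⁻¹).sub hFent) (hprodi.sub hFint) hpt
  simp only [Pi.sub_apply] at key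
  rw [integral_sub (hsum.const_mul 2⁻¹) hFent, integral_sub hprodi hFint, integral_const_mul,
    integral_finsetSum _ fun j _ => (hlog j).1, Finset.sum_congr rfl fun j _ => (hlog j).2,
    hFprob] at key
  linarith
end
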